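/- Let d≥2 and m∈{1,…,d} be integers, let d_1,…,d_m be positive integers with d_1+…+d_m=d, and let β_1,…,β_m≥0. Let X_1,…,X_n be i.i.d. block-beta distributed random points in Z_𝕕=B_2^{d_1}×…×B_2^{d_m} and P_n^β=conv{X_1,…,X_n}. Set k_i=(d_i+β_i)/(1+β_i) for i∈{1,…,m}, k_max=max_{i} k_i and #k_max=#{i : k_i=k_max}. Then E f_{d−1}(P_n^β) ≍ n^{(k_max−1)/(k_max+1)} (ln n)^{#k_max−1}, i.e. there exist constants 0<c≤C depending only on (d_1,…,d_m) and (β_1,…,β_m) such that c ≤ liminf_{n→∞} E f_{d−1}(P_n^β)/(n^{(k_max−1)/(k_max+1)}(ln n)^{#k_max−1}) and the corresponding limsup is at most C. -/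

import Mathlib

open MeasureTheory Filter

noncomputable section

/-- Normalizing constant `c_{β,k}` of the beta density on the unit ball of `ℝ^k`. -/
def betaConst (β : ℝ) (k : ℕ) : ℝ :=
  Real.Gamma ((k : ℝ) / 2 + β + 1) / (Real.pi ^ ((k : ℝ) / 2) * Real.Gamma (β + 1))

/-- The beta density with parameter `β` on the unit ball of `ℝ^k` (extended by `0`). -/
def betaDensity (β : ℝ) (k : ℕ) (y : EuclideanSpace ℝ (Fin k)) : ℝ :=
  if ‖y‖ ≤ 1 then betaConst β k * (1 - ‖y‖ ^ 2) ^ β else 0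

/-- The beta probability distribution with parameter `β` on the unit ball of `ℝ^k`. -/
def betaMeasure (β : ℝ) (k : ℕ) : Measure (EuclideanSpace ℝ (Fin k)) :=
  volume.withDensity fun y => ENNReal.ofReal (betaDensity β k y)

/-- The block-beta distribution on `Z_𝕕 = B_2^{d_1} × ⋯ × B_2^{d_m}`: the block
coordinates are independent and the `i`-th block is beta distributed with parameter `β i`. -/
def blockBetaMeasure {m : ℕ} (dv : Fin m → ℕ) (βv : Fin m → ℝ) :
    Measure (Π i, EuclideanSpace ℝ (Fin (dv i))) :=
  Measure.pi fun i => betaMeasure (βv i) (dv i)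

/-- The number of `j`-dimensional faces of a convex body `K`: faces are the nonempty
convex extreme subsets of `K`, and the dimension of a face is the dimension of its
affine hull. -/
def faceCount {E : Type*} [AddCommGroup E] [Module ℝ E] (K : Set E) (j : ℕ) : ℕ :=
  Nat.card {F : Set E // F.Nonempty ∧ Convex ℝ F ∧ IsExtreme ℝ K F ∧
    Module.finrank ℝ (vectorSpan ℝ F) = j}

/-- Expected number of `j`-dimensional faces of the convex hull of `n` i.i.d.
block-beta distributed random points. -/
def expectedFaceCount {m : ℕ} (dv : Fin m → ℕ) (βv : Fin m → ℝ) (j n : ℕ) : ℝ :=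
  ∫ x : Fin n → Π i, EuclideanSpace ℝ (Fin (dv i)),
    (faceCount (convexHull ℝ (Set.range x)) j : ℝ)
    ∂(Measure.pi fun _ : Fin n => blockBetaMeasure dv βv)

section Polytope

variable {V : Type*} [NormedAddCommGroup V] [NormedSpace ℝ V] {n : ℕ}

/-- The points `x i`, `i ∈ I`, lie on a common supporting hyperplane of all points of `x`. -/
def IsSupported (I : Finset (Fin n)) (x : Fin n → V) : Prop :=
  ∃ f : V →L[ℝ] ℝ, f ≠ 0 ∧ ∃ t : ℝ, (∀ i ∈ I, f (x i) = t) ∧ ∀ j, f (x j) ≤ t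

/-- General position: any `dim V + 1` of the points are affinely independent. -/
def GeneralPosition (x : Fin n → V) : Prop :=
  ∀ I : Finset (Fin n), I.card ≤ Module.finrank ℝ V + 1 →
    AffineIndependent ℝ (fun i : I => x i)

lemma mem_convexHull_image_iff (x : Fin n → V) (I : Finset (Fin n)) (p : V) :
    p ∈ convexHull ℝ (x '' I) ↔ ∃ w : Fin n → ℝ, (∀ i, 0 ≤ w i) ∧ (∀ i ∉ I, w i = 0) ∧
      ∑ i, w i = 1 ∧ ∑ i, w i • x i = p := by
  constructor
  · intro hp
    have hconv : Convex ℝ {p : V | ∃ w : Fin n → ℝ, (∀ i, 0 ≤ w i) ∧ (∀ i ∉ I, w i = 0) ∧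
        ∑ i, w i = 1 ∧ ∑ i, w i • x i = p} := by
      rintro p ⟨w, hw0, hwI, hw1, rfl⟩ q ⟨v, hv0, hvI, hv1, rfl⟩ a b ha hb hab
      refine ⟨fun i => a * w i + b * v i, fun i => ?_, fun i hi => ?_, ?_, ?_⟩
      · have := hw0 i; have := hv0 i; positivity
      · simp [hwI i hi, hvI i hi]
      · rw [Finset.sum_add_distrib, ← Finset.mul_sum, ← Finset.mul_sum, hw1, hv1]; simpa using hab
      · simp only [add_smul, mul_smul, Finset.sum_add_distrib, Finset.smul_sum]
    refine convexHull_min ?_ hconv hp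
    rintro _ ⟨i, hi, rfl⟩
    refine ⟨Pi.single i 1, fun j => ?_, fun j hj => ?_, ?_, ?_⟩
    · by_cases h : j = i
      · subst h; simp
      · simp [h]
    · have : j ≠ i := fun h => hj (h ▸ hi)
      simp [this]
    · simp
    · simp [Pi.single_apply, ite_smul]
  · rintro ⟨w, hw0, hwI, hw1, rfl⟩
    have h1 : ∑ i ∈ I, w i = 1 := by
      rw [← hw1]
      exact Finset.sum_subset (Finset.subset_univ _) fun i _ hi => hwI i hi
    have h2 : ∑ i ∈ I, w i • x i = ∑ i, w i • x i :=
      Finset.sum_subset (Finset.subset_univ _) fun i _ hi => by rw [hwI i hi, zero_smul]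
    rw [← h2]
    exact (convex_convexHull ℝ _).sum_mem (fun i _ => hw0 i) h1
      fun i hi => subset_convexHull ℝ _ ⟨i, hi, rfl⟩

lemma mem_convexHull_range_iff (x : Fin n → V) (p : V) :
    p ∈ convexHull ℝ (Set.range x) ↔ ∃ w : Fin n → ℝ, (∀ i, 0 ≤ w i) ∧
      ∑ i, w i = 1 ∧ ∑ i, w i • x i = p := by
  have := mem_convexHull_image_iff x Finset.univ p
  simpa using this

lemma vectorSpan_le_ker {s : Set V} {f : V →ₗ[ℝ] ℝ} {t : ℝ} (h : ∀ p ∈ s, f p = t) :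
    vectorSpan ℝ s ≤ LinearMap.ker f := by
  rw [vectorSpan, Submodule.span_le]
  rintro _ ⟨p, hp, q, hq, rfl⟩
  simp [h p hp, h q hq]

lemma finrank_vectorSpan_lt_of_const [FiniteDimensional ℝ V]
    {s : Set V} {f : V →ₗ[ℝ] ℝ} (hf : f ≠ 0) {t : ℝ}
    (h : ∀ p ∈ s, f p = t) : Module.finrank ℝ (vectorSpan ℝ s) < Module.finrank ℝ V := by
  have hle := vectorSpan_le_ker h
  refine Submodule.finrank_lt fun htop => hf ?_
  rw [htop] at hle
  exact LinearMap.ker_eq_top.1 (top_le_iff.1 hle)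

lemma GeneralPosition.card_le [FiniteDimensional ℝ V]
    {x : Fin n → V} (hx : GeneralPosition x) {f : V →ₗ[ℝ] ℝ}
    (hf : f ≠ 0) {t : ℝ} {T : Finset (Fin n)} (h : ∀ i ∈ T, f (x i) = t) :
    T.card ≤ Module.finrank ℝ V := by
  by_contra! hlt
  obtain ⟨T', hT', hcard⟩ := Finset.exists_subset_card_eq (Nat.succ_le_of_lt hlt)
  have hai := hx T' hcard.le
  have h1 := hai.finrank_vectorSpan (n := Module.finrank ℝ V) (by simpa using hcard)
  have h2 : Module.finrank ℝ (vectorSpan ℝ (Set.range fun i : T' => x i))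
      < Module.finrank ℝ V := by
    refine finrank_vectorSpan_lt_of_const hf (t := t) ?_
    rintro _ ⟨i, rfl⟩
    exact h i (hT' i.2)
  omega

lemma GeneralPosition.mem_of_eq [FiniteDimensional ℝ V]
    {x : Fin n → V} (hx : GeneralPosition x) {f : V →ₗ[ℝ] ℝ}
    (hf : f ≠ 0) {t : ℝ} {I : Finset (Fin n)} (hI : I.card = Module.finrank ℝ V)
    (h : ∀ i ∈ I, f (x i) = t) {j : Fin n} (hj : f (x j) = t) : j ∈ I := by
  by_contra hjI
  have := hx.card_le hf (t := t) (T := insert j I) (by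
    intro i hi
    rcases Finset.mem_insert.1 hi with rfl | hi
    · exact hj
    · exact h i hi)
  rw [Finset.card_insert_of_notMem hjI] at this
  omega

lemma range_restrict_eq_image {W : Type*} (x : Fin n → W) (I : Finset (Fin n)) :
    (Set.range fun i : I => x i) = x '' I := by
  ext p; simp

lemma GeneralPosition.finrank_vectorSpan_image {x : Fin n → V} (hx : GeneralPosition x)
    {I : Finset (Fin n)} {k : ℕ} (hI : I.card = k + 1) (hk : k ≤ Module.finrank ℝ V) :
    Module.finrank ℝ (vectorSpan ℝ (x '' I)) = k := by
  rw [← range_restrict_eq_image]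
  exact (hx I (by omega)).finrank_vectorSpan (by simpa using hI)

lemma le_of_mem_convexHull {s : Set V} {f : V →ₗ[ℝ] ℝ} {t : ℝ} (h : ∀ p ∈ s, f p ≤ t)
    {p : V} (hp : p ∈ convexHull ℝ s) : f p ≤ t :=
  convexHull_min (t := {p | f p ≤ t}) h (convex_halfSpace_le f.isLinear t) hp

lemma eq_of_mem_convexHull {s : Set V} {f : V →ₗ[ℝ] ℝ} {t : ℝ} (h : ∀ p ∈ s, f p = t)
    {p : V} (hp : p ∈ convexHull ℝ s) : f p = t :=
  convexHull_min (t := {p | f p = t}) h (convex_hyperplane f.isLinear t) hp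

/-- The convex hull of the points on a supporting hyperplane is an extreme subset. -/
lemma isExtreme_of_tight {x : Fin n → V} {f : V →ₗ[ℝ] ℝ} {t : ℝ} {I : Finset (Fin n)}
    (hI : ∀ i, i ∈ I ↔ f (x i) = t) (hle : ∀ j, f (x j) ≤ t) :
    IsExtreme ℝ (convexHull ℝ (Set.range x)) (convexHull ℝ (x '' I)) := by
  have hface : ∀ p ∈ convexHull ℝ (Set.range x), f p = t → p ∈ convexHull ℝ (x '' I) := by
    intro p hp hpt
    obtain ⟨w, hw0, hw1, rfl⟩ := (mem_convexHull_range_iff x p).1 hp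
    refine (mem_convexHull_image_iff x I _).2 ⟨w, hw0, ?_, hw1, rfl⟩
    have hsum : ∑ i, w i * (t - f (x i)) = 0 := by
      simp only [map_sum, map_smul, smul_eq_mul] at hpt
      simp only [mul_sub, Finset.sum_sub_distrib, ← Finset.sum_mul, hw1, hpt]
      ring
    have h0 := (Finset.sum_eq_zero_iff_of_nonneg
      (fun i _ => mul_nonneg (hw0 i) (sub_nonneg.2 (hle i)))).1 hsum
    intro i hi
    rcases mul_eq_zero.1 (h0 i (Finset.mem_univ _)) with h | h
    · exact h
    · exact absurd ((hI i).2 (by linarith)) hi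
  refine ⟨convexHull_mono (Set.image_subset_range _ _), ?_⟩
  intro p hp q hq z hz hzpq
  have hlK : ∀ y ∈ convexHull ℝ (Set.range x), f y ≤ t := fun y hy =>
    le_of_mem_convexHull (by rintro _ ⟨j, rfl⟩; exact hle j) hy
  have hzt : f z = t := eq_of_mem_convexHull (by rintro _ ⟨i, hi, rfl⟩; exact (hI i).1 hi) hz
  obtain ⟨a, b, ha, hb, hab, rfl⟩ := hzpq
  refine hface p hp ?_
  have h1 := hlK p hp
  have h2 := hlK q hq
  simp only [map_add, map_smul, smul_eq_mul] at hzt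
  have h3 : a * (t - f p) + b * (t - f q) = 0 := by
    have : (a + b) * t = t := by rw [hab, one_mul]
    linarith
  have h4 : 0 ≤ b * (t - f q) := mul_nonneg hb.le (sub_nonneg.2 h2)
  have h5 : 0 ≤ a * (t - f p) := mul_nonneg ha.le (sub_nonneg.2 h1)
  have h6 : a * (t - f p) = 0 := by linarith
  rcases mul_eq_zero.1 h6 with h | h <;> linarith

/-- A face of a polytope is the convex hull of the generating points that it contains. -/
lemma IsExtreme.eq_convexHull_image {x : Fin n → V} {F : Set V} (hconv : Convex ℝ F)
    (hF : IsExtreme ℝ (convexHull ℝ (Set.range x)) F) {T : Finset (Fin n)}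
    (hT : ∀ i, i ∈ T ↔ x i ∈ F) : F = convexHull ℝ (x '' T) := by
  refine Set.Subset.antisymm ?_ (convexHull_min ?_ hconv)
  · intro p hp
    obtain ⟨w, hw0, hw1, hwp⟩ := (mem_convexHull_range_iff x p).1 (hF.subset hp)
    refine (mem_convexHull_image_iff x T _).2 ⟨w, hw0, ?_, hw1, hwp⟩
    intro i hi
    by_contra hne
    have hpos : 0 < w i := lt_of_le_of_ne (hw0 i) (Ne.symm hne)
    apply hi
    rw [hT]
    have hsplit : w i + ∑ j ∈ Finset.univ.erase i, w j = 1 := by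
      rw [Finset.add_sum_erase _ _ (Finset.mem_univ i), hw1]
    have hsplit' : w i • x i + ∑ j ∈ Finset.univ.erase i, w j • x j = p := by
      rw [Finset.add_sum_erase _ (fun j => w j • x j) (Finset.mem_univ i), hwp]
    have hr0 : 0 ≤ ∑ j ∈ Finset.univ.erase i, w j := Finset.sum_nonneg fun j _ => hw0 j
    rcases hr0.eq_or_lt with h0 | h0
    · have hz := (Finset.sum_eq_zero_iff_of_nonneg (fun j _ => hw0 j)).1 h0.symm
      rw [Finset.sum_eq_zero fun j hj => by rw [hz j hj, zero_smul]] at hsplit'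
      have : w i = 1 := by linarith
      rw [this] at hsplit'
      simp only [one_smul, add_zero] at hsplit'
      rwa [hsplit']
    · refine hF.left_mem_of_mem_openSegment (subset_convexHull ℝ _ ⟨i, rfl⟩)
        (y := (Finset.univ.erase i).centerMass w x) ?_ hp ?_
      · exact Finset.centerMass_mem_convexHull _ (fun j _ => hw0 j) h0 fun j _ => ⟨j, rfl⟩
      · refine ⟨w i, ∑ j ∈ Finset.univ.erase i, w j, hpos, h0, hsplit, ?_⟩
        rw [Finset.centerMass, smul_inv_smul₀ h0.ne', hsplit']
  · rintro _ ⟨i, hi, rfl⟩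
    exact (hT i).1 hi

/-- A point of the polytope in the affine hull of a nonempty face belongs to that face. -/
lemma IsExtreme.mem_of_mem_affineSpan {x : Fin n → V} {F : Set V}
    (hF : IsExtreme ℝ (convexHull ℝ (Set.range x)) F) {T : Finset (Fin n)}
    (hTne : T.Nonempty) (hT : F = convexHull ℝ (x '' T)) {p : V}
    (hp : p ∈ convexHull ℝ (Set.range x))
    (hpa : p ∈ affineSpan ℝ (Set.range fun i : T => x i)) : p ∈ F := by
  obtain ⟨c, hc1, hcp⟩ := eq_affineCombination_of_mem_affineSpan_of_fintype hpa
  rw [Finset.affineCombination_eq_linear_combination _ _ _ hc1] at hcp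
  have hcard : (0 : ℝ) < T.card := by exact_mod_cast hTne.card_pos
  set D : ℝ := (T.card : ℝ) with hD
  set S : ℝ := ∑ i, |c i| with hS
  have hS0 : 0 ≤ S := Finset.sum_nonneg fun i _ => abs_nonneg _
  set ε : ℝ := 1 / (D * S + 2) with hε
  have hden : 0 < D * S + 2 := by positivity
  have hε0 : 0 < ε := by positivity
  have hε1 : ε < 1 := by
    rw [hε, div_lt_one hden]; nlinarith [mul_nonneg hcard.le hS0]
  have hεS : ε * S ≤ 1 / D := by
    rw [hε, div_mul_eq_mul_div, div_le_div_iff₀ hden hcard]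
    nlinarith
  let v : T → ℝ := fun i => (1 / D - ε * c i) / (1 - ε)
  have hv0 : ∀ i, 0 ≤ v i := by
    intro i
    refine div_nonneg ?_ (by linarith)
    have h1 : c i ≤ S := (le_abs_self _).trans
      (Finset.single_le_sum (f := fun i => |c i|) (fun j _ => abs_nonneg _) (Finset.mem_univ i))
    nlinarith
  have hv1 : ∑ i, v i = 1 := by
    simp only [v, ← Finset.sum_div, Finset.sum_sub_distrib, ← Finset.mul_sum, hc1]
    simp only [Finset.sum_const, Finset.card_univ, Fintype.card_coe, nsmul_eq_mul]
    rw [← hD]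
    field_simp
    rw [div_self]
    linarith
  have hmem : ∀ u : T → ℝ, (∀ i, 0 ≤ u i) → ∑ i, u i = 1 → ∑ i, u i • x i ∈ F := by
    intro u hu0 hu1
    rw [hT]
    exact (convex_convexHull ℝ _).sum_mem (fun i _ => hu0 i) hu1
      fun i _ => subset_convexHull ℝ _ ⟨i, i.2, rfl⟩
  have hq : ∑ i : T, (1 / D) • x i ∈ F := by
    refine hmem (fun _ => 1 / D) (fun i => by positivity) ?_
    simp only [Finset.sum_const, Finset.card_univ, Fintype.card_coe, nsmul_eq_mul]
    rw [← hD]; field_simp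
  refine hF.left_mem_of_mem_openSegment hp (hF.subset (hmem v hv0 hv1)) hq ?_
  refine ⟨ε, 1 - ε, hε0, by linarith, by ring, ?_⟩
  rw [hcp, Finset.smul_sum, Finset.smul_sum, ← Finset.sum_add_distrib]
  refine Finset.sum_congr rfl fun i _ => ?_
  rw [smul_smul, smul_smul, ← add_smul]
  congr 1
  simp only [v]
  have : (1 - ε) ≠ 0 := by linarith
  field_simp
  ring

/-- The hull of `dim V` points on a supporting hyperplane is a facet. -/
lemma GeneralPosition.isFacet_convexHull [FiniteDimensional ℝ V] {x : Fin n → V}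
    (hx : GeneralPosition x) (hV : 1 ≤ Module.finrank ℝ V) {I : Finset (Fin n)}
    (hI : I.card = Module.finrank ℝ V) (hs : IsSupported I x) :
    (convexHull ℝ (x '' I)).Nonempty ∧ Convex ℝ (convexHull ℝ (x '' I)) ∧
      IsExtreme ℝ (convexHull ℝ (Set.range x)) (convexHull ℝ (x '' I)) ∧
      Module.finrank ℝ (vectorSpan ℝ (convexHull ℝ (x '' I))) = Module.finrank ℝ V - 1 := by
  obtain ⟨f, hf0, t, hft, hle⟩ := hs
  have hf0' : (f : V →ₗ[ℝ] ℝ) ≠ 0 := fun h => hf0 (ContinuousLinearMap.coe_injective h)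
  refine ⟨?_, convex_convexHull ℝ _, ?_, ?_⟩
  · have : I.Nonempty := Finset.card_pos.1 (by omega)
    exact (Set.Nonempty.image _ this).convexHull
  · refine isExtreme_of_tight (f := (f : V →ₗ[ℝ] ℝ)) (t := t) (fun i => ⟨hft i, fun h => ?_⟩) hle
    exact hx.mem_of_eq hf0' hI hft h
  · rw [← direction_affineSpan, affineSpan_convexHull, direction_affineSpan]
    exact hx.finrank_vectorSpan_image (by omega) (by omega)

lemma GeneralPosition.eq_of_convexHull_eq [FiniteDimensional ℝ V] {x : Fin n → V}
    (hx : GeneralPosition x) {I J : Finset (Fin n)}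
    (hI : I.card = Module.finrank ℝ V) (hJ : J.card = Module.finrank ℝ V) (hs : IsSupported I x)
    (h : convexHull ℝ (x '' I) = convexHull ℝ (x '' J)) : I = J := by
  obtain ⟨f, hf0, t, hft, -⟩ := hs
  have hf0' : (f : V →ₗ[ℝ] ℝ) ≠ 0 := fun h => hf0 (ContinuousLinearMap.coe_injective h)
  refine (Finset.eq_of_subset_of_card_le (fun j hj => ?_) (by omega)).symm
  refine hx.mem_of_eq hf0' hI hft (j := j) ?_
  refine eq_of_mem_convexHull (s := x '' I) (f := (f : V →ₗ[ℝ] ℝ)) (t := t) ?_ ?_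
  · rintro _ ⟨i, hi, rfl⟩; exact hft i hi
  · rw [h]; exact subset_convexHull ℝ _ ⟨j, hj, rfl⟩

open Classical in
/-- Every facet is the hull of `dim V` points on a supporting hyperplane. -/
lemma GeneralPosition.exists_of_isFacet [FiniteDimensional ℝ V] {x : Fin n → V}
    (hx : GeneralPosition x) (hV : 1 ≤ Module.finrank ℝ V) {F : Set V} (hne : F.Nonempty)
    (hconv : Convex ℝ F) (hF : IsExtreme ℝ (convexHull ℝ (Set.range x)) F)
    (hdim : Module.finrank ℝ (vectorSpan ℝ F) = Module.finrank ℝ V - 1) :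
    ∃ I : Finset (Fin n), I.card = Module.finrank ℝ V ∧ IsSupported I x ∧
      convexHull ℝ (x '' I) = F := by
  set T : Finset (Fin n) := Finset.univ.filter fun i => x i ∈ F with hTdef
  have hT : ∀ i, i ∈ T ↔ x i ∈ F := by simp [hTdef]
  have hFT := hF.eq_convexHull_image hconv hT
  have hTne : T.Nonempty := by
    by_contra h
    rw [Finset.not_nonempty_iff_eq_empty] at h
    rw [hFT, h] at hne
    simp at hne
  have hspan : vectorSpan ℝ F = vectorSpan ℝ (Set.range fun i : T => x i) := by
    conv_lhs => rw [hFT]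
    rw [← direction_affineSpan, affineSpan_convexHull, direction_affineSpan,
      range_restrict_eq_image]
  have hker : ∃ f : V →ₗ[ℝ] ℝ, f ≠ 0 ∧ vectorSpan ℝ F ≤ LinearMap.ker f := by
    refine Submodule.exists_le_ker_of_lt_top _ (lt_top_iff_ne_top.2 fun h => ?_)
    rw [h, finrank_top] at hdim
    omega
  obtain ⟨f, hf0, hfk⟩ := hker
  obtain ⟨i₀, hi₀⟩ := hTne
  have hft : ∀ p ∈ F, f p = f (x i₀) := by
    intro p hp
    have := hfk (vsub_mem_vectorSpan ℝ hp ((hT i₀).1 hi₀))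
    rw [LinearMap.mem_ker, vsub_eq_sub, map_sub] at this
    linarith
  have hcard : T.card = Module.finrank ℝ V := by
    refine le_antisymm (hx.card_le hf0 (t := f (x i₀)) fun i hi => hft _ ((hT i).1 hi)) ?_
    have : Nonempty T := ⟨⟨i₀, hi₀⟩⟩
    have := finrank_vectorSpan_range_add_one_le ℝ (fun i : T => x i)
    rw [← hspan, hdim, Fintype.card_coe] at this
    omega
  have hkeq : vectorSpan ℝ F = LinearMap.ker f := by
    refine Submodule.eq_of_le_of_finrank_eq hfk ?_
    have h1 := LinearMap.finrank_range_add_finrank_ker f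
    rw [LinearMap.range_eq_top.2 (LinearMap.surjective_of_ne_zero hf0), finrank_top,
      Module.finrank_self] at h1
    omega
  have hface : ∀ p ∈ convexHull ℝ (Set.range x), f p = f (x i₀) → p ∈ F := by
    intro p hp hpt
    refine hF.mem_of_mem_affineSpan ⟨i₀, hi₀⟩ hFT hp ?_
    have hmem : p - x i₀ ∈ vectorSpan ℝ (Set.range fun i : T => x i) := by
      rw [← hspan, hkeq, LinearMap.mem_ker, map_sub, hpt, sub_self]
    have := AffineSubspace.vadd_mem_of_mem_direction
      (s := affineSpan ℝ (Set.range fun i : T => x i)) (by rwa [direction_affineSpan])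
      (mem_affineSpan ℝ (Set.mem_range_self (⟨i₀, hi₀⟩ : T)))
    simpa using this
  have hside : (∀ j, f (x j) ≤ f (x i₀)) ∨ ∀ j, f (x i₀) ≤ f (x j) := by
    by_contra! h
    obtain ⟨⟨j, hj⟩, k, hk⟩ := h
    have hd : 0 < f (x j) - f (x k) := by linarith
    set a := (f (x i₀) - f (x k)) / (f (x j) - f (x k)) with ha
    have ha0 : 0 < a := div_pos (by linarith) hd
    have ha1 : a < 1 := by rw [ha, div_lt_one hd]; linarith
    have hseg : a • x j + (1 - a) • x k ∈ openSegment ℝ (x j) (x k) :=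
      ⟨a, 1 - a, ha0, by linarith, by ring, rfl⟩
    have hjK : x j ∈ convexHull ℝ (Set.range x) := subset_convexHull ℝ _ ⟨j, rfl⟩
    have hkK : x k ∈ convexHull ℝ (Set.range x) := subset_convexHull ℝ _ ⟨k, rfl⟩
    have hp : a • x j + (1 - a) • x k ∈ F := by
      refine hface _ ((convex_convexHull ℝ _) hjK hkK ha0.le (by linarith) (by ring)) ?_
      simp only [map_add, map_smul, smul_eq_mul]
      have : a * (f (x j) - f (x k)) = f (x i₀) - f (x k) := by
        rw [ha]; field_simp
      linarith
    have := hft _ (hF.left_mem_of_mem_openSegment hjK hkK hp hseg)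
    linarith
  refine ⟨T, hcard, ?_, hFT.symm⟩
  have hTt : ∀ i ∈ T, f (x i) = f (x i₀) := fun i hi => hft _ ((hT i).1 hi)
  have hf0' : LinearMap.toContinuousLinearMap f ≠ 0 := by
    simpa using hf0
  rcases hside with h | h
  · exact ⟨LinearMap.toContinuousLinearMap f, hf0', f (x i₀), hTt, h⟩
  · refine ⟨-LinearMap.toContinuousLinearMap f, neg_ne_zero.2 hf0', -f (x i₀), ?_, ?_⟩
    · intro i hi; simp [hTt i hi]
    · intro j; simpa using h j

open Classical in
/-- In general position, facets correspond to the supported `dim V`-subsets. -/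
lemma GeneralPosition.faceCount_eq [FiniteDimensional ℝ V] {x : Fin n → V}
    (hx : GeneralPosition x) (hV : 1 ≤ Module.finrank ℝ V) :
    faceCount (convexHull ℝ (Set.range x)) (Module.finrank ℝ V - 1) =
      ((Finset.univ.powersetCard (Module.finrank ℝ V)).filter fun I => IsSupported I x).card := by
  rw [faceCount, ← Fintype.card_coe, ← Nat.card_eq_fintype_card]
  symm
  refine Nat.card_congr (Equiv.ofBijective (fun I => ⟨convexHull ℝ (x '' I.1), ?_⟩) ⟨?_, ?_⟩)
  · obtain ⟨I, hI⟩ := I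
    simp only [Finset.mem_filter, Finset.mem_powersetCard_univ] at hI
    exact hx.isFacet_convexHull hV hI.1 hI.2
  · rintro ⟨I, hI⟩ ⟨J, hJ⟩ h
    simp only [Finset.mem_filter, Finset.mem_powersetCard_univ] at hI hJ
    simp only [Subtype.mk.injEq] at h ⊢
    exact hx.eq_of_convexHull_eq hI.1 hJ.1 hI.2 h
  · rintro ⟨F, hne, hconv, hF, hdim⟩
    obtain ⟨I, hI, hs, rfl⟩ := hx.exists_of_isFacet hV hne hconv hF hdim
    exact ⟨⟨I, by simp [hI, hs]⟩, rfl⟩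

open Classical in
/-- Every strictly exposed vertex lies on a facet. -/
lemma GeneralPosition.exists_isSupported_of_exposed [FiniteDimensional ℝ V] {x : Fin n → V}
    (hx : GeneralPosition x) (hV : 1 ≤ Module.finrank ℝ V) (hn : Module.finrank ℝ V + 1 ≤ n)
    {i : Fin n} {g : V →L[ℝ] ℝ} (hg : ∀ j, j ≠ i → g (x j) < g (x i)) :
    ∃ I : Finset (Fin n), I.card = Module.finrank ℝ V ∧ i ∈ I ∧ IsSupported I x := by
  set y : Fin n → V := fun j => x j - x i with hy
  have hspan : Submodule.span ℝ (Set.range y) = ⊤ := by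
    obtain ⟨J, -, hJ⟩ := Finset.exists_subset_card_eq (s := (Finset.univ : Finset (Fin n)))
      (n := Module.finrank ℝ V + 1) (by simpa using hn)
    have h1 := hx.finrank_vectorSpan_image hJ le_rfl
    have h2 := Submodule.eq_top_of_finrank_eq h1
    have h3 : vectorSpan ℝ (x '' J) ≤ vectorSpan ℝ (Set.range x) :=
      vectorSpan_mono ℝ (Set.image_subset_range _ _)
    rw [h2, vectorSpan_range_eq_span_range_vsub_right ℝ x i] at h3
    exact top_le_iff.1 h3
  let C : Set (V →L[ℝ] ℝ) := {f | (∀ j, f (y j) ≤ 0) ∧ ∑ j, f (y j) = -1}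
  have hCne : C.Nonempty := by
    have hle : ∀ j, g (y j) ≤ 0 := by
      intro j
      by_cases h : j = i
      · simp [hy, h]
      · have := hg j h; simp only [hy, map_sub]; linarith
    have hlt : ∑ j, g (y j) < 0 := by
      have : ∃ j : Fin n, j ≠ i := by
        have : Nontrivial (Fin n) := Fin.nontrivial_iff_two_le.2 (by omega)
        exact exists_ne i
      obtain ⟨j, hj⟩ := this
      refine (Finset.sum_lt_sum (fun k _ => hle k) ⟨j, Finset.mem_univ _, ?_⟩).trans_eq
        (by simp)
      have := hg j hj; simp only [hy, map_sub]; linarith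
    refine ⟨(-∑ j, g (y j))⁻¹ • g, fun j => ?_, ?_⟩
    · simp only [smul_apply, smul_eq_mul]
      exact mul_nonpos_of_nonneg_of_nonpos (inv_nonneg.2 (by linarith)) (hle j)
    · simp only [smul_apply, smul_eq_mul, ← Finset.mul_sum]
      rw [inv_mul_eq_div, div_eq_iff (by linarith)]; ring
  have hCcpt : IsCompact C := by
    have hcont : ∀ v : V, Continuous fun f : V →L[ℝ] ℝ => f v := fun v => by fun_prop
    refine Metric.isCompact_of_isClosed_isBounded ?_ ?_
    · have : C = (⋂ j, {f : V →L[ℝ] ℝ | f (y j) ≤ 0}) ∩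
          {f : V →L[ℝ] ℝ | ∑ j, f (y j) = -1} := by
        ext f; simp [C]
      rw [this]
      refine (isClosed_iInter fun j => isClosed_le (hcont _) continuous_const).inter
        (isClosed_eq (continuous_finsetSum _ fun j _ => hcont _) continuous_const)
    · let L : (V →L[ℝ] ℝ) →ₗ[ℝ] (Fin n → ℝ) :=
        { toFun := fun f j => f (y j)
          map_add' := fun f g => rfl
          map_smul' := fun c f => rfl }
      have hker : LinearMap.ker L = ⊥ := by
        rw [LinearMap.ker_eq_bot']
        intro f hf
        have h0 : (⊤ : Submodule ℝ V) ≤ LinearMap.ker (f : V →ₗ[ℝ] ℝ) := by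
          rw [← hspan, Submodule.span_le]
          rintro _ ⟨j, rfl⟩
          exact congrFun hf j
        ext v
        exact h0 (Submodule.mem_top (x := v))
      obtain ⟨K, -, hK⟩ := L.exists_antilipschitzWith hker
      refine (hK.isBounded_preimage (s := Set.Icc (fun _ => -1) (fun _ => 0))
        (Metric.isBounded_Icc _ _)).subset ?_
      rintro f ⟨hf0, hf1⟩
      refine ⟨fun j => ?_, fun j => hf0 j⟩
      change -1 ≤ f (y j)
      rw [← hf1]
      have := Finset.add_sum_erase Finset.univ (fun j => f (y j)) (Finset.mem_univ j)
      have h2 : ∑ k ∈ Finset.univ.erase j, f (y k) ≤ 0 := Finset.sum_nonpos fun k _ => hf0 k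
      linarith
  obtain ⟨u, hu⟩ := hCcpt.extremePoints_nonempty hCne
  rw [mem_extremePoints] at hu
  obtain ⟨⟨hu0, hu1⟩, huext⟩ := hu
  set T : Finset (Fin n) := Finset.univ.filter fun j => u (x j) = u (x i) with hT
  have hune : (u : V →ₗ[ℝ] ℝ) ≠ 0 := by
    intro h
    have h' : ∀ v, u v = 0 := fun v => LinearMap.congr_fun h v
    simp [h'] at hu1
  have hrank : Module.finrank ℝ V - 1 ≤
      Module.finrank ℝ (vectorSpan ℝ (Set.range fun j : T => x j)) := by
    by_contra! hlt
    set W := vectorSpan ℝ (Set.range fun j : T => x j) with hW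
    have hlt' : W ⊔ Submodule.span ℝ {∑ j, y j} < ⊤ := by
      refine lt_top_iff_ne_top.2 fun h => ?_
      have h1 := Submodule.finrank_add_le_finrank_add_finrank W (Submodule.span ℝ {∑ j, y j})
      have h2 := finrank_span_le_card (R := ℝ) ({∑ j, y j} : Set V)
      rw [h, finrank_top] at h1
      simp only [Set.toFinset_singleton, Finset.card_singleton] at h2
      omega
    obtain ⟨v, hv0, hvk⟩ := Submodule.exists_le_ker_of_lt_top _ hlt'
    have hvW : ∀ j ∈ T, v (y j) = 0 := by
      intro j hj
      have hi : i ∈ T := by simp [hT]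
      exact hvk (Submodule.mem_sup_left (vsub_mem_vectorSpan ℝ
        (Set.mem_range_self (⟨j, hj⟩ : T)) (Set.mem_range_self (⟨i, hi⟩ : T))))
    have hvs : ∑ j, v (y j) = 0 := by
      rw [← map_sum]
      exact hvk (Submodule.mem_sup_right (Submodule.mem_span_singleton_self _))
    have hneg : ∀ j, j ∉ T → u (y j) < 0 := by
      intro j hj
      refine lt_of_le_of_ne (hu0 j) fun h => hj ?_
      simp only [hy, map_sub, sub_eq_zero] at h
      simp [hT, h]
    have hev : ∀ c : ℝ, ∀ᶠ ε : ℝ in nhdsWithin 0 (Set.Ioi 0),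
        ∀ j, u (y j) + ε * (c * v (y j)) ≤ 0 := by
      intro c
      rw [Filter.eventually_all]
      intro j
      by_cases hj : j ∈ T
      · refine Filter.Eventually.of_forall fun ε => ?_
        rw [hvW j hj]; simpa using hu0 j
      · have hc : Filter.Tendsto (fun ε : ℝ => u (y j) + ε * (c * v (y j)))
            (nhdsWithin 0 (Set.Ioi 0)) (nhds (u (y j) + 0 * (c * v (y j)))) :=
          (Continuous.tendsto (by fun_prop) 0).mono_left nhdsWithin_le_nhds
        rw [zero_mul, add_zero] at hc
        exact (hc.eventually (gt_mem_nhds (hneg j hj))).mono fun ε h => le_of_lt h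
    obtain ⟨ε, ⟨hε1, hε2⟩, hε0⟩ :=
      (((hev 1).and (hev (-1))).and self_mem_nhdsWithin).exists
    have hmem : ∀ c : ℝ, (∀ j, u (y j) + ε * (c * v (y j)) ≤ 0) →
        u + (ε * c) • LinearMap.toContinuousLinearMap v ∈ C := by
      intro c hc
      refine ⟨fun j => ?_, ?_⟩
      · simpa [mul_assoc] using hc j
      · simp only [add_apply, smul_apply,
          LinearMap.coe_toContinuousLinearMap', smul_eq_mul, Finset.sum_add_distrib,
          ← Finset.mul_sum, hvs, hu1]
        simp
    have hsame := (huext _ (hmem 1 hε1) _ (hmem (-1) hε2) ⟨1 / 2, 1 / 2, by norm_num, by norm_num,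
      by norm_num, by module⟩).1
    apply hv0
    simp only [mul_one, add_eq_left, smul_eq_zero] at hsame
    rcases hsame with h | h
    · exact absurd h (ne_of_gt hε0)
    · simpa using h
  have hTt : ∀ j ∈ T, u (x j) = u (x i) := by simp [hT]
  have hiT : i ∈ T := by simp [hT]
  refine ⟨T, le_antisymm (hx.card_le hune hTt) ?_, hiT, u, fun h => hune (by simp [h]), u (x i),
    hTt, fun j => ?_⟩
  · have : Nonempty T := ⟨⟨i, hiT⟩⟩
    have := finrank_vectorSpan_range_add_one_le ℝ (fun j : T => x j)
    rw [Fintype.card_coe] at this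
    omega
  · have := hu0 j
    simp only [hy, map_sub] at this
    linarith

lemma isSupported_iff_exists_mem_sphere {I : Finset (Fin n)} (hI : I.Nonempty) (x : Fin n → V) :
    IsSupported I x ↔ ∃ f ∈ Metric.sphere (0 : V →L[ℝ] ℝ) 1,
      ∀ i ∈ I, ∀ j, f (x j) ≤ f (x i) := by
  constructor
  · rintro ⟨f, hf0, t, hft, hle⟩
    refine ⟨‖f‖⁻¹ • f, ?_, fun i hi j => ?_⟩
    · simp [norm_smul, hf0]
    · simp only [smul_apply, smul_eq_mul]
      rw [hft i hi]
      exact mul_le_mul_of_nonneg_left (hle j) (by positivity)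
  · rintro ⟨f, hf, h⟩
    obtain ⟨i, hi⟩ := hI
    refine ⟨f, fun h0 => ?_, f (x i), fun k hk => le_antisymm (h i hi k) (h k hk i), h i hi⟩
    simp [h0] at hf

lemma isClosed_isSupported [FiniteDimensional ℝ V] {I : Finset (Fin n)} (hI : I.Nonempty) :
    IsClosed {x : Fin n → V | IsSupported I x} := by
  let S := Metric.sphere (0 : V →L[ℝ] ℝ) 1
  let C : Set (S × (Fin n → V)) := {p | ∀ i ∈ I, ∀ j, p.1.1 (p.2 j) ≤ p.1.1 (p.2 i)}
  have hC : IsClosed C := by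
    have hcont : ∀ j, Continuous fun p : S × (Fin n → V) => p.1.1 (p.2 j) := fun j => by fun_prop
    have : C = ⋂ i ∈ I, ⋂ j, {p : S × (Fin n → V) | p.1.1 (p.2 j) ≤ p.1.1 (p.2 i)} := by
      ext p; simp [C]
    rw [this]
    exact isClosed_biInter fun i _ => isClosed_iInter fun j => isClosed_le (hcont j) (hcont i)
  have : CompactSpace S := isCompact_iff_compactSpace.1 (isCompact_sphere _ _)
  have h := isClosedMap_snd_of_compactSpace (X := S) (Y := Fin n → V) C hC
  convert h using 1
  ext x
  simp only [Set.mem_ofPred_eq, isSupported_iff_exists_mem_sphere hI, Set.mem_image, Prod.exists,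
    exists_eq_right, Subtype.exists]
  constructor
  · rintro ⟨f, hf, h⟩; exact ⟨f, hf, h⟩
  · rintro ⟨f, hf, h⟩; exact ⟨f, hf, h⟩

/-- A measurable set in a product all of whose sections along one coordinate are null is null. -/
lemma measure_pi_eq_zero_of_update {ι : Type*} [Fintype ι] [DecidableEq ι] {X : ι → Type*}
    [∀ i, MeasurableSpace (X i)] (μ : ∀ i, Measure (X i)) [∀ i, SigmaFinite (μ i)]
    {N : Set (∀ i, X i)} (hN : MeasurableSet N) (i : ι)
    (h : ∀ x, μ i {y | Function.update x i y ∈ N} = 0) : Measure.pi μ N = 0 := by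
  by_cases hne : Nonempty (∀ i, X i)
  swap
  · rw [not_nonempty_iff] at hne
    rw [Set.eq_empty_of_isEmpty N, measure_empty]
  obtain ⟨x₀⟩ := hne
  have hf : Measurable (N.indicator (1 : (∀ i, X i) → ENNReal)) := measurable_one.indicator hN
  rw [← lintegral_indicator_one hN, lintegral_eq_lmarginal_univ x₀,
    lmarginal_erase' (μ := μ) _ hf (Finset.mem_univ i)]
  have : (fun x => ∫⁻ y, N.indicator (1 : (∀ i, X i) → ENNReal) (Function.update x i y) ∂μ i)
      = fun _ => 0 := by
    ext x
    have hm : MeasurableSet {y | Function.update x i y ∈ N} := (measurable_update x) hN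
    calc ∫⁻ y, N.indicator (1 : (∀ i, X i) → ENNReal) (Function.update x i y) ∂μ i
        = ∫⁻ y, {y | Function.update x i y ∈ N}.indicator 1 y ∂μ i := rfl
      _ = 0 := by rw [lintegral_indicator_one hm, h]
  rw [this]
  simp [lmarginal]

variable [FiniteDimensional ℝ V] [MeasurableSpace V] [BorelSpace V]

lemma measurableSet_affineIndependent (I : Finset (Fin n)) :
    MeasurableSet {x : Fin n → V | AffineIndependent ℝ fun i : I => x i} := by
  have h : IsOpen {p : I → V | AffineIndependent ℝ p} := isOpen_setOfPred_affineIndependent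
  exact (h.preimage (f := fun (x : Fin n → V) (i : I) => x i) (by fun_prop)).measurableSet

/-- Points sampled independently from a law that does not charge hyperplanes are almost surely
in general position. -/
lemma ae_generalPosition (μ : Measure V) [SigmaFinite μ]
    (hμ : ∀ (f : V →ₗ[ℝ] ℝ) (t : ℝ), f ≠ 0 → μ {y | f y = t} = 0) :
    ∀ᵐ x ∂(Measure.pi fun _ : Fin n => μ), GeneralPosition x := by
  simp only [GeneralPosition]
  rw [ae_all_iff]
  intro I
  induction I using Finset.induction_on with
  | empty =>
    refine Eventually.of_forall fun x _ => ?_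
    exact affineIndependent_of_subsingleton ℝ _
  | insert j I hj ih =>
    by_cases hc : (insert j I).card ≤ Module.finrank ℝ V + 1
    swap
    · exact Eventually.of_forall fun x h => absurd h hc
    have hcI : I.card ≤ Module.finrank ℝ V := by
      rw [Finset.card_insert_of_notMem hj] at hc; omega
    set N : Set (Fin n → V) := {x | AffineIndependent ℝ fun i : I => x i} ∩
      {x | AffineIndependent ℝ fun i : (insert j I : Finset (Fin n)) => x i}ᶜ with hN
    have hNm : MeasurableSet N :=
      (measurableSet_affineIndependent I).inter (measurableSet_affineIndependent _).compl
    have hN0 : Measure.pi (fun _ : Fin n => μ) N = 0 := by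
      refine measure_pi_eq_zero_of_update _ hNm j fun x => ?_
      rcases I.eq_empty_or_nonempty with rfl | ⟨i₀, hi₀⟩
      · convert measure_empty (μ := μ)
        ext y
        simp only [Set.mem_ofPred_eq, Set.mem_empty_iff_false, iff_false, hN]
        rintro ⟨-, h⟩
        apply h
        have : Subsingleton (insert j ∅ : Finset (Fin n)) := by
          rw [Finset.insert_empty]; infer_instance
        exact affineIndependent_of_subsingleton ℝ _
      · have hker : ∃ f : V →ₗ[ℝ] ℝ, f ≠ 0 ∧
            vectorSpan ℝ (Set.range fun i : I => x i) ≤ LinearMap.ker f := by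
          refine Submodule.exists_le_ker_of_lt_top _ (lt_top_iff_ne_top.2 fun h => ?_)
          have : Nonempty I := ⟨⟨i₀, hi₀⟩⟩
          have h1 := finrank_vectorSpan_range_add_one_le ℝ (fun i : I => x i)
          rw [h, finrank_top, Fintype.card_coe] at h1
          omega
        obtain ⟨f, hf0, hfk⟩ := hker
        refine measure_mono_null (fun y hy => ?_) (hμ f (f (x i₀)) hf0)
        obtain ⟨hy1, hy2⟩ := hy
        by_contra hne
        apply hy2
        have hup : ∀ i ∈ I, Function.update x j y i = x i := fun i hi =>
          Function.update_of_ne (by rintro rfl; exact hj hi) _ _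
        let j' : (insert j I : Finset (Fin n)) := ⟨j, Finset.mem_insert_self _ _⟩
        refine AffineIndependent.affineIndependent_of_notMem_span (i := j') ?_ ?_
        · let e : {z : (insert j I : Finset (Fin n)) // z ≠ j'} ↪ I :=
            ⟨fun z => ⟨z.1.1, by
              rcases Finset.mem_insert.1 z.1.2 with h | h
              · exact absurd (Subtype.ext h) z.2
              · exact h⟩, fun z w h => by
              simp only [Subtype.mk.injEq] at h
              exact Subtype.ext (Subtype.ext h)⟩
          exact hy1.comp_embedding e
        · intro hmem
          apply hne
          have hle : affineSpan ℝ ((fun i : (insert j I : Finset (Fin n)) =>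
              Function.update x j y i) '' {z | z ≠ j'}) ≤
              affineSpan ℝ (Set.range fun i : I => x i) := by
            refine affineSpan_mono ℝ ?_
            rintro _ ⟨z, hz, rfl⟩
            have hzI : z.1 ∈ I := by
              rcases Finset.mem_insert.1 z.2 with h | h
              · exact absurd (Subtype.ext h) hz
              · exact h
            exact ⟨⟨z.1, hzI⟩, (hup _ hzI).symm⟩
          have h1 := hle hmem
          have h2 := AffineSubspace.vsub_mem_direction h1
            (mem_affineSpan ℝ (Set.mem_range_self (⟨i₀, hi₀⟩ : I)))
          rw [direction_affineSpan] at h2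
          have h3 := hfk h2
          simp only [j', Function.update_self, vsub_eq_sub, LinearMap.mem_ker, map_sub,
            sub_eq_zero] at h3
          exact h3
    filter_upwards [ih, measure_eq_zero_iff_ae_notMem.1 hN0] with x hx1 hx2 _
    by_contra hcon
    exact hx2 ⟨hx1 (by omega), hcon⟩

end Polytope

section BetaMeasure

lemma betaConst_pos {β : ℝ} (hβ : -1 < β) (k : ℕ) : 0 < betaConst β k := by
  have h1 : 0 < Real.Gamma ((k : ℝ) / 2 + β + 1) :=
    Real.Gamma_pos_of_pos (by have : (0 : ℝ) ≤ k := k.cast_nonneg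
                              linarith)
  have h2 : 0 < Real.Gamma (β + 1) := Real.Gamma_pos_of_pos (by linarith)
  unfold betaConst
  have := Real.pi_pos
  positivity

lemma betaDensity_nonneg {β : ℝ} (hβ : -1 < β) (k : ℕ) (y : EuclideanSpace ℝ (Fin k)) :
    0 ≤ betaDensity β k y := by
  unfold betaDensity
  split_ifs with h
  · refine mul_nonneg (betaConst_pos hβ k).le (Real.rpow_nonneg ?_ _)
    nlinarith [norm_nonneg y]
  · exact le_rfl

lemma integral_betaPDFReal {a b : ℝ} (ha : 0 < a) (hb : 0 < b) :
    ∫ x, ProbabilityTheory.betaPDFReal a b x = 1 := by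
  have h := ProbabilityTheory.lintegral_betaPDF_eq_one ha hb
  rw [integral_eq_lintegral_of_nonneg_ae]
  · simp only [ProbabilityTheory.betaPDF] at h
    rw [h]; simp
  · refine Eventually.of_forall fun x => ?_
    by_cases hx : 0 < x ∧ x < 1
    · exact (ProbabilityTheory.betaPDFReal_pos hx.1 hx.2 ha hb).le
    · simp [ProbabilityTheory.betaPDFReal, hx]
  · exact (ProbabilityTheory.measurable_betaPDFReal a b).aestronglyMeasurable

lemma integral_Ioi_beta {a b : ℝ} (ha : 0 < a) (hb : 0 < b) :
    ∫ s in Set.Ioi (0 : ℝ), s ^ (a - 1) * (if s ≤ 1 then (1 - s) ^ (b - 1) else 0) =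
      ProbabilityTheory.beta a b := by
  have h := integral_betaPDFReal ha hb
  have hB := ProbabilityTheory.beta_pos ha hb
  calc ∫ s in Set.Ioi (0 : ℝ), s ^ (a - 1) * (if s ≤ 1 then (1 - s) ^ (b - 1) else 0)
      = ∫ s in Set.Ioi (0 : ℝ),
          ProbabilityTheory.beta a b * ProbabilityTheory.betaPDFReal a b s := by
        refine setIntegral_congr_ae measurableSet_Ioi ?_
        filter_upwards [compl_mem_ae_iff.2 (measure_singleton (1 : ℝ))] with s hs1 hs0
        have hs1' : s ≠ 1 := hs1
        have hs0' : 0 < s := hs0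
        unfold ProbabilityTheory.betaPDFReal
        by_cases h1 : s < 1
        · rw [if_pos h1.le, if_pos ⟨hs0', h1⟩]
          field_simp
        · have : ¬ s ≤ 1 := fun h' => h1 (lt_of_le_of_ne h' hs1')
          simp [h1, this]
    _ = ∫ s, ProbabilityTheory.beta a b * ProbabilityTheory.betaPDFReal a b s := by
        refine setIntegral_eq_integral_of_forall_compl_eq_zero fun s hs => ?_
        have : ¬ (0 < s ∧ s < 1) := fun h' => hs h'.1
        simp [ProbabilityTheory.betaPDFReal, this]
    _ = ProbabilityTheory.beta a b := by rw [integral_const_mul, h, mul_one]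

lemma integral_betaDensity {β : ℝ} (hβ : -1 < β) {k : ℕ} (hk : 1 ≤ k) :
    ∫ y, betaDensity β k y = 1 := by
  have : Nonempty (Fin k) := ⟨⟨0, hk⟩⟩
  have : Nontrivial (EuclideanSpace ℝ (Fin k)) :=
    Module.nontrivial_of_finrank_pos (R := ℝ) (by rw [finrank_euclideanSpace_fin]; omega)
  let F : ℝ → ℝ := fun r => if r ≤ 1 then betaConst β k * (1 - r ^ 2) ^ β else 0
  have hk0 : (0 : ℝ) < k := by exact_mod_cast hk
  have h1 := integral_fun_norm_addHaar (volume : Measure (EuclideanSpace ℝ (Fin k))) F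
  have h2 : ∫ y in Set.Ioi (0 : ℝ), y ^ (k - 1) • F y =
      betaConst β k / 2 * ProbabilityTheory.beta (k / 2) (β + 1) := by
    have hsub := integral_comp_rpow_Ioi_of_pos (p := 2) (g := fun s : ℝ =>
      s ^ ((k : ℝ) / 2 - 1) * (if s ≤ 1 then (1 - s) ^ (β + 1 - 1) else 0)) two_pos
    rw [← integral_Ioi_beta (by positivity) (by linarith), ← hsub, ← integral_const_mul]
    refine setIntegral_congr_fun measurableSet_Ioi fun y hy => ?_
    have hy0 : (0 : ℝ) < y := hy
    have e1 : y ^ (2 : ℝ) = y ^ 2 := by norm_cast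
    have e2 : ((y : ℝ) ^ 2 ≤ 1) ↔ y ≤ 1 := by
      rw [sq_le_one_iff₀ hy0.le]
    have e3 : y * (y ^ (2 : ℝ)) ^ ((k : ℝ) / 2 - 1) = y ^ (k - 1) := by
      rw [← Real.rpow_mul hy0.le, ← Real.rpow_natCast y (k - 1), Nat.cast_sub hk]
      nth_rewrite 1 [← Real.rpow_one y]
      rw [← Real.rpow_add hy0]
      congr 1
      push_cast
      ring
    simp only [F, smul_eq_mul]
    rw [← e3, e1]
    simp only [e2, add_sub_cancel_right]
    have e4 : y ^ ((2 : ℝ) - 1) = y := by norm_num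
    rw [e4]
    split_ifs <;> ring
  have h3 : (volume : Measure (EuclideanSpace ℝ (Fin k))).real (Metric.ball 0 1) =
      Real.pi ^ ((k : ℝ) / 2) / Real.Gamma ((k : ℝ) / 2 + 1) := by
    have hG : 0 < Real.Gamma ((k : ℝ) / 2 + 1) := Real.Gamma_pos_of_pos (by positivity)
    rw [Measure.real, EuclideanSpace.volume_ball]
    simp only [ENNReal.ofReal_one, one_pow, one_mul, Fintype.card_fin]
    rw [ENNReal.toReal_ofReal (by positivity), Real.sqrt_eq_rpow, ← Real.rpow_natCast,
      ← Real.rpow_mul Real.pi_pos.le]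
    congr 2
    ring
  rw [finrank_euclideanSpace_fin, h2, h3] at h1
  have h4 : ∫ y, betaDensity β k y = ∫ y : EuclideanSpace ℝ (Fin k), F ‖y‖ := rfl
  rw [h4, h1, nsmul_eq_mul, smul_eq_mul]
  have hG1 : 0 < Real.Gamma ((k : ℝ) / 2) := Real.Gamma_pos_of_pos (by positivity)
  have hG2 : 0 < Real.Gamma (β + 1) := Real.Gamma_pos_of_pos (by linarith)
  have hG3 : 0 < Real.Gamma ((k : ℝ) / 2 + β + 1) := Real.Gamma_pos_of_pos (by
    have : 0 < (k : ℝ) / 2 := by positivity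
    linarith)
  have hG4 : Real.Gamma ((k : ℝ) / 2 + 1) = k / 2 * Real.Gamma ((k : ℝ) / 2) :=
    Real.Gamma_add_one (by positivity)
  have hpi : 0 < Real.pi ^ ((k : ℝ) / 2) := Real.rpow_pos_of_pos Real.pi_pos _
  rw [hG4, ProbabilityTheory.beta, betaConst, ← add_assoc]
  generalize Real.Gamma ((k : ℝ) / 2 + β + 1) = G at *
  field_simp

lemma isProbabilityMeasure_betaMeasure {β : ℝ} (hβ : -1 < β) {k : ℕ} (hk : 1 ≤ k) :
    IsProbabilityMeasure (betaMeasure β k) := by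
  constructor
  rw [betaMeasure, withDensity_apply _ MeasurableSet.univ, Measure.restrict_univ,
    ← ofReal_integral_eq_lintegral_ofReal
      (integrable_of_integral_eq_one (integral_betaDensity hβ hk))
      (Eventually.of_forall (betaDensity_nonneg hβ k)), integral_betaDensity hβ hk,
    ENNReal.ofReal_one]

lemma betaMeasure_absolutelyContinuous (β : ℝ) (k : ℕ) : betaMeasure β k ≪ volume :=
  withDensity_absolutelyContinuous _ _

lemma ae_norm_lt_one_betaMeasure (β : ℝ) {k : ℕ} (hk : 1 ≤ k) :
    ∀ᵐ y ∂betaMeasure β k, ‖y‖ < 1 := by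
  have : Nontrivial (EuclideanSpace ℝ (Fin k)) :=
    Module.nontrivial_of_finrank_pos (R := ℝ) (by rw [finrank_euclideanSpace_fin]; omega)
  have h1 : ∀ᵐ y ∂betaMeasure β k, y ∉ Metric.sphere (0 : EuclideanSpace ℝ (Fin k)) 1 :=
    measure_eq_zero_iff_ae_notMem.1
      (betaMeasure_absolutelyContinuous β k (Measure.addHaar_sphere _ _ _))
  have h2 : ∀ᵐ y ∂betaMeasure β k, ‖y‖ ≤ 1 := by
    have hm : MeasurableSet {y : EuclideanSpace ℝ (Fin k) | ¬ ‖y‖ ≤ 1} :=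
      (measurableSet_le measurable_norm measurable_const).compl
    rw [ae_iff, betaMeasure, withDensity_apply _ hm]
    refine setLIntegral_eq_zero hm fun y hy => ?_
    have : ¬ ‖y‖ ≤ 1 := hy
    simp [betaDensity, this]
  filter_upwards [h1, h2] with y hy1 hy2
  refine lt_of_le_of_ne hy2 fun h => hy1 ?_
  simpa using h

lemma betaMeasure_hyperplane (β : ℝ) {k : ℕ} (f : EuclideanSpace ℝ (Fin k) →ₗ[ℝ] ℝ) (t : ℝ)
    (hf : f ≠ 0) : betaMeasure β k {y | f y = t} = 0 := by
  refine betaMeasure_absolutelyContinuous β k ?_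
  obtain ⟨v, hv⟩ : ∃ v, f v ≠ 0 := by
    by_contra! h
    exact hf (LinearMap.ext h)
  have hs : {y | f y = t} = ((AffineSubspace.mk' ((t / f v) • v) (LinearMap.ker f) :
      AffineSubspace ℝ _) : Set _) := by
    ext y
    simp only [Set.mem_ofPred_eq, SetLike.mem_coe, AffineSubspace.mem_mk', vsub_eq_sub,
      LinearMap.mem_ker, map_sub, map_smul, smul_eq_mul, div_mul_cancel₀ _ hv, sub_eq_zero]
  rw [hs]
  refine Measure.addHaar_affineSubspace _ _ fun htop => hv ?_
  have := congrArg AffineSubspace.direction htop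
  rw [AffineSubspace.direction_mk', AffineSubspace.direction_top] at this
  have hv' : v ∈ LinearMap.ker f := this ▸ Submodule.mem_top
  exact hv'

/-- Upper bound for the beta measure of a set contained in a shell. -/
lemma betaMeasure_le_of_subset_shell {β : ℝ} (hβ : 0 ≤ β) {k : ℕ} {l : ℝ}
    {S : Set (EuclideanSpace ℝ (Fin k))} (hS : MeasurableSet S)
    (h : ∀ y ∈ S, 1 - ‖y‖ ≤ l) :
    betaMeasure β k S ≤
      ENNReal.ofReal (betaConst β k * (2 * l) ^ β) * volume (S ∩ Metric.closedBall 0 1) := by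
  have hb : MeasurableSet (Metric.closedBall (0 : EuclideanSpace ℝ (Fin k)) 1) :=
    Metric.isClosed_closedBall.measurableSet
  rw [betaMeasure, withDensity_apply _ hS, ← setLIntegral_const, Set.inter_comm,
    ← Measure.restrict_restrict hb, ← lintegral_indicator hb]
  refine setLIntegral_mono_ae' hS (Eventually.of_forall fun y hy => ?_)
  by_cases hy1 : ‖y‖ ≤ 1
  · rw [Set.indicator_of_mem (by simpa using hy1)]
    refine ENNReal.ofReal_le_ofReal ?_
    rw [betaDensity, if_pos hy1]
    refine mul_le_mul_of_nonneg_left ?_ (betaConst_pos (by linarith) k).le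
    refine Real.rpow_le_rpow ?_ ?_ hβ
    · nlinarith [norm_nonneg y]
    · nlinarith [norm_nonneg y, h y hy]
  · simp [betaDensity, hy1]

/-- Lower bound for the beta measure of a set avoiding a shell. -/
lemma le_betaMeasure_of_forall {β : ℝ} (hβ : 0 ≤ β) {k : ℕ} {l : ℝ} (hl : 0 ≤ l)
    {S : Set (EuclideanSpace ℝ (Fin k))} (hS : MeasurableSet S)
    (h : ∀ y ∈ S, ‖y‖ ≤ 1 ∧ l ≤ 1 - ‖y‖ ^ 2) :
    ENNReal.ofReal (betaConst β k * l ^ β) * volume S ≤ betaMeasure β k S := by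
  rw [betaMeasure, withDensity_apply _ hS, ← setLIntegral_const]
  refine setLIntegral_mono_ae' hS (Eventually.of_forall fun y hy => ?_)
  refine ENNReal.ofReal_le_ofReal ?_
  rw [betaDensity, if_pos (h y hy).1]
  exact mul_le_mul_of_nonneg_left (Real.rpow_le_rpow hl (h y hy).2 hβ)
    (betaConst_pos (by linarith) k).le

end BetaMeasure

section BetaEstimates

lemma exists_orthonormalBasis_apply_eq {k : ℕ} (i₀ : Fin k) (u : EuclideanSpace ℝ (Fin k))
    (hu : ‖u‖ = 1) : ∃ b : OrthonormalBasis (Fin k) ℝ (EuclideanSpace ℝ (Fin k)), b i₀ = u := by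
  obtain ⟨b, hb⟩ := Orthonormal.exists_orthonormalBasis_extension_of_card_eq (𝕜 := ℝ)
    (E := EuclideanSpace ℝ (Fin k)) (ι := Fin k) (by simp) (v := fun _ => u) (s := {i₀}) (by
      refine ⟨fun i => hu, fun i j hij => ?_⟩
      exact absurd (Subtype.ext ((Set.mem_singleton_iff.1 i.2).trans
        (Set.mem_singleton_iff.1 j.2).symm)) hij)
  exact ⟨b, hb i₀ rfl⟩

lemma volume_orthonormal_box {k : ℕ} (b : OrthonormalBasis (Fin k) ℝ (EuclideanSpace ℝ (Fin k)))
    (s : Fin k → Set ℝ) (hs : ∀ i, MeasurableSet (s i)) :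
    volume {y | ∀ i, inner ℝ (b i) y ∈ s i} = ∏ i, volume (s i) := by
  have h := (PiLp.volume_preserving_ofLp (Fin k)).comp b.measurePreserving_repr
  rw [← volume_pi_pi, ← h.measure_preimage (MeasurableSet.univ_pi hs).nullMeasurableSet]
  congr 1
  ext y
  simp [OrthonormalBasis.repr_apply_apply]

lemma prod_eq_mul_pow_of_ne {k : ℕ} (i₀ : Fin k) (g : Fin k → ENNReal) (A B : ENNReal)
    (h0 : g i₀ = A) (h : ∀ i ≠ i₀, g i = B) : ∏ i, g i = A * B ^ (k - 1) := by
  rw [← Finset.mul_prod_erase _ _ (Finset.mem_univ i₀), h0,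
    Finset.prod_congr rfl (g := fun _ => B) (fun i hi => h i (Finset.ne_of_mem_erase hi)),
    Finset.prod_const, Finset.card_erase_of_mem (Finset.mem_univ _)]
  simp

lemma rpow_mul_sqrt_pow {β l : ℝ} (hl : 0 < l) {k : ℕ} (hk : 1 ≤ k) :
    l ^ β * (l * Real.sqrt l ^ (k - 1)) = l ^ (((k : ℝ) + 1) / 2 + β) := by
  rw [Real.sqrt_eq_rpow, ← Real.rpow_natCast, ← Real.rpow_mul hl.le]
  nth_rewrite 2 [← Real.rpow_one l]
  rw [← Real.rpow_add hl, ← Real.rpow_add hl]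
  congr 1
  rw [Nat.cast_sub hk]
  push_cast
  ring

lemma measurableSet_shell {k : ℕ} (l : ℝ) :
    MeasurableSet {y : EuclideanSpace ℝ (Fin k) | 1 - ‖y‖ ≤ l} :=
  measurableSet_le (by fun_prop) measurable_const

/-- Mass of a shell near the boundary of the ball, upper bound. -/
lemma exists_betaMeasure_shell_le {β : ℝ} (hβ : 0 ≤ β) {k : ℕ} (hk : 1 ≤ k) :
    ∃ C : ℝ, 0 < C ∧ ∀ l : ℝ, 0 < l → l ≤ 1 →
      betaMeasure β k {y | 1 - ‖y‖ ≤ l} ≤ ENNReal.ofReal (C * l ^ (β + 1)) := by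
  have : Nontrivial (EuclideanSpace ℝ (Fin k)) :=
    Module.nontrivial_of_finrank_pos (R := ℝ) (by rw [finrank_euclideanSpace_fin]; omega)
  have hk0 : (0 : ℝ) < k := by exact_mod_cast hk
  set V := (volume : Measure (EuclideanSpace ℝ (Fin k))).real (Metric.ball 0 1) with hV
  have hV0 : 0 < V := by
    rw [hV, Measure.real]
    exact ENNReal.toReal_pos (Metric.measure_ball_pos _ _ one_pos).ne'
      measure_ball_lt_top.ne
  have hVe : volume (Metric.ball (0 : EuclideanSpace ℝ (Fin k)) 1) = ENNReal.ofReal V := by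
    rw [hV, Measure.real, ENNReal.ofReal_toReal measure_ball_lt_top.ne]
  have hc := betaConst_pos (β := β) (by linarith) k
  refine ⟨betaConst β k * 2 ^ β * (k * V), by positivity, fun l hl hl1 => ?_⟩
  refine (betaMeasure_le_of_subset_shell hβ (measurableSet_shell l) (fun y hy => hy)).trans ?_
  have hsub : {y : EuclideanSpace ℝ (Fin k) | 1 - ‖y‖ ≤ l} ∩ Metric.closedBall 0 1 ⊆
      Metric.closedBall 0 1 \ Metric.ball 0 (1 - l) := by
    rintro y ⟨hy1, hy2⟩
    refine ⟨hy2, fun h => ?_⟩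
    rw [mem_ball_zero_iff] at h
    have : 1 - ‖y‖ ≤ l := hy1
    linarith
  have hvol : volume ({y : EuclideanSpace ℝ (Fin k) | 1 - ‖y‖ ≤ l} ∩ Metric.closedBall 0 1) ≤
      ENNReal.ofReal (k * V * l) := by
    refine (measure_mono hsub).trans ?_
    rw [measure_sdiff ((Metric.ball_subset_ball (by linarith)).trans Metric.ball_subset_closedBall)
      Metric.isOpen_ball.measurableSet.nullMeasurableSet measure_ball_lt_top.ne,
      Measure.addHaar_ball _ _ (by linarith), Measure.addHaar_closedBall _ _ zero_le_one, hVe,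
      finrank_euclideanSpace_fin, ← ENNReal.ofReal_mul (by positivity),
      ← ENNReal.ofReal_mul (pow_nonneg (by linarith) _), ← ENNReal.ofReal_sub _
        (mul_nonneg (pow_nonneg (by linarith) _) hV0.le)]
    refine ENNReal.ofReal_le_ofReal ?_
    have := one_add_mul_le_pow (a := -l) (by linarith) k
    have e : (1 + -l) ^ k = (1 - l) ^ k := by ring_nf
    rw [e] at this
    rw [one_pow]
    nlinarith
  calc _ ≤ ENNReal.ofReal (betaConst β k * (2 * l) ^ β) * ENNReal.ofReal (k * V * l) := by gcongr
    _ = _ := by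
      rw [← ENNReal.ofReal_mul (by positivity), Real.mul_rpow two_pos.le hl.le,
        Real.rpow_add hl, Real.rpow_one]
      congr 1
      ring

/-- Mass of a shell near the boundary of the ball, lower bound. -/
lemma exists_le_betaMeasure_shell {β : ℝ} (hβ : 0 ≤ β) {k : ℕ} (hk : 1 ≤ k) {ρ : ℝ} (hρ : 0 < ρ)
    (hρ1 : ρ < 1) :
    ∃ c : ℝ, 0 < c ∧ ∀ l : ℝ, 0 < l → l ≤ 1 →
      ENNReal.ofReal (c * l ^ (β + 1)) ≤ betaMeasure β k {y | ρ * l < 1 - ‖y‖ ∧ 1 - ‖y‖ ≤ l} := by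
  have : Nontrivial (EuclideanSpace ℝ (Fin k)) :=
    Module.nontrivial_of_finrank_pos (R := ℝ) (by rw [finrank_euclideanSpace_fin]; omega)
  set V := (volume : Measure (EuclideanSpace ℝ (Fin k))).real (Metric.ball 0 1) with hV
  have hV0 : 0 < V := by
    rw [hV, Measure.real]
    exact ENNReal.toReal_pos (Metric.measure_ball_pos _ _ one_pos).ne'
      measure_ball_lt_top.ne
  have hVe : volume (Metric.ball (0 : EuclideanSpace ℝ (Fin k)) 1) = ENNReal.ofReal V := by
    rw [hV, Measure.real, ENNReal.ofReal_toReal measure_ball_lt_top.ne]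
  have hc := betaConst_pos (β := β) (by linarith) k
  have hρ2 : 0 < 1 - ρ := by linarith
  refine ⟨betaConst β k * ρ ^ β * ((1 - ρ) ^ k * V), by positivity, fun l hl hl1 => ?_⟩
  have hSeq : {y : EuclideanSpace ℝ (Fin k) | ρ * l < 1 - ‖y‖ ∧ 1 - ‖y‖ ≤ l} =
      Metric.ball 0 (1 - ρ * l) \ Metric.ball 0 (1 - l) := by
    ext y
    simp only [Set.mem_ofPred_eq, Set.mem_sdiff, mem_ball_zero_iff, not_lt]
    constructor <;> rintro ⟨h1, h2⟩ <;> constructor <;> linarith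
  have hρl : ρ * l ≤ l := by nlinarith
  have hρl' : ρ * l ≤ ρ := by nlinarith
  have hSm : MeasurableSet {y : EuclideanSpace ℝ (Fin k) | ρ * l < 1 - ‖y‖ ∧ 1 - ‖y‖ ≤ l} := by
    rw [hSeq]
    exact measurableSet_ball.diff measurableSet_ball
  refine le_trans ?_ (le_betaMeasure_of_forall hβ (l := ρ * l) (by positivity) hSm ?_)
  · have hvol : ENNReal.ofReal ((1 - ρ) ^ k * V * l) ≤
        volume {y : EuclideanSpace ℝ (Fin k) | ρ * l < 1 - ‖y‖ ∧ 1 - ‖y‖ ≤ l} := by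
      rw [hSeq, measure_sdiff (Metric.ball_subset_ball (by linarith))
        Metric.isOpen_ball.measurableSet.nullMeasurableSet measure_ball_lt_top.ne,
        Measure.addHaar_ball (r := 1 - ρ * l) _ _ (by linarith),
        Measure.addHaar_ball (r := 1 - l) _ _ (by linarith), hVe,
        finrank_euclideanSpace_fin, ← ENNReal.ofReal_mul (pow_nonneg (by linarith) _),
        ← ENNReal.ofReal_mul (pow_nonneg (by linarith) _), ← ENNReal.ofReal_sub _
          (mul_nonneg (pow_nonneg (by linarith) _) hV0.le)]
      refine ENNReal.ofReal_le_ofReal ?_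
      obtain ⟨j, rfl⟩ : ∃ j, k = j + 1 := ⟨k - 1, by omega⟩
      have h1 : (1 - l) ^ j ≤ (1 - ρ * l) ^ j := pow_le_pow_left₀ (by linarith) (by linarith) _
      have h2 : (1 - ρ) ^ j ≤ (1 - ρ * l) ^ j := pow_le_pow_left₀ (by linarith) (by linarith) _
      have h3 : (1 - ρ) ^ (j + 1) * l ≤ (1 - ρ * l) ^ (j + 1) - (1 - l) ^ (j + 1) := by
        have e1 : (1 - l) ^ (j + 1) ≤ (1 - ρ * l) ^ j * (1 - l) := by
          rw [pow_succ]; exact mul_le_mul_of_nonneg_right h1 (by linarith)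
        have e2 : (1 - ρ) ^ (j + 1) * l ≤ (1 - ρ * l) ^ j * ((1 - ρ) * l) := by
          rw [pow_succ, mul_assoc]; exact mul_le_mul_of_nonneg_right h2 (by positivity)
        have e3 : (1 - ρ * l) ^ (j + 1) = (1 - ρ * l) ^ j * (1 - l) +
          (1 - ρ * l) ^ j * ((1 - ρ) * l) := by ring
        linarith
      nlinarith
    refine le_trans (le_of_eq ?_) (mul_le_mul_right hvol _)
    rw [← ENNReal.ofReal_mul (by positivity), Real.mul_rpow hρ.le hl.le, Real.rpow_add hl,
      Real.rpow_one]
    congr 1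
    ring
  · rintro y ⟨hy1, hy2⟩
    have := norm_nonneg y
    have h1 : ‖y‖ ≤ 1 := by nlinarith
    exact ⟨h1, by nlinarith⟩

/-- Mass of the part of a shell close to a given point of the sphere. -/
lemma exists_betaMeasure_near_le {β : ℝ} (hβ : 0 ≤ β) {k : ℕ} (hk : 1 ≤ k) :
    ∃ C : ℝ, 0 < C ∧ ∀ l : ℝ, 0 < l → l ≤ 1 → ∀ u : EuclideanSpace ℝ (Fin k), ‖u‖ = 1 →
      betaMeasure β k {y | 1 - ‖y‖ ≤ l ∧ ‖y - u‖ ≤ 4 * Real.sqrt l} ≤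
        ENNReal.ofReal (C * l ^ (((k : ℝ) + 1) / 2 + β)) := by
  have hc := betaConst_pos (β := β) (by linarith) k
  refine ⟨betaConst β k * 2 ^ β * (9 * 8 ^ (k - 1)), by positivity, fun l hl hl1 u hu => ?_⟩
  let i₀ : Fin k := ⟨0, hk⟩
  obtain ⟨b, hb⟩ := exists_orthonormalBasis_apply_eq i₀ u hu
  have hSm : MeasurableSet {y : EuclideanSpace ℝ (Fin k) |
      1 - ‖y‖ ≤ l ∧ ‖y - u‖ ≤ 4 * Real.sqrt l} :=
    (measurableSet_shell l).inter
      (measurableSet_le (f := fun y => ‖y - u‖) (by fun_prop) measurable_const)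
  refine (betaMeasure_le_of_subset_shell hβ hSm (fun y hy => hy.1)).trans ?_
  let s : Fin k → Set ℝ := fun i => if i = i₀ then Set.Icc (1 - 9 * l) 1 else
    Set.Icc (-(4 * Real.sqrt l)) (4 * Real.sqrt l)
  have hsub : {y : EuclideanSpace ℝ (Fin k) | 1 - ‖y‖ ≤ l ∧ ‖y - u‖ ≤ 4 * Real.sqrt l} ∩
      Metric.closedBall 0 1 ⊆ {y | ∀ i, inner ℝ (b i) y ∈ s i} := by
    rintro y ⟨⟨hy1, hy2⟩, hy3⟩ i
    rw [mem_closedBall_zero_iff] at hy3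
    have hsq := norm_sub_sq_real y u
    by_cases hi : i = i₀
    · subst hi
      simp only [s, if_true, hb, Set.mem_Icc]
      rw [hu] at hsq
      have h4 : ‖y - u‖ ^ 2 ≤ 16 * l := by
        calc ‖y - u‖ ^ 2 ≤ (4 * Real.sqrt l) ^ 2 := pow_le_pow_left₀ (norm_nonneg _) hy2 2
          _ = 16 * l := by rw [mul_pow, Real.sq_sqrt hl.le]; norm_num
      rw [real_inner_comm]
      have hy0 := norm_nonneg y
      constructor
      · nlinarith
      · have := real_inner_le_norm y u
        rw [hu] at this
        linarith
    · simp only [s, if_neg hi, Set.mem_Icc, ← abs_le]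
      have h5 : inner ℝ (b i) y = inner ℝ (b i) (y - u) := by
        rw [inner_sub_right, ← hb, b.inner_eq_zero hi, sub_zero]
      rw [h5]
      refine (abs_real_inner_le_norm _ _).trans ?_
      rw [b.norm_eq_one, one_mul]
      exact hy2
  have hvol : volume ({y : EuclideanSpace ℝ (Fin k) | 1 - ‖y‖ ≤ l ∧ ‖y - u‖ ≤ 4 * Real.sqrt l} ∩
      Metric.closedBall 0 1) ≤ ENNReal.ofReal (9 * l * (8 * Real.sqrt l) ^ (k - 1)) := by
    refine (measure_mono hsub).trans ?_
    rw [volume_orthonormal_box b s (fun i => by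
      simp only [s]; split_ifs <;> exact measurableSet_Icc),
      prod_eq_mul_pow_of_ne i₀ _ (ENNReal.ofReal (9 * l)) (ENNReal.ofReal (8 * Real.sqrt l)),
      ← ENNReal.ofReal_pow (by positivity), ← ENNReal.ofReal_mul (by positivity)]
    · simp only [s, if_true, Real.volume_Icc]
      congr 1; ring
    · intro i hi
      simp only [s, if_neg hi, Real.volume_Icc]
      congr 1; ring
  calc _ ≤ ENNReal.ofReal (betaConst β k * (2 * l) ^ β) *
        ENNReal.ofReal (9 * l * (8 * Real.sqrt l) ^ (k - 1)) := by gcongr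
    _ = _ := by
      rw [← ENNReal.ofReal_mul (by positivity), Real.mul_rpow two_pos.le hl.le,
        ← rpow_mul_sqrt_pow hl hk, mul_pow]
      congr 1
      ring

lemma exists_unit_smul_eq {k : ℕ} (hk : 1 ≤ k) (x : EuclideanSpace ℝ (Fin k)) :
    ∃ u : EuclideanSpace ℝ (Fin k), ‖u‖ = 1 ∧ x = ‖x‖ • u := by
  have : Nontrivial (EuclideanSpace ℝ (Fin k)) :=
    Module.nontrivial_of_finrank_pos (R := ℝ) (by rw [finrank_euclideanSpace_fin]; omega)
  by_cases hx : x = 0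
  · obtain ⟨u, hu⟩ := exists_norm_eq (EuclideanSpace ℝ (Fin k)) (zero_le_one' ℝ)
    exact ⟨u, hu, by simp [hx]⟩
  · have h : ‖x‖ ≠ 0 := norm_ne_zero_iff.2 hx
    exact ⟨‖x‖⁻¹ • x, by simp [norm_smul, h], by rw [smul_smul, mul_inv_cancel₀ h, one_smul]⟩

/-- Mass of the part of a shell close to a given point of the shell. -/
lemma exists_betaMeasure_close_le {β : ℝ} (hβ : 0 ≤ β) {k : ℕ} (hk : 1 ≤ k) :
    ∃ C : ℝ, 0 < C ∧ ∀ l : ℝ, 0 < l → l ≤ 1 → ∀ x : EuclideanSpace ℝ (Fin k), ‖x‖ ≤ 1 →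
      1 - ‖x‖ ≤ l →
      betaMeasure β k {y | 1 - ‖y‖ ≤ l ∧ ‖y - x‖ ≤ 3 * Real.sqrt l} ≤
        ENNReal.ofReal (C * l ^ (((k : ℝ) + 1) / 2 + β)) := by
  obtain ⟨C, hC, h⟩ := exists_betaMeasure_near_le hβ hk
  refine ⟨C, hC, fun l hl hl1 x hx hx1 => ?_⟩
  obtain ⟨u, hu, hxu⟩ := exists_unit_smul_eq hk x
  refine (measure_mono ?_).trans (h l hl hl1 u hu)
  rintro y ⟨hy1, hy2⟩
  refine ⟨hy1, ?_⟩
  have h1 : ‖x - u‖ ≤ l := by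
    have : x - u = (‖x‖ - 1) • u := by rw [sub_smul, one_smul, ← hxu]
    rw [this, norm_smul, hu, mul_one, Real.norm_eq_abs, abs_le]
    constructor <;> linarith
  have h2 : l ≤ Real.sqrt l := Real.le_sqrt_of_sq_le (by nlinarith)
  calc ‖y - u‖ = ‖(y - x) + (x - u)‖ := by congr 1; abel
    _ ≤ ‖y - x‖ + ‖x - u‖ := norm_add_le _ _
    _ ≤ _ := by linarith

/-- Mass of a cap, upper bound. -/
lemma exists_betaMeasure_cap_le {β : ℝ} (hβ : 0 ≤ β) {k : ℕ} (hk : 1 ≤ k) :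
    ∃ C : ℝ, 1 ≤ C ∧ ∀ l : ℝ, 0 < l → ∀ u : EuclideanSpace ℝ (Fin k), ‖u‖ = 1 →
      betaMeasure β k {y | 1 - inner ℝ u y ≤ l} ≤
        ENNReal.ofReal (C * l ^ (((k : ℝ) + 1) / 2 + β)) := by
  obtain ⟨C, hC, h⟩ := exists_betaMeasure_near_le hβ hk
  have := isProbabilityMeasure_betaMeasure (β := β) (by linarith) hk
  refine ⟨max C 1, le_max_right _ _, fun l hl u hu => ?_⟩
  rcases le_or_gt l 1 with hl1 | hl1
  · calc betaMeasure β k {y | 1 - inner ℝ u y ≤ l}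
        ≤ betaMeasure β k {y | 1 - ‖y‖ ≤ l ∧ ‖y - u‖ ≤ 4 * Real.sqrt l} := by
          refine measure_mono_ae ?_
          filter_upwards [ae_norm_lt_one_betaMeasure β hk] with y hy hyl
          have h1 : 1 - inner ℝ u y ≤ l := hyl
          have h2 := real_inner_le_norm u y
          rw [hu, one_mul] at h2
          refine ⟨by linarith, ?_⟩
          have h3 := norm_sub_sq_real y u
          rw [hu, real_inner_comm] at h3
          have h4 : ‖y - u‖ ≤ Real.sqrt (2 * l) := by
            refine Real.le_sqrt_of_sq_le ?_
            nlinarith [norm_nonneg y]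
          refine h4.trans (Real.sqrt_le_iff.2 ⟨by positivity, ?_⟩)
          rw [mul_pow, Real.sq_sqrt hl.le]
          linarith
      _ ≤ ENNReal.ofReal (C * l ^ (((k : ℝ) + 1) / 2 + β)) := h l hl hl1 u hu
      _ ≤ _ := by
        refine ENNReal.ofReal_le_ofReal ?_
        have := le_max_left C 1
        gcongr
  · refine prob_le_one.trans ?_
    rw [← ENNReal.ofReal_one]
    refine ENNReal.ofReal_le_ofReal ?_
    have h1 : 1 ≤ l ^ (((k : ℝ) + 1) / 2 + β) := Real.one_le_rpow hl1.le (by positivity)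
    have h2 := le_max_right C 1
    nlinarith

/-- Mass of a cap, lower bound. -/
lemma exists_le_betaMeasure_cap {β : ℝ} (hβ : 0 ≤ β) {k : ℕ} (hk : 1 ≤ k) :
    ∃ c : ℝ, 0 < c ∧ ∀ l : ℝ, 0 < l → l ≤ 1 → ∀ u : EuclideanSpace ℝ (Fin k), ‖u‖ = 1 →
      ENNReal.ofReal (c * l ^ (((k : ℝ) + 1) / 2 + β)) ≤
        betaMeasure β k {y | 1 - inner ℝ u y < l} := by
  have hc := betaConst_pos (β := β) (by linarith) k
  have hk0 : (0 : ℝ) < k := by exact_mod_cast hk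
  have hk1 : (1 : ℝ) ≤ k := by exact_mod_cast hk
  have hsk : 0 < Real.sqrt k := Real.sqrt_pos.2 hk0
  refine ⟨betaConst β k * (1 / 4) ^ β * (1 / 4 * (1 / Real.sqrt k) ^ (k - 1)), by positivity,
    fun l hl hl1 u hu => ?_⟩
  let i₀ : Fin k := ⟨0, hk⟩
  obtain ⟨b, hb⟩ := exists_orthonormalBasis_apply_eq i₀ u hu
  set w := Real.sqrt l / (2 * Real.sqrt k) with hw
  have hw0 : 0 < w := by have := Real.sqrt_pos.2 hl; positivity
  have hw2 : w ^ 2 = l / (4 * k) := by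
    rw [hw, div_pow, mul_pow, Real.sq_sqrt hl.le, Real.sq_sqrt hk0.le]; norm_num
  let s : Fin k → Set ℝ := fun i => if i = i₀ then Set.Icc (1 - 3 / 4 * l) (1 - 1 / 2 * l) else
    Set.Icc (-w) w
  have hsm : ∀ i, MeasurableSet (s i) := fun i => by
    simp only [s]; split_ifs <;> exact measurableSet_Icc
  have hTm : MeasurableSet {y | ∀ i, inner ℝ (b i) y ∈ s i} := by
    have : {y | ∀ i, inner ℝ (b i) y ∈ s i} = ⋂ i, (fun y => inner ℝ (b i) y) ⁻¹' s i := by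
      ext y; simp
    rw [this]
    exact MeasurableSet.iInter fun i => (by fun_prop : Measurable fun y => inner ℝ (b i) y) (hsm i)
  have hsub : {y | ∀ i, inner ℝ (b i) y ∈ s i} ⊆ {y | 1 - inner ℝ u y < l} := by
    intro y hy
    have := hy i₀
    simp only [s, if_true, hb, Set.mem_Icc] at this
    change 1 - inner ℝ u y < l
    linarith [this.1]
  refine le_trans ?_ (measure_mono hsub)
  refine le_trans ?_ (le_betaMeasure_of_forall hβ (l := l / 4) (by positivity) hTm ?_)
  · rw [volume_orthonormal_box b s hsm,
      prod_eq_mul_pow_of_ne i₀ _ (ENNReal.ofReal (1 / 4 * l)) (ENNReal.ofReal (2 * w)),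
      ← ENNReal.ofReal_pow (by positivity), ← ENNReal.ofReal_mul (by positivity),
      ← ENNReal.ofReal_mul (by positivity)]
    · refine ENNReal.ofReal_le_ofReal (le_of_eq ?_)
      have e : 2 * w = 1 / Real.sqrt k * Real.sqrt l := by rw [hw]; field_simp
      rw [← rpow_mul_sqrt_pow hl hk, e, mul_pow, show l / 4 = 1 / 4 * l by ring,
        Real.mul_rpow (by norm_num) hl.le]
      ring
    · simp only [s, if_true, Real.volume_Icc]
      congr 1; ring
    · intro i hi
      simp only [s, if_neg hi, Real.volume_Icc]
      congr 1; ring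
  · intro y hy
    have h0 := hy i₀
    simp only [s, if_true, hb, Set.mem_Icc] at h0
    have hn : ‖y‖ ^ 2 ≤ 1 - l / 4 := by
      rw [← b.sum_sq_norm_inner_right y, ← Finset.add_sum_erase _ _ (Finset.mem_univ i₀)]
      have h1 : ∑ i ∈ Finset.univ.erase i₀, ‖inner ℝ (b i) y‖ ^ 2 ≤
          ∑ i ∈ Finset.univ.erase i₀, w ^ 2 := by
        refine Finset.sum_le_sum fun i hi => ?_
        have h2 := hy i
        simp only [s, if_neg (Finset.ne_of_mem_erase hi), Set.mem_Icc, ← abs_le] at h2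
        exact pow_le_pow_left₀ (norm_nonneg _) h2 2
      have h3 : ∑ i ∈ Finset.univ.erase i₀, w ^ 2 ≤ l / 4 := by
        rw [Finset.sum_const, Finset.card_erase_of_mem (Finset.mem_univ _), Finset.card_univ,
          Fintype.card_fin, nsmul_eq_mul, hw2, Nat.cast_sub hk]
        rw [mul_div_assoc', div_le_div_iff₀ (by positivity) (by positivity)]
        push_cast
        nlinarith
      have h4 : ‖inner ℝ (b i₀) y‖ ^ 2 ≤ 1 - 1 / 2 * l := by
        rw [hb, Real.norm_eq_abs, sq_abs]
        nlinarith [h0.1, h0.2]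
      linarith
    exact ⟨by nlinarith [norm_nonneg y], by linarith⟩

end BetaEstimates

section Product

/-- The law of one point together with independent points each in relation with it. -/
lemma measure_pi_pair {ι X : Type*} [Fintype ι] [DecidableEq ι] [MeasurableSpace X]
    (μ : Measure X) [SigmaFinite μ] (p₀ : ι) {S : Set X} (hS : MeasurableSet S) {R : Set (X × X)}
    (hR : MeasurableSet R) :
    Measure.pi (fun _ : ι => μ) {y | y p₀ ∈ S ∧ ∀ p ≠ p₀, (y p₀, y p) ∈ R} =
      ∫⁻ z in S, μ {w | (z, w) ∈ R} ^ (Fintype.card ι - 1) ∂μ := by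
  have h₀ := measurePreserving_piEquivPiSubtypeProd (fun _ : ι => μ) (· = p₀)
  rw [Subsingleton.elim (Subtype.fintype (· = p₀)) (Fintype.subtypeEq p₀)] at h₀
  have h := ((measurePreserving_piUnique (fun _ : {i : ι // i = p₀} => μ)).prod
    (MeasurePreserving.id (Measure.pi fun _ : {i : ι // ¬ i = p₀} => μ))).comp h₀
  let T : Set (X × ({i : ι // ¬ i = p₀} → X)) := {q | q.1 ∈ S ∧ ∀ p, (q.1, q.2 p) ∈ R}
  have hT : MeasurableSet T := by
    have : T = Prod.fst ⁻¹' S ∩ ⋂ p, (fun q : X × ({i : ι // ¬ i = p₀} → X) =>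
        (q.1, q.2 p)) ⁻¹' R := by
      ext q; simp [T]
    rw [this]
    refine (measurable_fst hS).inter (MeasurableSet.iInter fun p => ?_)
    exact (measurable_fst.prodMk ((measurable_pi_apply p).comp measurable_snd)) hR
  have hpre : {y : ι → X | y p₀ ∈ S ∧ ∀ p ≠ p₀, (y p₀, y p) ∈ R} =
      (Prod.map (MeasurableEquiv.piUnique fun _ : {i : ι // i = p₀} => X) id ∘
        MeasurableEquiv.piEquivPiSubtypeProd (fun _ : ι => X) (· = p₀)) ⁻¹' T := by
    ext y
    change _ ↔ y p₀ ∈ S ∧ ∀ p : {i : ι // ¬ i = p₀}, (y p₀, y p) ∈ R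
    simp [Subtype.forall]
  rw [hpre, h.measure_preimage hT.nullMeasurableSet, Measure.prod_apply hT,
    ← lintegral_indicator hS]
  refine lintegral_congr fun z => ?_
  by_cases hz : z ∈ S
  · rw [Set.indicator_of_mem hz]
    have : Prod.mk z ⁻¹' T = Set.univ.pi fun _ => {w | (z, w) ∈ R} := by
      ext w; simp [T, hz, Set.mem_pi]
    rw [this, Measure.pi_pi, Finset.prod_const, Finset.card_univ, Fintype.card_subtype_compl]
    simp
  · rw [Set.indicator_of_notMem hz]
    have : Prod.mk z ⁻¹' T = ∅ := by
      ext w; simp [T, hz]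
    rw [this, measure_empty]

variable {m : ℕ} {dv : Fin m → ℕ} {βv : Fin m → ℝ}

lemma isProbabilityMeasure_blockBetaMeasure (hdv : ∀ i, 1 ≤ dv i) (hβ : ∀ i, 0 ≤ βv i) :
    IsProbabilityMeasure (blockBetaMeasure dv βv) := by
  have : ∀ i, IsProbabilityMeasure (betaMeasure (βv i) (dv i)) := fun i =>
    isProbabilityMeasure_betaMeasure (by linarith [hβ i]) (hdv i)
  unfold blockBetaMeasure
  infer_instance

lemma blockBetaMeasure_pi (hdv : ∀ i, 1 ≤ dv i) (hβ : ∀ i, 0 ≤ βv i)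
    (s : ∀ i, Set (EuclideanSpace ℝ (Fin (dv i)))) :
    blockBetaMeasure dv βv {y | ∀ i, y i ∈ s i} = ∏ i, betaMeasure (βv i) (dv i) (s i) := by
  have : ∀ i, IsProbabilityMeasure (betaMeasure (βv i) (dv i)) := fun i =>
    isProbabilityMeasure_betaMeasure (by linarith [hβ i]) (hdv i)
  rw [blockBetaMeasure, ← Measure.pi_pi]
  congr 1
  ext y; simp [Set.mem_pi]

lemma ae_norm_lt_one_blockBetaMeasure (hdv : ∀ i, 1 ≤ dv i) (hβ : ∀ i, 0 ≤ βv i) :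
    ∀ᵐ y ∂blockBetaMeasure dv βv, ∀ i, ‖y i‖ < 1 := by
  have : ∀ i, IsProbabilityMeasure (betaMeasure (βv i) (dv i)) := fun i =>
    isProbabilityMeasure_betaMeasure (by linarith [hβ i]) (hdv i)
  rw [ae_all_iff]
  intro i
  exact (Measure.quasiMeasurePreserving_eval (μ := fun i => betaMeasure (βv i) (dv i)) i).ae
    (ae_norm_lt_one_betaMeasure (βv i) (hdv i))

lemma blockBetaMeasure_hyperplane (hdv : ∀ i, 1 ≤ dv i) (hβ : ∀ i, 0 ≤ βv i)
    (f : (Π i, EuclideanSpace ℝ (Fin (dv i))) →ₗ[ℝ] ℝ) (t : ℝ) (hf : f ≠ 0) :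
    blockBetaMeasure dv βv {y | f y = t} = 0 := by
  have : ∀ i, IsProbabilityMeasure (betaMeasure (βv i) (dv i)) := fun i =>
    isProbabilityMeasure_betaMeasure (by linarith [hβ i]) (hdv i)
  obtain ⟨i, hi⟩ : ∃ i, f ∘ₗ LinearMap.single ℝ _ i ≠ 0 := by
    by_contra! h
    refine hf (LinearMap.pi_ext fun i x => ?_)
    simpa using LinearMap.congr_fun (h i) x
  have hm : MeasurableSet {y | f y = t} :=
    (f.continuous_of_finiteDimensional.measurable) (measurableSet_singleton t)
  refine measure_pi_eq_zero_of_update _ hm i fun x => ?_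
  refine measure_mono_null (fun y hy => ?_) (betaMeasure_hyperplane (βv i)
    (f ∘ₗ LinearMap.single ℝ (fun i => EuclideanSpace ℝ (Fin (dv i))) i)
    (t - f (Function.update x i 0)) hi)
  have h1 : f (Function.update x i y) = t := hy
  have h2 : Function.update x i y = Function.update x i 0 + Pi.single i y := by
    ext1 j
    by_cases hj : j = i
    · subst hj; simp
    · simp [Function.update_of_ne hj, Pi.single_eq_of_ne hj]
  rw [h2, map_add] at h1
  simp only [Set.mem_ofPred_eq, LinearMap.comp_apply, LinearMap.single_apply]
  linarith

end Product

section ExpectedFaceCount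

variable {m : ℕ} {dv : Fin m → ℕ} {βv : Fin m → ℝ}

lemma finrank_blockSpace {d : ℕ} (hsum : ∑ i, dv i = d) :
    Module.finrank ℝ (Π i, EuclideanSpace ℝ (Fin (dv i))) = d := by
  rw [Module.finrank_pi_fintype]
  simpa using hsum

lemma ae_generalPosition_block (hdv : ∀ i, 1 ≤ dv i) (hβ : ∀ i, 0 ≤ βv i) (n : ℕ) :
    ∀ᵐ x ∂(Measure.pi fun _ : Fin n => blockBetaMeasure dv βv), GeneralPosition x := by
  have := isProbabilityMeasure_blockBetaMeasure (βv := βv) hdv hβ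
  exact ae_generalPosition _ (blockBetaMeasure_hyperplane hdv hβ)

lemma measurableSet_isSupported {n : ℕ} {I : Finset (Fin n)} (hI : I.Nonempty) :
    MeasurableSet {x : Fin n → Π i, EuclideanSpace ℝ (Fin (dv i)) | IsSupported I x} :=
  (isClosed_isSupported hI).measurableSet

lemma expectedFaceCount_eq {d : ℕ} (hd : 1 ≤ d) (hsum : ∑ i, dv i = d)
    (hdv : ∀ i, 1 ≤ dv i) (hβ : ∀ i, 0 ≤ βv i) (n : ℕ) :
    expectedFaceCount dv βv (d - 1) n =
      (∑ I ∈ Finset.univ.powersetCard d,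
        Measure.pi (fun _ : Fin n => blockBetaMeasure dv βv) {x | IsSupported I x}).toReal := by
  classical
  have := isProbabilityMeasure_blockBetaMeasure (βv := βv) hdv hβ
  have hfr := finrank_blockSpace hsum
  rw [expectedFaceCount, ENNReal.toReal_sum (fun _ _ => measure_ne_top _ _)]
  have h1 : ∀ᵐ x ∂(Measure.pi fun _ : Fin n => blockBetaMeasure dv βv),
      (faceCount (convexHull ℝ (Set.range x)) (d - 1) : ℝ) =
        ∑ I ∈ Finset.univ.powersetCard d, {x | IsSupported I x}.indicator (fun _ => (1 : ℝ)) x := by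
    filter_upwards [ae_generalPosition_block hdv hβ n] with x hx
    have h2 := hx.faceCount_eq (by rw [hfr]; exact hd)
    rw [hfr] at h2
    rw [h2, Finset.card_filter]
    push_cast
    refine Finset.sum_congr rfl fun I _ => ?_
    by_cases h : IsSupported I x <;> simp [h]
  have hm : ∀ I ∈ (Finset.univ : Finset (Fin n)).powersetCard d,
      MeasurableSet {x : Fin n → Π i, EuclideanSpace ℝ (Fin (dv i)) | IsSupported I x} := by
    intro I hI
    refine measurableSet_isSupported (Finset.card_pos.1 ?_)
    rw [(Finset.mem_powersetCard.1 hI).2]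
    exact hd
  rw [integral_congr_ae h1, integral_finsetSum]
  · refine Finset.sum_congr rfl fun I hI => ?_
    rw [integral_indicator (hm I hI), setIntegral_const]
    simp [Measure.real]
  · intro I hI
    exact (integrable_const _).indicator (hm I hI)

end ExpectedFaceCount

section Scale

/-- The exponent governing the beta mass of a cap. -/
def capExponent (β : ℝ) (k : ℕ) : ℝ := ((k : ℝ) + 1) / 2 + β

lemma capExponent_pos {β : ℝ} (hβ : 0 ≤ β) (k : ℕ) : 0 < capExponent β k := by
  unfold capExponent
  positivity

/-- The length whose power with exponent `a` is `2⁻ʲ`. -/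
def dyadicScale (a : ℝ) (j : ℕ) : ℝ := ((1 / 2 : ℝ) ^ j) ^ (1 / a)

lemma dyadicScale_pos (a : ℝ) (j : ℕ) : 0 < dyadicScale a j := by
  unfold dyadicScale
  positivity

lemma dyadicScale_le_one {a : ℝ} (ha : 0 < a) (j : ℕ) : dyadicScale a j ≤ 1 :=
  Real.rpow_le_one (by positivity) (pow_le_one₀ (by norm_num) (by norm_num)) (by positivity)

lemma dyadicScale_rpow (a b : ℝ) (j : ℕ) :
    dyadicScale a j ^ b = ((1 / 2 : ℝ) ^ (b / a)) ^ j := by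
  unfold dyadicScale
  rw [← Real.rpow_mul (by positivity), ← Real.rpow_natCast, ← Real.rpow_natCast,
    ← Real.rpow_mul (by norm_num), ← Real.rpow_mul (by norm_num)]
  congr 1
  ring

lemma dyadicScale_rpow_self {a : ℝ} (ha : 0 < a) (j : ℕ) :
    dyadicScale a j ^ a = (1 / 2 : ℝ) ^ j := by
  rw [dyadicScale_rpow, div_self ha.ne', Real.rpow_one]

lemma dyadicScale_succ (a : ℝ) (j : ℕ) :
    dyadicScale a (j + 1) = (1 / 2 : ℝ) ^ (1 / a) * dyadicScale a j := by
  unfold dyadicScale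
  rw [pow_succ, mul_comm, Real.mul_rpow (by positivity) (by positivity)]

lemma dyadicScale_antitone {a : ℝ} (ha : 0 < a) : Antitone (dyadicScale a) := fun _ _ hij =>
  Real.rpow_le_rpow (by positivity) (pow_le_pow_of_le_one (by norm_num) (by norm_num) hij)
    (by positivity)

end Scale

section Exposed

variable {m : ℕ} {dv : Fin m → ℕ} {βv : Fin m → ℝ}

/-- A linear functional adapted to a point of the product of balls. -/
def blockFunctional (z : Π i, EuclideanSpace ℝ (Fin (dv i))) :
    (Π i, EuclideanSpace ℝ (Fin (dv i))) →L[ℝ] ℝ :=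
  ∑ i, (‖z i‖ * (1 - ‖z i‖))⁻¹ • (innerSL ℝ (z i)).comp (ContinuousLinearMap.proj i)

lemma blockFunctional_apply (z y : Π i, EuclideanSpace ℝ (Fin (dv i))) :
    blockFunctional z y = ∑ i, (‖z i‖ * (1 - ‖z i‖))⁻¹ * inner ℝ (z i) (y i) := by
  simp [blockFunctional]

/-- The second point lies below the first one for the functional adapted to the first one. -/
def belowRel (dv : Fin m → ℕ) : Set ((Π i, EuclideanSpace ℝ (Fin (dv i))) ×
    (Π i, EuclideanSpace ℝ (Fin (dv i)))) :=
  {p | blockFunctional p.1 p.2 < blockFunctional p.1 p.1}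

lemma measurableSet_belowRel : MeasurableSet (belowRel dv) := by
  unfold belowRel
  simp only [blockFunctional_apply]
  refine measurableSet_lt ?_ ?_ <;> fun_prop

lemma one_sub_inner_le_of_notMem_belowRel {z y : Π i, EuclideanSpace ℝ (Fin (dv i))}
    (hz : ∀ i, 0 < 1 - ‖z i‖) (hz0 : ∀ i, z i ≠ 0) (hy : ∀ i, ‖y i‖ < 1)
    (h : (z, y) ∉ belowRel dv) (i : Fin m) :
    1 - inner ℝ (‖z i‖⁻¹ • z i) (y i) ≤ m * (1 - ‖z i‖) := by
  have hn : ∀ l, 0 < ‖z l‖ := fun l => norm_pos_iff.2 (hz0 l)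
  have h1 : blockFunctional z z ≤ blockFunctional z y := not_lt.1 h
  rw [blockFunctional_apply, blockFunctional_apply] at h1
  let t : Fin m → ℝ := fun l => (1 - inner ℝ (‖z l‖⁻¹ • z l) (y l)) / (1 - ‖z l‖)
  have ht : ∀ l, 0 ≤ t l := fun l => by
    refine div_nonneg ?_ (hz l).le
    have h2 := real_inner_le_norm (‖z l‖⁻¹ • z l) (y l)
    rw [norm_smul, norm_inv, norm_norm, inv_mul_cancel₀ (hn l).ne', one_mul] at h2
    linarith [hy l]
  have hsum : ∑ l, t l ≤ m := by
    have e : ∀ l, t l = 1 + ((‖z l‖ * (1 - ‖z l‖))⁻¹ * inner ℝ (z l) (z l) -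
        (‖z l‖ * (1 - ‖z l‖))⁻¹ * inner ℝ (z l) (y l)) := fun l => by
      have := hn l
      have := hz l
      simp only [t]
      rw [real_inner_smul_left, real_inner_self_eq_norm_sq]
      field_simp
      ring
    simp_rw [e, Finset.sum_add_distrib, Finset.sum_sub_distrib]
    simp only [Finset.sum_const, Finset.card_univ, Fintype.card_fin, nsmul_eq_mul, mul_one]
    linarith
  have hi : t i ≤ m := (Finset.single_le_sum (fun l _ => ht l) (Finset.mem_univ i)).trans hsum
  simp only [t] at hi
  rwa [div_le_iff₀ (hz i)] at hi

lemma exists_measure_notMem_belowRel_le (hm : 1 ≤ m) (hdv : ∀ i, 1 ≤ dv i)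
    (hβ : ∀ i, 0 ≤ βv i) :
    ∃ A : ℕ, ∀ j : Fin m → ℕ, ∀ z : Π i, EuclideanSpace ℝ (Fin (dv i)),
      (∀ i, 0 < 1 - ‖z i‖ ∧ 1 - ‖z i‖ ≤ dyadicScale (capExponent (βv i) (dv i)) (j i) / 2) →
      blockBetaMeasure dv βv {y | (z, y) ∉ belowRel dv} ≤
        ENNReal.ofReal (2 ^ A * (1 / 2) ^ ∑ i, j i) := by
  choose C hC h using fun i => exists_betaMeasure_cap_le (hβ i) (hdv i)
  obtain ⟨A, hA⟩ := pow_unbounded_of_one_lt (∏ i, C i * (m : ℝ) ^ capExponent (βv i) (dv i))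
    (one_lt_two (α := ℝ))
  refine ⟨A, fun j z hz => ?_⟩
  have hm0 : (0 : ℝ) < m := by exact_mod_cast hm
  have hz0 : ∀ i, z i ≠ 0 := fun i hi => by
    have h1 := (hz i).2
    have h2 := dyadicScale_le_one (capExponent_pos (hβ i) (dv i)) (j i)
    rw [hi, norm_zero] at h1
    linarith
  calc blockBetaMeasure dv βv {y | (z, y) ∉ belowRel dv}
      ≤ blockBetaMeasure dv βv {y | ∀ i, y i ∈ {w | 1 - inner ℝ (‖z i‖⁻¹ • z i) w ≤
          m * (1 - ‖z i‖)}} := by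
        refine measure_mono_ae ?_
        filter_upwards [ae_norm_lt_one_blockBetaMeasure hdv hβ] with y hy hyR i
        exact one_sub_inner_le_of_notMem_belowRel (fun i => (hz i).1) hz0 hy hyR i
    _ = ∏ i, betaMeasure (βv i) (dv i) {w | 1 - inner ℝ (‖z i‖⁻¹ • z i) w ≤
          m * (1 - ‖z i‖)} := blockBetaMeasure_pi hdv hβ _
    _ ≤ ∏ i, ENNReal.ofReal ((C i * (m : ℝ) ^ capExponent (βv i) (dv i)) * (1 / 2) ^ j i) := by
        refine Finset.prod_le_prod' fun i _ => ?_
        have ha := capExponent_pos (hβ i) (dv i)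
        refine (h i _ (mul_pos hm0 (hz i).1) _ ?_).trans (ENNReal.ofReal_le_ofReal ?_)
        · rw [norm_smul, norm_inv, norm_norm, inv_mul_cancel₀ (norm_ne_zero_iff.2 (hz0 i))]
        · change C i * (m * (1 - ‖z i‖)) ^ capExponent (βv i) (dv i) ≤ _
          rw [Real.mul_rpow hm0.le (hz i).1.le, ← mul_assoc, ← dyadicScale_rpow_self ha]
          have hC0 : 0 < C i := by linarith [hC i]
          have hs := dyadicScale_pos (capExponent (βv i) (dv i)) (j i)
          refine mul_le_mul_of_nonneg_left (Real.rpow_le_rpow (hz i).1.le ?_ ha.le) (by positivity)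
          linarith [(hz i).2]
    _ ≤ ENNReal.ofReal (2 ^ A * (1 / 2) ^ ∑ i, j i) := by
        have hC0 : ∀ i, 0 < C i := fun i => by linarith [hC i]
        rw [← ENNReal.ofReal_prod_of_nonneg (fun i _ => by have := hC0 i; positivity),
          Finset.prod_mul_distrib, Finset.prod_pow_eq_pow_sum]
        refine ENNReal.ofReal_le_ofReal ?_
        gcongr

lemma exists_le_measure_shells (hdv : ∀ i, 1 ≤ dv i) (hβ : ∀ i, 0 ≤ βv i) :
    ∃ c : ℝ, 0 < c ∧ ∀ j : Fin m → ℕ,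
      ENNReal.ofReal (c * ∏ i,
        ((1 / 2 : ℝ) ^ ((βv i + 1) / capExponent (βv i) (dv i))) ^ j i) ≤
      blockBetaMeasure dv βv {z | ∀ i, z i ∈ {w | dyadicScale (capExponent (βv i) (dv i)) (j i + 1)
        / 2 < 1 - ‖w‖ ∧ 1 - ‖w‖ ≤ dyadicScale (capExponent (βv i) (dv i)) (j i) / 2}} := by
  choose c hc h using fun i => exists_le_betaMeasure_shell (hβ i) (hdv i)
    (ρ := (1 / 2 : ℝ) ^ (1 / capExponent (βv i) (dv i))) (by positivity)
    (Real.rpow_lt_one (by norm_num) (by norm_num)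
      (by have := capExponent_pos (hβ i) (dv i); positivity))
  refine ⟨∏ i, c i * (1 / 2) ^ (βv i + 1), Finset.prod_pos fun i _ => by
    have := hc i; positivity, fun j => ?_⟩
  rw [blockBetaMeasure_pi hdv hβ, ← Finset.prod_mul_distrib,
    ENNReal.ofReal_prod_of_nonneg (fun i _ => by have := hc i; positivity)]
  refine Finset.prod_le_prod' fun i _ => ?_
  have hs := dyadicScale_pos (capExponent (βv i) (dv i)) (j i)
  have hs1 := dyadicScale_le_one (capExponent_pos (hβ i) (dv i)) (j i)
  have := h i (dyadicScale (capExponent (βv i) (dv i)) (j i) / 2) (by positivity) (by linarith)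
  refine le_trans (le_of_eq ?_) (this.trans (le_of_eq ?_))
  · rw [← dyadicScale_rpow,
      div_eq_mul_one_div (dyadicScale (capExponent (βv i) (dv i)) (j i)),
      Real.mul_rpow hs.le (by norm_num)]
    congr 1
    ring
  · simp only [dyadicScale_succ, mul_div_assoc]

end Exposed

section LowerBound

lemma pow_le_card_piAntidiag {ι : Type*} [Fintype ι] [DecidableEq ι] {M : Finset ι}
    (hM : M.Nonempty) (N : ℕ) :
    (N / M.card + 1) ^ (M.card - 1) ≤ (M.piAntidiag N).card := by
  obtain ⟨i₀, hi₀⟩ := hM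
  let T : Finset (ι → ℕ) := Fintype.piFinset fun i =>
    if i ∈ M.erase i₀ then Finset.range (N / M.card + 1) else {0}
  have hTcard : T.card = (N / M.card + 1) ^ (M.card - 1) := by
    rw [Fintype.card_piFinset, ← Finset.card_erase_of_mem hi₀, ← Finset.prod_const,
      ← Finset.prod_subset (Finset.subset_univ (M.erase i₀))]
    · exact Finset.prod_congr rfl fun i hi => by rw [if_pos hi, Finset.card_range]
    · intro i _ hi
      rw [if_neg hi, Finset.card_singleton]
  have h0 : ∀ j ∈ T, ∀ i, i ∉ M.erase i₀ → j i = 0 := fun j hj i hi => by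
    simpa [hi] using Fintype.mem_piFinset.1 hj i
  have h1 : ∀ j ∈ T, ∀ i, i ∈ M.erase i₀ → j i ≤ N / M.card := fun j hj i hi => by
    have := Fintype.mem_piFinset.1 hj i
    rw [if_pos hi, Finset.mem_range] at this
    omega
  have hle : ∀ j ∈ T, ∑ i ∈ M.erase i₀, j i ≤ N := fun j hj =>
    calc ∑ i ∈ M.erase i₀, j i ≤ ∑ i ∈ M.erase i₀, N / M.card := Finset.sum_le_sum (h1 j hj)
      _ ≤ ∑ i ∈ M, N / M.card :=
        Finset.sum_le_sum_of_subset (Finset.erase_subset _ _)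
      _ ≤ N := by
        rw [Finset.sum_const, smul_eq_mul]
        exact Nat.mul_div_le N _
  rw [← hTcard]
  refine Finset.card_le_card_of_injOn
    (fun j => Function.update j i₀ (N - ∑ i ∈ M.erase i₀, j i)) (fun j hj => ?_) ?_
  · rw [Finset.mem_coe, Finset.mem_piAntidiag]
    constructor
    · rw [← Finset.add_sum_erase M _ hi₀, Function.update_self]
      have : ∑ i ∈ M.erase i₀, Function.update j i₀ (N - ∑ i ∈ M.erase i₀, j i) i =
          ∑ i ∈ M.erase i₀, j i := Finset.sum_congr rfl fun i hi =>
        Function.update_of_ne (Finset.ne_of_mem_erase hi) _ _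
      rw [this]
      exact Nat.sub_add_cancel (hle j hj)
    · intro i hi
      by_contra hiM
      have hne : i ≠ i₀ := fun h => hiM (h ▸ hi₀)
      simp only [Function.update_of_ne hne] at hi
      exact hi (h0 j hj i fun h => hiM (Finset.mem_of_mem_erase h))
  · intro j hj j' hj' h
    ext i
    by_cases hi : i = i₀
    · subst hi
      rw [h0 j hj i (Finset.notMem_erase _ _), h0 j' hj' i (Finset.notMem_erase _ _)]
    · simpa [Function.update_of_ne hi] using congr_fun h i

variable {m : ℕ} {dv : Fin m → ℕ} {βv : Fin m → ℝ}

/-- The points whose blocks have prescribed dyadic distances to the boundary. -/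
def dyadicShell (dv : Fin m → ℕ) (βv : Fin m → ℝ) (j : Fin m → ℕ) :
    Set (Π i, EuclideanSpace ℝ (Fin (dv i))) :=
  {z | ∀ i, z i ∈ {w : EuclideanSpace ℝ (Fin (dv i)) |
    dyadicScale (capExponent (βv i) (dv i)) (j i + 1) / 2 < 1 - ‖w‖ ∧
      1 - ‖w‖ ≤ dyadicScale (capExponent (βv i) (dv i)) (j i) / 2}}

lemma measurableSet_dyadicShell (j : Fin m → ℕ) : MeasurableSet (dyadicShell dv βv j) := by
  unfold dyadicShell
  simp only [Set.mem_ofPred_eq]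
  rw [Set.ofPred_forall]
  refine MeasurableSet.iInter fun i => ?_
  have h : Measurable fun z : Π i, EuclideanSpace ℝ (Fin (dv i)) => 1 - ‖z i‖ := by fun_prop
  exact (measurableSet_lt measurable_const h).inter (measurableSet_le h measurable_const)

lemma pairwise_disjoint_dyadicShell (hβ : ∀ i, 0 ≤ βv i) :
    Pairwise (Function.onFun Disjoint (dyadicShell dv βv)) := by
  intro j j' hjj'
  rw [Function.onFun, Set.disjoint_left]
  intro z hz hz'
  refine hjj' (funext fun i => ?_)
  have ha := dyadicScale_antitone (capExponent_pos (hβ i) (dv i))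
  have h1 := hz i
  have h2 := hz' i
  rcases lt_trichotomy (j i) (j' i) with h | h | h
  · have := ha (Nat.succ_le_of_lt h)
    simp only [Nat.succ_eq_add_one] at this
    linarith [h1.1, h2.2]
  · exact h
  · have := ha (Nat.succ_le_of_lt h)
    simp only [Nat.succ_eq_add_one] at this
    linarith [h2.1, h1.2]

/-- The probability that a given sample point is exposed by its adapted functional is at most
the probability that it lies on a facet. -/
lemma measure_exposed_le {d n : ℕ} (hd : 1 ≤ d) (hsum : ∑ i, dv i = d) (hdv : ∀ i, 1 ≤ dv i)
    (hβ : ∀ i, 0 ≤ βv i) (hn : d + 1 ≤ n) (p : Fin n) :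
    Measure.pi (fun _ : Fin n => blockBetaMeasure dv βv)
      {x | x p ∈ (Set.univ : Set (Π i, EuclideanSpace ℝ (Fin (dv i)))) ∧
        ∀ q ≠ p, (x p, x q) ∈ belowRel dv} ≤
      ∑ I ∈ Finset.univ.powersetCard d, if p ∈ I then
        Measure.pi (fun _ : Fin n => blockBetaMeasure dv βv) {x | IsSupported I x} else 0 := by
  have hfr := finrank_blockSpace hsum
  calc _ ≤ Measure.pi (fun _ : Fin n => blockBetaMeasure dv βv)
        (⋃ I ∈ (Finset.univ.powersetCard d).filter (p ∈ ·), {x | IsSupported I x}) := by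
        refine measure_mono_ae ?_
        filter_upwards [ae_generalPosition_block hdv hβ n] with x hx hxp
        obtain ⟨I, hI, hpI, hs⟩ := hx.exists_isSupported_of_exposed (i := p)
          (g := blockFunctional (x p)) (by rw [hfr]; exact hd) (by rw [hfr]; exact hn) hxp.2
        rw [hfr] at hI
        refine Set.mem_biUnion (x := I) ?_ hs
        simp [hI, hpI]
    _ ≤ ∑ I ∈ (Finset.univ.powersetCard d).filter (p ∈ ·),
        Measure.pi (fun _ : Fin n => blockBetaMeasure dv βv) {x | IsSupported I x} :=
      measure_biUnion_finset_le _ _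
    _ = _ := Finset.sum_filter _ _

lemma sum_measure_exposed_le {d n : ℕ} (hd : 1 ≤ d) (hsum : ∑ i, dv i = d)
    (hdv : ∀ i, 1 ≤ dv i) (hβ : ∀ i, 0 ≤ βv i) (hn : d + 1 ≤ n) :
    ∑ p : Fin n, Measure.pi (fun _ : Fin n => blockBetaMeasure dv βv)
      {x | x p ∈ (Set.univ : Set (Π i, EuclideanSpace ℝ (Fin (dv i)))) ∧
        ∀ q ≠ p, (x p, x q) ∈ belowRel dv} ≤
      d * ∑ I ∈ Finset.univ.powersetCard d,
        Measure.pi (fun _ : Fin n => blockBetaMeasure dv βv) {x | IsSupported I x} := by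
  refine (Finset.sum_le_sum fun p _ => measure_exposed_le hd hsum hdv hβ hn p).trans ?_
  rw [Finset.sum_comm, Finset.mul_sum]
  refine Finset.sum_le_sum fun I hI => ?_
  rw [← Finset.sum_filter, Finset.sum_const, nsmul_eq_mul]
  refine le_of_eq ?_
  congr 2
  rw [Finset.filter_univ_mem]
  exact_mod_cast (Finset.mem_powersetCard.1 hI).2

lemma exists_le_measure_iUnion_dyadicShell (hdv : ∀ i, 1 ≤ dv i) (hβ : ∀ i, 0 ≤ βv i) {σ : ℝ}
    {M : Finset (Fin m)} (hM : M.Nonempty)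
    (hσ : ∀ i ∈ M, (βv i + 1) / capExponent (βv i) (dv i) = σ) :
    ∃ c : ℝ, 0 < c ∧ ∀ N : ℕ,
      ENNReal.ofReal (c * ((N : ℝ) + 1) ^ (M.card - 1) * ((1 / 2 : ℝ) ^ σ) ^ N) ≤
        blockBetaMeasure dv βv (⋃ j ∈ M.piAntidiag N, dyadicShell dv βv j) := by
  classical
  obtain ⟨c, hc, h⟩ := exists_le_measure_shells (dv := dv) hdv hβ
  have hq : 0 < (M.card : ℝ) := by exact_mod_cast hM.card_pos
  refine ⟨c * ((M.card : ℝ)⁻¹) ^ (M.card - 1), by positivity, fun N => ?_⟩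
  rw [measure_biUnion_finset ((pairwise_disjoint_dyadicShell hβ).set_pairwise _)
    fun j _ => measurableSet_dyadicShell j]
  calc _ ≤ ENNReal.ofReal ((M.piAntidiag N).card * (c * ((1 / 2 : ℝ) ^ σ) ^ N)) := by
        refine ENNReal.ofReal_le_ofReal ?_
        have h1 : (((N : ℝ) + 1) * (M.card : ℝ)⁻¹) ^ (M.card - 1) ≤ (M.piAntidiag N).card := by
          refine le_trans (pow_le_pow_left₀ (by positivity) ?_ _)
            (by exact_mod_cast pow_le_card_piAntidiag hM N :
              (((N / M.card + 1 : ℕ) : ℝ)) ^ (M.card - 1) ≤ _)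
          rw [← div_eq_mul_inv, div_le_iff₀ hq]
          have := Nat.lt_mul_of_div_lt (Nat.lt_succ_self (N / M.card)) hM.card_pos
          exact_mod_cast (by simpa [mul_comm] using this : N < (N / M.card + 1) * M.card)
        calc _ = (((N : ℝ) + 1) * (M.card : ℝ)⁻¹) ^ (M.card - 1) *
              (c * ((1 / 2 : ℝ) ^ σ) ^ N) := by
              rw [mul_pow]; ring
          _ ≤ _ := mul_le_mul_of_nonneg_right h1 (by positivity)
    _ = ∑ j ∈ M.piAntidiag N, ENNReal.ofReal (c * ((1 / 2 : ℝ) ^ σ) ^ N) := by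
        rw [Finset.sum_const, nsmul_eq_mul, ENNReal.ofReal_mul (by positivity),
          ENNReal.ofReal_natCast]
    _ ≤ _ := by
        refine Finset.sum_le_sum fun j hj => le_trans (le_of_eq ?_) (h j)
        rw [Finset.mem_piAntidiag] at hj
        congr 2
        rw [← Finset.prod_subset (Finset.subset_univ M), ← hj.1, ← Finset.prod_pow_eq_pow_sum]
        · exact Finset.prod_congr rfl fun i hi => by rw [hσ i hi]
        · intro i _ hi
          have : j i = 0 := by
            by_contra h0
            exact hi (hj.2 i h0)
          rw [this, pow_zero]

lemma exp_neg_one_le_one_sub_inv_pow {n : ℕ} (hn : 2 ≤ n) :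
    Real.exp (-1) ≤ (1 - 1 / (n : ℝ)) ^ (n - 1) := by
  have hn1 : (0 : ℝ) < (n - 1 : ℕ) := by exact_mod_cast (by omega : 0 < n - 1)
  have hcast : (n : ℝ) = (n - 1 : ℕ) + 1 := by
    rw [Nat.cast_sub (by omega)]; simp
  have e : 1 - 1 / (n : ℝ) = (1 + 1 / ((n - 1 : ℕ) : ℝ))⁻¹ := by
    rw [hcast]; field_simp; ring
  rw [e, inv_pow, Real.exp_neg]
  refine inv_anti₀ (by positivity) ?_
  calc (1 + 1 / ((n - 1 : ℕ) : ℝ)) ^ (n - 1) ≤ (Real.exp (1 / ((n - 1 : ℕ) : ℝ))) ^ (n - 1) := by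
        refine pow_le_pow_left₀ (by positivity) ?_ _
        rw [add_comm]; exact Real.add_one_le_exp _
    _ = Real.exp 1 := by
        rw [← Real.exp_nat_mul]; congr 1; field_simp

/-- Lower bound for the expected number of facets. -/
lemma exists_le_expectedFaceCount {d : ℕ} (hd : 2 ≤ d) (hm : 1 ≤ m) (hsum : ∑ i, dv i = d)
    (hdv : ∀ i, 1 ≤ dv i) (hβ : ∀ i, 0 ≤ βv i) {σ : ℝ} {M : Finset (Fin m)} (hM : M.Nonempty)
    (hσ0 : 0 ≤ σ) (hσ : ∀ i ∈ M, (βv i + 1) / capExponent (βv i) (dv i) = σ) :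
    ∃ c : ℝ, 0 < c ∧ ∀ n : ℕ, d + 1 ≤ n →
      c * ((n : ℝ) ^ (1 - σ) * Real.log n ^ (M.card - 1)) ≤
        expectedFaceCount dv βv (d - 1) n := by
  have := isProbabilityMeasure_blockBetaMeasure (βv := βv) hdv hβ
  obtain ⟨A, hA⟩ := exists_measure_notMem_belowRel_le (βv := βv) hm hdv hβ
  obtain ⟨c, hc, h⟩ := exists_le_measure_iUnion_dyadicShell hdv hβ hM hσ
  have hd0 : (0 : ℝ) < d := by exact_mod_cast (by omega : 0 < d)
  refine ⟨c * Real.exp (-1) * ((1 / 2 : ℝ) ^ σ) ^ (A + 1) / d, by positivity, fun n hn => ?_⟩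
  have hn0 : (0 : ℝ) < n := by exact_mod_cast (by omega : 0 < n)
  set L := Nat.log 2 n with hL
  set N := A + L + 1 with hN
  have hLn : (2 : ℝ) ^ L ≤ n := by exact_mod_cast Nat.pow_log_le_self 2 (by omega)
  have hnL : (n : ℝ) < 2 ^ (L + 1) := by
    exact_mod_cast Nat.lt_pow_succ_log_self (by norm_num) n
  set S := ⋃ j ∈ M.piAntidiag N, dyadicShell dv βv j with hS
  have hSm : MeasurableSet S := Finset.measurableSet_biUnion _ fun j _ =>
    measurableSet_dyadicShell j
  have hbelow : ∀ z ∈ S, ENNReal.ofReal (1 - 1 / n) ≤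
      blockBetaMeasure dv βv {y | (z, y) ∈ belowRel dv} := by
    intro z hz
    obtain ⟨j, hj, hzj⟩ := Set.mem_iUnion₂.1 hz
    have h1 := hA j z fun i => ⟨lt_trans (half_pos (dyadicScale_pos _ _)) (hzj i).1, (hzj i).2⟩
    have hjs : ∑ i, j i = N := by
      rw [Finset.mem_piAntidiag] at hj
      rw [← hj.1]
      refine (Finset.sum_subset (Finset.subset_univ M) fun i _ hi => ?_).symm
      by_contra h0
      exact hi (hj.2 i h0)
    have h2 : (2 : ℝ) ^ A * (1 / 2) ^ N ≤ 1 / n := by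
      rw [hN, show A + L + 1 = A + (L + 1) by ring, pow_add, ← mul_assoc, ← mul_pow]
      rw [show (2 : ℝ) * (1 / 2) = 1 by norm_num, one_pow, one_mul, one_div_pow]
      exact one_div_le_one_div_of_le hn0 hnL.le
    have hmeas : MeasurableSet {y | (z, y) ∈ belowRel dv} :=
      measurable_prodMk_left measurableSet_belowRel
    have h3 := prob_compl_eq_one_sub (μ := blockBetaMeasure dv βv) hmeas.compl
    rw [compl_compl] at h3
    rw [h3, ENNReal.ofReal_sub _ (by positivity), ENNReal.ofReal_one]
    refine tsub_le_tsub_left (h1.trans (ENNReal.ofReal_le_ofReal ?_)) _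
    rwa [hjs]
  have hexp : ∀ p : Fin n, ENNReal.ofReal (Real.exp (-1)) * blockBetaMeasure dv βv S ≤
      Measure.pi (fun _ : Fin n => blockBetaMeasure dv βv)
        {x | x p ∈ (Set.univ : Set (Π i, EuclideanSpace ℝ (Fin (dv i)))) ∧
          ∀ q ≠ p, (x p, x q) ∈ belowRel dv} := by
    intro p
    rw [measure_pi_pair _ p MeasurableSet.univ measurableSet_belowRel, Fintype.card_fin,
      ← setLIntegral_const]
    refine (setLIntegral_mono' hSm fun z hz => ?_).trans
      (lintegral_mono_set (Set.subset_univ S))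
    have h1n : 1 / (n : ℝ) ≤ 1 := by
      rw [div_le_one hn0]; exact_mod_cast (by omega : 1 ≤ n)
    calc ENNReal.ofReal (Real.exp (-1)) ≤ ENNReal.ofReal (1 - 1 / n) ^ (n - 1) := by
          rw [← ENNReal.ofReal_pow (by linarith)]
          exact ENNReal.ofReal_le_ofReal (exp_neg_one_le_one_sub_inv_pow (by omega))
      _ ≤ _ := pow_le_pow_left₀ zero_le (hbelow z hz) _
  have htotal := (Finset.sum_le_sum fun (p : Fin n) (_ : p ∈ Finset.univ) => hexp p).trans
    (sum_measure_exposed_le (by omega) hsum hdv hβ hn)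
  rw [Finset.sum_const, Finset.card_univ, Fintype.card_fin, nsmul_eq_mul] at htotal
  set T := ∑ I ∈ Finset.univ.powersetCard d,
    Measure.pi (fun _ : Fin n => blockBetaMeasure dv βv) {x | IsSupported I x} with hT
  have hTtop : T ≠ ⊤ := ENNReal.sum_ne_top.2 fun I _ => measure_ne_top _ _
  have hE : expectedFaceCount dv βv (d - 1) n = T.toReal :=
    expectedFaceCount_eq (by omega) hsum hdv hβ n
  have h4 : ENNReal.ofReal ((n : ℝ) * (Real.exp (-1) *
      (c * ((N : ℝ) + 1) ^ (M.card - 1) * ((1 / 2 : ℝ) ^ σ) ^ N))) ≤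
      ENNReal.ofReal (d * T.toReal) := by
    rw [ENNReal.ofReal_mul hn0.le, ENNReal.ofReal_mul (Real.exp_pos _).le,
      ENNReal.ofReal_mul hd0.le, ENNReal.ofReal_toReal hTtop, ENNReal.ofReal_natCast,
      ENNReal.ofReal_natCast]
    exact le_trans (by gcongr; exact h N) htotal
  have h5 := (ENNReal.ofReal_le_ofReal_iff (by positivity)).1 h4
  rw [hE, div_mul_eq_mul_div, div_le_iff₀ hd0, mul_comm T.toReal]
  refine le_trans ?_ h5
  have hlog : Real.log n ≤ (N : ℝ) + 1 := by
    have h6 : Real.log n ≤ (L + 1 : ℕ) * Real.log 2 := by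
      rw [← Real.log_pow]
      exact Real.log_le_log hn0 (by exact_mod_cast hnL.le)
    have h7 : Real.log 2 ≤ 1 := by linarith [Real.log_two_lt_d9]
    have h8 : ((L + 1 : ℕ) : ℝ) ≤ (N : ℝ) + 1 := by
      exact_mod_cast (by omega : L + 1 ≤ N + 1)
    have h9 : (0 : ℝ) ≤ (L + 1 : ℕ) := by positivity
    nlinarith
  have hlog0 : 0 ≤ Real.log n := Real.log_natCast_nonneg n
  have hpow : (n : ℝ) ^ (1 - σ) ≤ n * ((1 / 2 : ℝ) ^ σ) ^ L := by
    rw [Real.rpow_sub hn0, Real.rpow_one, div_eq_mul_inv]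
    refine mul_le_mul_of_nonneg_left ?_ hn0.le
    rw [← Real.rpow_natCast, ← Real.rpow_mul (by norm_num), mul_comm, Real.rpow_mul (by norm_num),
      ← Real.inv_rpow hn0.le, Real.rpow_natCast]
    refine Real.rpow_le_rpow (by positivity) ?_ hσ0
    rw [one_div_pow, one_div]
    exact inv_anti₀ (by positivity) hLn
  calc c * Real.exp (-1) * ((1 / 2 : ℝ) ^ σ) ^ (A + 1) *
        ((n : ℝ) ^ (1 - σ) * Real.log n ^ (M.card - 1))
      ≤ c * Real.exp (-1) * ((1 / 2 : ℝ) ^ σ) ^ (A + 1) *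
        ((n * ((1 / 2 : ℝ) ^ σ) ^ L) * ((N : ℝ) + 1) ^ (M.card - 1)) := by gcongr
    _ = _ := by
      rw [hN, show A + L + 1 = (A + 1) + L by ring, pow_add]
      ring

end LowerBound

section Box

variable {m : ℕ} {dv : Fin m → ℕ} {βv : Fin m → ℝ}

/-- The points of the product of balls within prescribed dyadic distances to the boundary. -/
def nearBoundary (dv : Fin m → ℕ) (βv : Fin m → ℝ) (j : Fin m → ℕ) :
    Set (Π i, EuclideanSpace ℝ (Fin (dv i))) :=
  {z | ∀ i, z i ∈ {w : EuclideanSpace ℝ (Fin (dv i)) | ‖w‖ ≤ 1 ∧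
    1 - ‖w‖ ≤ dyadicScale (capExponent (βv i) (dv i)) (j i)}}

/-- The pairs of points that are close at prescribed dyadic scales, the second one being near the
boundary. -/
def closeRel (dv : Fin m → ℕ) (βv : Fin m → ℝ) (j : Fin m → ℕ) :
    Set ((Π i, EuclideanSpace ℝ (Fin (dv i))) × (Π i, EuclideanSpace ℝ (Fin (dv i)))) :=
  {p | ∀ i, p.2 i ∈ {w : EuclideanSpace ℝ (Fin (dv i)) |
    1 - ‖w‖ ≤ dyadicScale (capExponent (βv i) (dv i)) (j i) ∧
      ‖w - p.1 i‖ ≤ 3 * Real.sqrt (dyadicScale (capExponent (βv i) (dv i)) (j i))}}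

lemma measurableSet_nearBoundary (j : Fin m → ℕ) : MeasurableSet (nearBoundary dv βv j) := by
  unfold nearBoundary
  simp only [Set.mem_ofPred_eq]
  rw [Set.ofPred_forall]
  refine MeasurableSet.iInter fun i => ?_
  have h : Measurable fun z : Π i, EuclideanSpace ℝ (Fin (dv i)) => ‖z i‖ := by fun_prop
  exact (measurableSet_le h measurable_const).inter
    (measurableSet_le (measurable_const.sub h) measurable_const)

lemma measurableSet_closeRel (j : Fin m → ℕ) : MeasurableSet (closeRel dv βv j) := by
  unfold closeRel
  simp only [Set.mem_ofPred_eq]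
  rw [Set.ofPred_forall]
  refine MeasurableSet.iInter fun i => ?_
  have h : Measurable fun p : (Π i, EuclideanSpace ℝ (Fin (dv i))) ×
    (Π i, EuclideanSpace ℝ (Fin (dv i))) => 1 - ‖p.2 i‖ := by fun_prop
  have h' : Measurable fun p : (Π i, EuclideanSpace ℝ (Fin (dv i))) ×
    (Π i, EuclideanSpace ℝ (Fin (dv i))) => ‖p.2 i - p.1 i‖ := by fun_prop
  exact (measurableSet_le h measurable_const).inter (measurableSet_le h' measurable_const)

/-- The families of points near the boundary that are all close to a reference one. -/
def closeFamily {κ : Type*} (dv : Fin m → ℕ) (βv : Fin m → ℝ) (p₀ : κ) (j : Fin m → ℕ) :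
    Set (κ → Π i, EuclideanSpace ℝ (Fin (dv i))) :=
  {y | y p₀ ∈ nearBoundary dv βv j ∧ ∀ p ≠ p₀, (y p₀, y p) ∈ closeRel dv βv j}

lemma measurableSet_closeFamily {κ : Type*} [Countable κ] (p₀ : κ) (j : Fin m → ℕ) :
    MeasurableSet (closeFamily dv βv p₀ j) := by
  have : closeFamily dv βv p₀ j = (fun y => y p₀) ⁻¹' nearBoundary dv βv j ∩
      ⋂ p, ⋂ (_ : p ≠ p₀), (fun y : κ → Π i, EuclideanSpace ℝ (Fin (dv i)) =>
        (y p₀, y p)) ⁻¹' closeRel dv βv j := by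
    ext y; simp [closeFamily]
  rw [this]
  refine (measurable_pi_apply p₀ (measurableSet_nearBoundary j)).inter
    (MeasurableSet.iInter fun p => MeasurableSet.iInter fun _ => ?_)
  exact ((measurable_pi_apply p₀).prodMk (measurable_pi_apply p)) (measurableSet_closeRel j)

lemma exists_measure_closeFamily_le (hdv : ∀ i, 1 ≤ dv i) (hβ : ∀ i, 0 ≤ βv i) (d : ℕ) :
    ∃ C : ℝ, 0 < C ∧ ∀ (κ : Type) [Fintype κ] (_ : Fintype.card κ = d) (p₀ : κ) (j : Fin m → ℕ),
      Measure.pi (fun _ : κ => blockBetaMeasure dv βv) (closeFamily dv βv p₀ j) ≤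
        ENNReal.ofReal (C * (∏ i, ((1 / 2 : ℝ) ^
          ((βv i + 1) / capExponent (βv i) (dv i))) ^ j i) *
            ((1 / 2 : ℝ) ^ ∑ i, j i) ^ (d - 1)) := by
  classical
  choose C₁ hC₁ h₁ using fun i => exists_betaMeasure_shell_le (hβ i) (hdv i)
  choose C₂ hC₂ h₂ using fun i => exists_betaMeasure_close_le (hβ i) (hdv i)
  have := isProbabilityMeasure_blockBetaMeasure (βv := βv) hdv hβ
  have hP₁ : 0 < ∏ i, C₁ i := Finset.prod_pos fun i _ => hC₁ i
  have hP₂ : 0 < ∏ i, C₂ i := Finset.prod_pos fun i _ => hC₂ i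
  refine ⟨(∏ i, C₁ i) * (∏ i, C₂ i) ^ (d - 1), by positivity, fun κ _ hκ p₀ j => ?_⟩
  have hs : blockBetaMeasure dv βv (nearBoundary dv βv j) ≤
      ENNReal.ofReal ((∏ i, C₁ i) * ∏ i, ((1 / 2 : ℝ) ^
          ((βv i + 1) / capExponent (βv i) (dv i))) ^ j i) := by
    rw [nearBoundary, blockBetaMeasure_pi hdv hβ, ← Finset.prod_mul_distrib,
      ENNReal.ofReal_prod_of_nonneg (fun i _ => by have := hC₁ i; positivity)]
    refine Finset.prod_le_prod' fun i _ => ?_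
    rw [← dyadicScale_rpow]
    refine (measure_mono ?_).trans (h₁ i _ (dyadicScale_pos _ _)
      (dyadicScale_le_one (capExponent_pos (hβ i) _) _))
    exact fun w hw => hw.2
  have hr : ∀ z ∈ nearBoundary dv βv j,
      blockBetaMeasure dv βv {w | (z, w) ∈ closeRel dv βv j} ≤
        ENNReal.ofReal ((∏ i, C₂ i) * (1 / 2 : ℝ) ^ ∑ i, j i) := by
    intro z hz
    refine (blockBetaMeasure_pi hdv hβ (fun i => {w : EuclideanSpace ℝ (Fin (dv i)) |
      1 - ‖w‖ ≤ dyadicScale (capExponent (βv i) (dv i)) (j i) ∧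
      ‖w - z i‖ ≤ 3 * Real.sqrt (dyadicScale (capExponent (βv i) (dv i)) (j i))})).trans_le ?_
    rw [← Finset.prod_pow_eq_pow_sum, ← Finset.prod_mul_distrib,
      ENNReal.ofReal_prod_of_nonneg (fun i _ => by have := hC₂ i; positivity)]
    refine Finset.prod_le_prod' fun i _ => ?_
    rw [← dyadicScale_rpow_self (capExponent_pos (hβ i) (dv i))]
    exact h₂ i _ (dyadicScale_pos _ _) (dyadicScale_le_one (capExponent_pos (hβ i) _) _) _
      (hz i).1 (hz i).2
  rw [closeFamily, measure_pi_pair _ p₀ (measurableSet_nearBoundary j) (measurableSet_closeRel j),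
    hκ]
  calc _ ≤ ∫⁻ z in nearBoundary dv βv j,
        ENNReal.ofReal ((∏ i, C₂ i) * (1 / 2 : ℝ) ^ ∑ i, j i) ^ (d - 1) ∂blockBetaMeasure dv βv :=
        setLIntegral_mono' (measurableSet_nearBoundary j) fun z hz =>
          pow_le_pow_left₀ zero_le (hr z hz) _
    _ ≤ ENNReal.ofReal ((∏ i, C₂ i) * (1 / 2 : ℝ) ^ ∑ i, j i) ^ (d - 1) *
        ENNReal.ofReal ((∏ i, C₁ i) * ∏ i, ((1 / 2 : ℝ) ^
          ((βv i + 1) / capExponent (βv i) (dv i))) ^ j i) := by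
        rw [setLIntegral_const]
        gcongr
    _ = _ := by
        rw [← ENNReal.ofReal_pow (by positivity), ← ENNReal.ofReal_mul (by positivity)]
        congr 1
        ring

end Box

section Hyperplane

variable {m : ℕ} {dv : Fin m → ℕ} {βv : Fin m → ℝ}

lemma le_dyadicScale_of_rpow_le {a l : ℝ} (ha : 0 < a) (hl : 0 ≤ l) {j : ℕ}
    (h : l ^ a ≤ (1 / 2 : ℝ) ^ j) : l ≤ dyadicScale a j := by
  unfold dyadicScale
  rw [one_div a]
  exact (Real.le_rpow_inv_iff_of_pos hl (by positivity) ha).2 h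

/-- Decomposition of a continuous linear functional along unit vectors of the blocks. -/
lemma exists_unit_decomposition (hdv : ∀ i, 1 ≤ dv i)
    (f : (Π i, EuclideanSpace ℝ (Fin (dv i))) →L[ℝ] ℝ) :
    ∃ (r : Fin m → ℝ) (u : Π i, EuclideanSpace ℝ (Fin (dv i))), (∀ i, 0 ≤ r i) ∧
      (∀ i, ‖u i‖ = 1) ∧ ∀ y, f y = ∑ i, r i * inner ℝ (u i) (y i) := by
  let v : Π i, EuclideanSpace ℝ (Fin (dv i)) := fun i =>
    (InnerProductSpace.toDual ℝ _).symm (f.comp (ContinuousLinearMap.single ℝ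
      (fun i => EuclideanSpace ℝ (Fin (dv i))) i))
  choose u hu hv using fun i => exists_unit_smul_eq (hdv i) (v i)
  refine ⟨fun i => ‖v i‖, u, fun i => norm_nonneg _, hu, fun y => ?_⟩
  have h1 : ∀ i, f (Pi.single i (y i)) = ‖v i‖ * inner ℝ (u i) (y i) := fun i => by
    rw [← real_inner_smul_left, ← hv i, InnerProductSpace.toDual_symm_apply]
    simp
  calc f y = f (∑ i, Pi.single i (y i)) := by rw [Finset.univ_sum_single]
    _ = _ := by rw [map_sum]; exact Finset.sum_congr rfl fun i _ => h1 i

/-- Points of the open balls on a hyperplane are near the boundary and close to each other at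
scales controlled by the mass of the half-space. -/
lemma exists_scale_of_hyperplane (hdv : ∀ i, 1 ≤ dv i) {κ : Type*} [Nonempty κ]
    {f : (Π i, EuclideanSpace ℝ (Fin (dv i))) →L[ℝ] ℝ} (hf : f ≠ 0) {t : ℝ}
    {y : κ → Π i, EuclideanSpace ℝ (Fin (dv i))} (hy : ∀ p i, ‖y p i‖ < 1)
    (hft : ∀ p, f (y p) = t) :
    ∃ (l : Fin m → ℝ) (u : Π i, EuclideanSpace ℝ (Fin (dv i))),
      (∀ i, 0 < l i ∧ l i ≤ 1) ∧ (∀ i, ‖u i‖ = 1) ∧ (∀ p i, 1 - ‖y p i‖ ≤ l i) ∧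
      (∀ p q i, ‖y p i - y q i‖ ≤ 3 * Real.sqrt (l i)) ∧
      ∀ w : Π i, EuclideanSpace ℝ (Fin (dv i)),
        (∀ i, 1 - inner ℝ (u i) (w i) < l i / m) → t < f w := by
  obtain ⟨r, u, hr, hu, hfr⟩ := exists_unit_decomposition hdv f
  obtain ⟨i₀, hi₀⟩ : ∃ i, 0 < r i := by
    by_contra! h
    refine hf (ContinuousLinearMap.ext fun w => ?_)
    rw [hfr]
    exact Finset.sum_eq_zero fun i _ => by rw [le_antisymm (h i) (hr i), zero_mul]
  have hm0 : (0 : ℝ) < m := by exact_mod_cast i₀.pos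
  have hin : ∀ p i, inner ℝ (u i) (y p i) ≤ ‖y p i‖ := fun p i => by
    have := real_inner_le_norm (u i) (y p i)
    rwa [hu, one_mul] at this
  set δ := ∑ i, r i - t with hδ
  have hδp : ∀ p, δ = ∑ i, r i * (1 - inner ℝ (u i) (y p i)) := fun p => by
    simp_rw [mul_sub, mul_one, Finset.sum_sub_distrib]
    rw [hδ, ← hfr, hft p]
  have hterm : ∀ p i, 0 ≤ r i * (1 - inner ℝ (u i) (y p i)) := fun p i =>
    mul_nonneg (hr i) (by linarith [hin p i, hy p i])
  have hle : ∀ p i, r i * (1 - inner ℝ (u i) (y p i)) ≤ δ := fun p i => by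
    rw [hδp p]
    exact Finset.single_le_sum (f := fun i => r i * (1 - inner ℝ (u i) (y p i)))
      (fun i _ => hterm p i) (Finset.mem_univ i)
  have hδ0 : 0 < δ := by
    obtain ⟨p⟩ := ‹Nonempty κ›
    refine lt_of_lt_of_le (mul_pos hi₀ ?_) (hle p i₀)
    linarith [hin p i₀, hy p i₀]
  let l : Fin m → ℝ := fun i => if r i ≤ δ then 1 else δ / r i
  have hl0 : ∀ i, 0 < l i := fun i => by
    simp only [l]
    split_ifs with h
    · exact one_pos
    · exact div_pos hδ0 (by linarith)
  have hl1 : ∀ i, l i ≤ 1 := fun i => by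
    simp only [l]
    split_ifs with h
    · exact le_rfl
    · rw [div_le_one (by linarith)]; linarith
  have hrl : ∀ i, r i * l i ≤ δ := fun i => by
    simp only [l]
    split_ifs with h
    · linarith
    · rw [mul_div_cancel₀ _ (by linarith : r i ≠ 0)]
  have hcap : ∀ p i, l i = 1 ∨ 1 - inner ℝ (u i) (y p i) ≤ l i := fun p i => by
    by_cases h : r i ≤ δ
    · exact Or.inl (if_pos h)
    · right
      simp only [l, if_neg h]
      rw [le_div_iff₀ (by linarith), mul_comm]
      exact hle p i
  refine ⟨l, u, fun i => ⟨hl0 i, hl1 i⟩, hu, fun p i => ?_, fun p q i => ?_, fun w hw => ?_⟩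
  · rcases hcap p i with h | h
    · rw [h]; linarith [norm_nonneg (y p i)]
    · linarith [hin p i]
  · have hnear : ∀ p, ‖y p i - u i‖ ≤ 3 / 2 * Real.sqrt (l i) ∨ l i = 1 := fun p => by
      rcases hcap p i with h | h
      · exact Or.inr h
      · left
        rw [← Real.sqrt_sq (show (0 : ℝ) ≤ 3 / 2 by norm_num), ← Real.sqrt_mul (by norm_num)]
        refine Real.le_sqrt_of_sq_le ?_
        rw [norm_sub_sq_real, hu, real_inner_comm]
        nlinarith [hl0 i, hy p i, norm_nonneg (y p i)]
    rcases hnear p with h | h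
    · rcases hnear q with h' | h'
      · calc ‖y p i - y q i‖ = ‖(y p i - u i) - (y q i - u i)‖ := by rw [sub_sub_sub_cancel_right]
          _ ≤ ‖y p i - u i‖ + ‖y q i - u i‖ := norm_sub_le _ _
          _ ≤ _ := by linarith
      · rw [h', Real.sqrt_one]
        linarith [norm_sub_le (y p i) (y q i), hy p i, hy q i]
    · rw [h, Real.sqrt_one]
      linarith [norm_sub_le (y p i) (y q i), hy p i, hy q i]
  · have h1 : ∑ i, r i * (1 - inner ℝ (u i) (w i)) < ∑ i : Fin m, δ / m := by
      refine Finset.sum_lt_sum (fun i _ => ?_) ⟨i₀, Finset.mem_univ _, ?_⟩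
      · calc r i * (1 - inner ℝ (u i) (w i)) ≤ r i * (l i / m) :=
              mul_le_mul_of_nonneg_left (hw i).le (hr i)
          _ = r i * l i / m := by ring
          _ ≤ δ / m := by gcongr; exact hrl i
      · calc r i₀ * (1 - inner ℝ (u i₀) (w i₀)) < r i₀ * (l i₀ / m) :=
              mul_lt_mul_of_pos_left (hw i₀) hi₀
          _ = r i₀ * l i₀ / m := by ring
          _ ≤ δ / m := by gcongr; exact hrl i₀
    simp_rw [mul_sub, mul_one, Finset.sum_sub_distrib] at h1
    rw [← hfr, Finset.sum_const, Finset.card_univ, Fintype.card_fin, nsmul_eq_mul,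
      mul_div_cancel₀ _ hm0.ne'] at h1
    linarith

lemma exists_closeFamily_of_hyperplane (hdv : ∀ i, 1 ≤ dv i) (hβ : ∀ i, 0 ≤ βv i) :
    ∃ c : ℝ, 0 < c ∧ ∀ (κ : Type) (p₀ : κ)
      (f : (Π i, EuclideanSpace ℝ (Fin (dv i))) →L[ℝ] ℝ) (t : ℝ)
      (y : κ → Π i, EuclideanSpace ℝ (Fin (dv i))), f ≠ 0 → (∀ p i, ‖y p i‖ < 1) →
      (∀ p, f (y p) = t) → ∃ j : Fin m → ℕ, y ∈ closeFamily dv βv p₀ j ∧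
        ENNReal.ofReal (c * (1 / 2 : ℝ) ^ ∑ i, j i) ≤ blockBetaMeasure dv βv {w | t < f w} := by
  choose c hc h using fun i => exists_le_betaMeasure_cap (hβ i) (hdv i)
  refine ⟨∏ i, c i * (1 / (m : ℝ)) ^ capExponent (βv i) (dv i) * (1 / 2),
    Finset.prod_pos fun i _ => ?_, fun κ p₀ f t y hf hy hft => ?_⟩
  · have := hc i
    have hm0 : (0 : ℝ) < m := by exact_mod_cast i.pos
    positivity
  have : Nonempty κ := ⟨p₀⟩
  obtain ⟨l, u, hl, hu, hyl, hyy, hw⟩ := exists_scale_of_hyperplane hdv hf hy hft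
  have ha : ∀ i, 0 < capExponent (βv i) (dv i) := fun i => capExponent_pos (hβ i) (dv i)
  choose j hj1 hj2 using fun i => exists_nat_pow_near_of_lt_one
    (Real.rpow_pos_of_pos (hl i).1 (capExponent (βv i) (dv i)))
    (Real.rpow_le_one (hl i).1.le (hl i).2 (ha i).le)
    (show (0 : ℝ) < 1 / 2 by norm_num) (by norm_num)
  have hlj : ∀ i, l i ≤ dyadicScale (capExponent (βv i) (dv i)) (j i) := fun i =>
    le_dyadicScale_of_rpow_le (ha i) (hl i).1.le (hj2 i)
  refine ⟨j, ⟨fun i => ⟨(hy p₀ i).le, (hyl p₀ i).trans (hlj i)⟩, fun p _ i =>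
    ⟨(hyl p i).trans (hlj i), (hyy p p₀ i).trans ?_⟩⟩, ?_⟩
  · gcongr
    exact hlj i
  calc ENNReal.ofReal ((∏ i, c i * (1 / (m : ℝ)) ^ capExponent (βv i) (dv i) * (1 / 2)) *
        (1 / 2 : ℝ) ^ ∑ i, j i)
      = ∏ i, ENNReal.ofReal (c i * (1 / (m : ℝ)) ^ capExponent (βv i) (dv i) *
          (1 / 2) ^ (j i + 1)) := by
        rw [← ENNReal.ofReal_prod_of_nonneg (fun i _ => by have := hc i; positivity),
          ← Finset.prod_pow_eq_pow_sum, ← Finset.prod_mul_distrib]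
        congr 1
        exact Finset.prod_congr rfl fun i _ => by ring
    _ ≤ ∏ i, betaMeasure (βv i) (dv i) {w | 1 - inner ℝ (u i) w < l i / m} := by
        refine Finset.prod_le_prod' fun i _ => ?_
        have hm0 : (0 : ℝ) < m := by exact_mod_cast i.pos
        have hm1 : (1 : ℝ) ≤ m := by exact_mod_cast i.pos
        refine le_trans (ENNReal.ofReal_le_ofReal ?_) (h i (l i / m) (div_pos (hl i).1 hm0)
          ((div_le_self (hl i).1.le hm1).trans (hl i).2) (u i) (hu i))
        change _ ≤ c i * (l i / m) ^ capExponent (βv i) (dv i)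
        rw [div_eq_mul_one_div (l i), Real.mul_rpow (hl i).1.le (by positivity), mul_assoc,
          mul_comm (l i ^ _)]
        have := hc i
        gcongr
        exact (hj1 i).le
    _ = blockBetaMeasure dv βv {w | ∀ i, w i ∈ {w | 1 - inner ℝ (u i) w < l i / m}} :=
        (blockBetaMeasure_pi hdv hβ _).symm
    _ ≤ _ := measure_mono fun w hww => hw w hww

end Hyperplane

section Slice

lemma exists_smul_of_const {V : Type*} [NormedAddCommGroup V] [NormedSpace ℝ V]
    [FiniteDimensional ℝ V] {κ : Type*} [Fintype κ] (hκ : Fintype.card κ = Module.finrank ℝ V)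
    (hV : 1 ≤ Module.finrank ℝ V) {y : κ → V} (hy : AffineIndependent ℝ y) {f g : V →L[ℝ] ℝ}
    (hf : f ≠ 0) (hg : g ≠ 0) {s t : ℝ} (hfy : ∀ p, f (y p) = s) (hgy : ∀ p, g (y p) = t) :
    ∃ a : ℝ, a ≠ 0 ∧ f = a • g := by
  have hker : ∀ {h : V →L[ℝ] ℝ} {r : ℝ}, h ≠ 0 → (∀ p, h (y p) = r) →
      vectorSpan ℝ (Set.range y) = LinearMap.ker (h : V →ₗ[ℝ] ℝ) := by
    intro h r hh hr
    refine Submodule.eq_of_le_of_finrank_eq (vectorSpan_le_ker (t := r) ?_) ?_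
    · rintro _ ⟨p, rfl⟩
      exact hr p
    · have h1 := Module.Dual.finrank_ker_add_one_of_ne_zero (K := ℝ) (f := (h : V →ₗ[ℝ] ℝ))
        fun h0 => hh (ContinuousLinearMap.coe_injective h0)
      have h2 := hy.finrank_vectorSpan (n := Module.finrank ℝ V - 1) (by omega)
      omega
  have hfg : ∀ v, g v = 0 → f v = 0 := fun v hv => by
    have h1 : v ∈ LinearMap.ker (g : V →ₗ[ℝ] ℝ) := hv
    rw [← hker hg hgy, hker hf hfy] at h1
    exact h1
  obtain ⟨w, hw⟩ : ∃ w, g w ≠ 0 := by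
    by_contra! h
    exact hg (ContinuousLinearMap.ext h)
  have hfw : f = (f w / g w) • g := by
    ext v
    have := hfg (v - (g v / g w) • w) (by
      rw [map_sub, map_smul, smul_eq_mul, div_mul_cancel₀ _ hw, sub_self])
    rw [map_sub, map_smul, smul_eq_mul, sub_eq_zero] at this
    rw [this, smul_apply, smul_eq_mul]
    ring
  refine ⟨f w / g w, fun h => hf ?_, hfw⟩
  rw [hfw, h, zero_smul]

variable {m : ℕ} {dv : Fin m → ℕ} {βv : Fin m → ℝ}

lemma exists_measure_slice_le {d : ℕ} (hd : 1 ≤ d) (hsum : ∑ i, dv i = d) (hdv : ∀ i, 1 ≤ dv i)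
    (hβ : ∀ i, 0 ≤ βv i) :
    ∃ c : ℝ, 0 < c ∧ ∀ (κ κ' : Type) [Fintype κ] [Fintype κ'] (p₀ : κ)
      (y : κ → Π i, EuclideanSpace ℝ (Fin (dv i))), Fintype.card κ = d → AffineIndependent ℝ y →
      (∀ p i, ‖y p i‖ < 1) →
      Measure.pi (fun _ : κ' => blockBetaMeasure dv βv)
        {w | ∃ f : (Π i, EuclideanSpace ℝ (Fin (dv i))) →L[ℝ] ℝ, f ≠ 0 ∧ ∃ t : ℝ,
          (∀ p, f (y p) = t) ∧ ∀ q, f (w q) ≤ t} ≤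
        2 * ∑' j : Fin m → ℕ, (closeFamily dv βv p₀ j).indicator (fun _ =>
          ENNReal.ofReal (Real.exp (-(c * (1 / 2) ^ ∑ i, j i))) ^ Fintype.card κ') y := by
  obtain ⟨c, hc, h⟩ := exists_closeFamily_of_hyperplane (βv := βv) hdv hβ
  have := isProbabilityMeasure_blockBetaMeasure (βv := βv) hdv hβ
  have hfr := finrank_blockSpace hsum
  refine ⟨c, hc, fun κ κ' _ _ p₀ y hκ hai hy => ?_⟩
  by_cases hex : ∃ f : (Π i, EuclideanSpace ℝ (Fin (dv i))) →L[ℝ] ℝ, f ≠ 0 ∧ ∃ t : ℝ,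
      ∀ p, f (y p) = t
  swap
  · refine le_of_eq_of_le (measure_mono_null (t := ∅) ?_ measure_empty) zero_le
    rintro w ⟨f, hf, t, hft, -⟩
    exact hex ⟨f, hf, t, hft⟩
  obtain ⟨f, hf, t, hft⟩ := hex
  have key : ∀ (g : (Π i, EuclideanSpace ℝ (Fin (dv i))) →L[ℝ] ℝ) (s : ℝ), g ≠ 0 →
      (∀ p, g (y p) = s) →
      Measure.pi (fun _ : κ' => blockBetaMeasure dv βv) {w | ∀ q, g (w q) ≤ s} ≤
        ∑' j : Fin m → ℕ, (closeFamily dv βv p₀ j).indicator (fun _ =>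
          ENNReal.ofReal (Real.exp (-(c * (1 / 2) ^ ∑ i, j i))) ^ Fintype.card κ') y := by
    intro g s hg hgs
    obtain ⟨j, hj, hmass⟩ := h κ p₀ g s y hg hy hgs
    refine le_trans ?_ (ENNReal.le_tsum j)
    rw [Set.indicator_of_mem hj]
    have hset : {w : κ' → Π i, EuclideanSpace ℝ (Fin (dv i)) | ∀ q, g (w q) ≤ s} =
        Set.univ.pi fun _ => {w | s < g w}ᶜ := by
      ext w; simp [Set.mem_pi]
    have hmeas : MeasurableSet {w | s < g w} :=
      measurableSet_lt measurable_const g.continuous.measurable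
    rw [hset, Measure.pi_pi, Finset.prod_const, Finset.card_univ]
    refine pow_le_pow_left₀ zero_le ?_ _
    rw [prob_compl_eq_one_sub hmeas]
    calc _ ≤ 1 - ENNReal.ofReal (c * (1 / 2) ^ ∑ i, j i) := tsub_le_tsub_left hmass _
      _ = ENNReal.ofReal (1 - c * (1 / 2) ^ ∑ i, j i) := by
        rw [ENNReal.ofReal_sub _ (by positivity), ENNReal.ofReal_one]
      _ ≤ _ := ENNReal.ofReal_le_ofReal (Real.one_sub_le_exp_neg _)
  calc _ ≤ Measure.pi (fun _ : κ' => blockBetaMeasure dv βv)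
        ({w | ∀ q, f (w q) ≤ t} ∪ {w | ∀ q, (-f) (w q) ≤ -t}) := by
        refine measure_mono ?_
        rintro w ⟨g, hg, s, hgs, hgw⟩
        obtain ⟨a, ha, rfl⟩ := exists_smul_of_const (by rw [hκ, hfr]) (by rw [hfr]; exact hd)
          hai hg hf hgs hft
        have hs : s = a * t := by
          rw [← hgs p₀, smul_apply, hft, smul_eq_mul]
        rcases lt_or_gt_of_ne ha with h0 | h0
        · right
          intro q
          have := hgw q
          rw [hs, smul_apply, smul_eq_mul] at this
          rw [neg_apply]
          nlinarith
        · left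
          intro q
          have := hgw q
          rw [hs, smul_apply, smul_eq_mul] at this
          nlinarith
    _ ≤ _ := (measure_union_le _ _).trans (add_le_add (key f t hf hft)
        (key (-f) (-t) (neg_ne_zero.2 hf) fun p => by
          rw [neg_apply, hft]))
    _ = _ := (two_mul _).symm

/-- Bound for the probability that a given set of sample points spans a facet. -/
lemma exists_measure_isSupported_le {d : ℕ} (hd : 1 ≤ d) (hsum : ∑ i, dv i = d)
    (hdv : ∀ i, 1 ≤ dv i) (hβ : ∀ i, 0 ≤ βv i) :
    ∃ c : ℝ, 0 < c ∧ ∃ C : ℝ, 0 < C ∧ ∀ (n : ℕ) (I : Finset (Fin n)), I.card = d →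
      Measure.pi (fun _ : Fin n => blockBetaMeasure dv βv) {x | IsSupported I x} ≤
        2 * ∑' j : Fin m → ℕ, ENNReal.ofReal (C * (∏ i, ((1 / 2 : ℝ) ^
          ((βv i + 1) / capExponent (βv i) (dv i))) ^ j i) *
            ((1 / 2 : ℝ) ^ ∑ i, j i) ^ (d - 1) *
            Real.exp (-(c * (1 / 2) ^ ∑ i, j i)) ^ (n - d)) := by
  classical
  obtain ⟨c, hc, h⟩ := exists_measure_slice_le (βv := βv) hd hsum hdv hβ
  obtain ⟨C, hC, hbox⟩ := exists_measure_closeFamily_le hdv hβ d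
  have := isProbabilityMeasure_blockBetaMeasure (βv := βv) hdv hβ
  have hfr := finrank_blockSpace hsum
  refine ⟨c, hc, C, hC, fun n I hI => ?_⟩
  obtain ⟨i₀, hi₀⟩ := Finset.card_pos.1 (show 0 < I.card by omega)
  let p₀ : {i // i ∈ I} := ⟨i₀, hi₀⟩
  have hκ : Fintype.card {i // i ∈ I} = d := by simpa using hI
  have hκ' : Fintype.card {i // ¬ i ∈ I} = n - d := by
    rw [Fintype.card_subtype_compl, hκ, Fintype.card_fin]
  have hmp := measurePreserving_piEquivPiSubtypeProd
    (fun _ : Fin n => blockBetaMeasure dv βv) (· ∈ I)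
  rw [Subsingleton.elim (Subtype.fintype (· ∈ I)) (inferInstance : Fintype {i // i ∈ I})] at hmp
  let U : Set ({i // i ∈ I} → Π i, EuclideanSpace ℝ (Fin (dv i))) :=
    {y | AffineIndependent ℝ y ∧ ∀ p i, ‖y p i‖ < 1}
  have hU : MeasurableSet U := by
    have h1 : MeasurableSet {y : {i // i ∈ I} → Π i, EuclideanSpace ℝ (Fin (dv i)) |
        AffineIndependent ℝ y} := isOpen_setOfPred_affineIndependent.measurableSet
    have h3 : {y : {i // i ∈ I} → Π i, EuclideanSpace ℝ (Fin (dv i)) | ∀ p i, ‖y p i‖ < 1} =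
        ⋂ p, ⋂ i, {y | ‖y p i‖ < 1} := by
      ext y; simp
    refine h1.inter (s₂ := {y | ∀ p i, ‖y p i‖ < 1}) ?_
    rw [h3]
    refine MeasurableSet.iInter fun p => MeasurableSet.iInter fun i => ?_
    have h2 : Measurable fun y : {i // i ∈ I} → Π i, EuclideanSpace ℝ (Fin (dv i)) =>
      ‖y p i‖ := by fun_prop
    exact measurableSet_lt h2 measurable_const
  let T := {x : Fin n → Π i, EuclideanSpace ℝ (Fin (dv i)) | IsSupported I x} ∩
    {x | (fun i : {i // i ∈ I} => x i) ∈ U}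
  have hT : MeasurableSet T := (measurableSet_isSupported ⟨i₀, hi₀⟩).inter
    ((measurable_pi_lambda _ fun i => measurable_pi_apply _) hU)
  have hTae : Measure.pi (fun _ : Fin n => blockBetaMeasure dv βv) {x | IsSupported I x} ≤
      Measure.pi (fun _ : Fin n => blockBetaMeasure dv βv) T := by
    refine measure_mono_ae ?_
    have h1 : ∀ᵐ x ∂(Measure.pi fun _ : Fin n => blockBetaMeasure dv βv),
        ∀ q i, ‖x q i‖ < 1 := by
      rw [ae_all_iff]
      intro q
      exact (Measure.quasiMeasurePreserving_eval
        (μ := fun _ : Fin n => blockBetaMeasure dv βv) q).ae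
        (ae_norm_lt_one_blockBetaMeasure hdv hβ)
    filter_upwards [ae_generalPosition_block hdv hβ n, h1] with x hx hx1 hs
    exact ⟨hs, hx I (by rw [hfr]; omega), fun p i => hx1 p i⟩
  refine hTae.trans ?_
  rw [← hmp.symm.measure_preimage hT.nullMeasurableSet, Measure.prod_apply
    ((MeasurableEquiv.measurable _) hT)]
  calc _ ≤ ∫⁻ y, 2 * ∑' j : Fin m → ℕ, (closeFamily dv βv p₀ j).indicator (fun _ =>
          ENNReal.ofReal (Real.exp (-(c * (1 / 2) ^ ∑ i, j i))) ^ (n - d)) y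
          ∂(Measure.pi fun _ : {i // i ∈ I} => blockBetaMeasure dv βv) := by
        refine lintegral_mono fun y => ?_
        by_cases hy : y ∈ U
        · have h2 := h {i // i ∈ I} {i // ¬ i ∈ I} p₀ y hκ hy.1 hy.2
          rw [hκ'] at h2
          refine (measure_mono ?_).trans h2
          rintro w ⟨⟨f, hf, t, hft, hle⟩, -⟩
          refine ⟨f, hf, t, fun p => ?_, fun q => ?_⟩
          · have := hft p p.2
            simpa [MeasurableEquiv.piEquivPiSubtypeProd, Equiv.piEquivPiSubtypeProd] using this
          · have := hle q
            simpa [MeasurableEquiv.piEquivPiSubtypeProd, Equiv.piEquivPiSubtypeProd, q.2]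
              using this
        · refine le_of_eq_of_le (measure_mono_null (t := ∅) ?_ measure_empty) zero_le
          rintro w ⟨-, hw⟩
          have e : (fun p : {i // i ∈ I} => (MeasurableEquiv.piEquivPiSubtypeProd
              (fun _ : Fin n => Π i, EuclideanSpace ℝ (Fin (dv i))) (· ∈ I)).symm
                (y, w) p) = y := by
            ext1 p
            simp [MeasurableEquiv.piEquivPiSubtypeProd, Equiv.piEquivPiSubtypeProd]
          exact hy (e ▸ hw)
    _ = 2 * ∑' j : Fin m → ℕ, ENNReal.ofReal (Real.exp (-(c * (1 / 2) ^ ∑ i, j i))) ^ (n - d) *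
          Measure.pi (fun _ : {i // i ∈ I} => blockBetaMeasure dv βv)
            (closeFamily dv βv p₀ j) := by
        rw [lintegral_const_mul' _ _ (by norm_num), lintegral_tsum]
        · congr 2
          ext1 j
          rw [lintegral_indicator (measurableSet_closeFamily p₀ j), setLIntegral_const]
        · intro j
          exact (measurable_const.indicator (measurableSet_closeFamily p₀ j)).aemeasurable
    _ ≤ _ := by
        gcongr with j
        rw [mul_comm, ENNReal.ofReal_mul (by positivity), ENNReal.ofReal_pow (by positivity)]
        gcongr
        exact hbox {i // i ∈ I} hκ p₀ j

end Slice

section WeightedSum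

lemma tsum_pi_eq_tsum_insertNth {m : ℕ} (i₀ : Fin (m + 1)) (F : (Fin (m + 1) → ℕ) → ENNReal) :
    ∑' j, F j = ∑' j : Fin m → ℕ, ∑' k, F (i₀.insertNth k j) := by
  rw [ENNReal.tsum_comm, ← ENNReal.tsum_prod,
    ← (Fin.insertNthEquiv (fun _ : Fin (m + 1) => ℕ) i₀).tsum_eq]
  refine tsum_congr fun p => congrArg F ?_
  ext i
  rw [Fin.insertNthEquiv_apply]

lemma tsum_pi_prod_eq : ∀ {m : ℕ} (g : Fin m → ℕ → ENNReal),
    ∑' j : Fin m → ℕ, ∏ i, g i (j i) = ∏ i, ∑' k, g i k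
  | 0, g => by simp
  | m + 1, g => by
    rw [tsum_pi_eq_tsum_insertNth 0, Fin.prod_univ_succAbove _ 0]
    simp_rw [Fin.prod_univ_succAbove _ (0 : Fin (m + 1)), Fin.insertNth_apply_same,
      Fin.insertNth_apply_succAbove, ENNReal.tsum_mul_right]
    rw [ENNReal.tsum_mul_left, tsum_pi_prod_eq fun i => g (Fin.succAbove 0 i)]

lemma tsum_inv_two_pow : ∑' k : ℕ, (2⁻¹ : ENNReal) ^ k = 2 := by
  rw [ENNReal.tsum_geometric, ENNReal.one_sub_inv_two, inv_inv]

lemma inv_two_pow_le_one (k : ℕ) : (2⁻¹ : ENNReal) ^ k ≤ 1 :=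
  pow_le_one₀ zero_le (ENNReal.inv_le_one.2 (by norm_num))

lemma inv_two_pow_antitone {a b : ℕ} (h : a ≤ b) : (2⁻¹ : ENNReal) ^ b ≤ 2⁻¹ ^ a :=
  pow_le_pow_of_le_one zero_le (ENNReal.inv_le_one.2 (by norm_num)) h

lemma tsum_inv_two_pow_dist_le (D : ℕ) :
    ∑' k : ℕ, (2⁻¹ : ENNReal) ^ ((k - D) + (D - k)) ≤ 4 := by
  rw [← Summable.sum_add_tsum_nat_add' (k := D) ENNReal.summable,
    show (4 : ENNReal) = 2 + 2 by norm_num]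
  refine add_le_add ?_ ?_
  · rw [← Finset.sum_range_reflect]
    refine le_of_le_of_eq ?_ tsum_inv_two_pow
    refine le_trans (Finset.sum_le_sum (g := fun k => (2⁻¹ : ENNReal) ^ k) fun k hk => ?_)
      (ENNReal.sum_le_tsum (Finset.range D))
    rw [Finset.mem_range] at hk
    exact inv_two_pow_antitone (by omega)
  · refine le_of_le_of_eq ?_ tsum_inv_two_pow
    exact ENNReal.tsum_le_tsum fun k => inv_two_pow_antitone (by omega)

lemma tsum_inv_two_pow_tsub_le (L : ℕ) :
    ∑' k : ℕ, (2⁻¹ : ENNReal) ^ (k - L) ≤ 2 * ((L + 1 : ℕ) : ENNReal) := by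
  rw [← Summable.sum_add_tsum_nat_add' (k := L) ENNReal.summable]
  have h1 : ∑ k ∈ Finset.range L, (2⁻¹ : ENNReal) ^ (k - L) ≤ L :=
    (Finset.sum_le_sum fun k _ => inv_two_pow_le_one (k - L)).trans (by simp)
  have h2 : ∑' k : ℕ, (2⁻¹ : ENNReal) ^ (k + L - L) ≤ 2 := by
    simp_rw [Nat.add_sub_cancel]
    exact tsum_inv_two_pow.le
  refine (add_le_add h1 h2).trans ?_
  exact_mod_cast (by omega : L + 2 ≤ 2 * (L + 1))

lemma inv_two_pow_sum_tsub_le {m : ℕ} (j : Fin m → ℕ) (L : ℕ) :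
    (2⁻¹ : ENNReal) ^ (∑ i, j i - L) ≤ ∏ i, 2⁻¹ ^ (j i - L) := by
  rw [Finset.prod_pow_eq_pow_sum]
  refine inv_two_pow_antitone ?_
  have : ∀ s : Finset (Fin m), ∑ i ∈ s, (j i - L) ≤ ∑ i ∈ s, j i - L := fun s => by
    classical
    induction s using Finset.induction_on with
    | empty => simp
    | insert a s ha ih =>
      rw [Finset.sum_insert ha, Finset.sum_insert ha]
      omega
  exact this _

/-- Summing products of geometric weights concentrated around a hyperplane of indices. -/
lemma exists_tsum_weight_le {m : ℕ} {M : Finset (Fin m)} (hM : M.Nonempty) {ρ : Fin m → ENNReal}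
    (hρ : ∀ i, ρ i ≤ 1) (hρM : ∀ i, i ∉ M → ρ i < 1) :
    ∃ K : ENNReal, K ≠ ⊤ ∧ ∀ L : ℕ, ∑' j : Fin m → ℕ, (∏ i, ρ i ^ j i) *
      2⁻¹ ^ ((∑ i, j i - L) + (L - ∑ i, j i)) ≤ K * ((L + 1 : ℕ) : ENNReal) ^ (M.card - 1) := by
  classical
  obtain ⟨i₀, hi₀⟩ := hM
  obtain ⟨m, rfl⟩ : ∃ k, m = k + 1 := ⟨m - 1, by have := i₀.pos; omega⟩
  refine ⟨4 * (2 ^ (M.card - 1) * ∏ i, if i ∈ M then 1 else (1 - ρ i)⁻¹),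
    ENNReal.mul_ne_top (by norm_num) (ENNReal.mul_ne_top (ENNReal.pow_ne_top (by norm_num))
      (ENNReal.prod_ne_top fun i _ => ?_)), fun L => ?_⟩
  · split_ifs with h
    · exact ENNReal.one_ne_top
    · exact ENNReal.inv_ne_top.2 (tsub_pos_of_lt (hρM i h)).ne'
  let b : Fin (m + 1) → ENNReal := fun i => (if i ∈ M.erase i₀ then 2 * ((L + 1 : ℕ) : ENNReal)
    else 1) * if i ∈ M then 1 else (1 - ρ i)⁻¹
  have hb : ∏ i, b i = (2 * ((L + 1 : ℕ) : ENNReal)) ^ (M.card - 1) *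
      ∏ i, if i ∈ M then 1 else (1 - ρ i)⁻¹ := by
    rw [Finset.prod_mul_distrib, Finset.prod_ite_mem, Finset.univ_inter, Finset.prod_const,
      Finset.card_erase_of_mem hi₀]
  have hb0 : b i₀ = 1 := by simp [b, hi₀]
  have hfac : ∀ i : Fin m, ∑' k : ℕ, ρ (i₀.succAbove i) ^ k * 2⁻¹ ^ (k - L) ≤
      b (i₀.succAbove i) := fun i => by
    by_cases h : i₀.succAbove i ∈ M
    · have h' : i₀.succAbove i ∈ M.erase i₀ :=
        Finset.mem_erase.2 ⟨Fin.succAbove_ne i₀ i, h⟩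
      simp only [b, if_pos h, if_pos h', mul_one]
      refine le_trans (ENNReal.tsum_le_tsum fun k => ?_) (tsum_inv_two_pow_tsub_le L)
      exact mul_le_of_le_one_left zero_le (pow_le_one₀ zero_le (hρ _))
    · have h' : i₀.succAbove i ∉ M.erase i₀ := fun h0 => h (Finset.mem_of_mem_erase h0)
      simp only [b, if_neg h, if_neg h', one_mul]
      rw [← ENNReal.tsum_geometric]
      exact ENNReal.tsum_le_tsum fun k => mul_le_of_le_one_right zero_le (inv_two_pow_le_one _)
  calc _ = ∑' j : Fin m → ℕ, ∑' k, (ρ i₀ ^ k * ∏ i, ρ (i₀.succAbove i) ^ j i) *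
        2⁻¹ ^ ((k + ∑ i, j i - L) + (L - (k + ∑ i, j i))) := by
        rw [tsum_pi_eq_tsum_insertNth i₀]
        simp_rw [Fin.prod_univ_succAbove _ i₀, Fin.sum_univ_succAbove _ i₀,
          Fin.insertNth_apply_same, Fin.insertNth_apply_succAbove]
    _ ≤ ∑' j : Fin m → ℕ, ∑' k, (∏ i, ρ (i₀.succAbove i) ^ j i) * 2⁻¹ ^ (∑ i, j i - L) *
        2⁻¹ ^ ((k - (L - ∑ i, j i)) + ((L - ∑ i, j i) - k)) := by
        refine ENNReal.tsum_le_tsum fun j => ENNReal.tsum_le_tsum fun k => ?_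
        rw [mul_assoc (∏ i, ρ (i₀.succAbove i) ^ j i), ← pow_add]
        refine mul_le_mul' (mul_le_of_le_one_left zero_le (pow_le_one₀ zero_le (hρ _)))
          (inv_two_pow_antitone ?_)
        omega
    _ ≤ ∑' j : Fin m → ℕ, (∏ i, ρ (i₀.succAbove i) ^ j i * 2⁻¹ ^ (j i - L)) * 4 := by
        refine ENNReal.tsum_le_tsum fun j => ?_
        rw [ENNReal.tsum_mul_left, Finset.prod_mul_distrib]
        gcongr
        · exact inv_two_pow_sum_tsub_le j L
        · exact tsum_inv_two_pow_dist_le _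
    _ = 4 * ∏ i, ∑' k : ℕ, ρ (i₀.succAbove i) ^ k * 2⁻¹ ^ (k - L) := by
        rw [ENNReal.tsum_mul_right, mul_comm,
          tsum_pi_prod_eq fun i k => ρ (i₀.succAbove i) ^ k * 2⁻¹ ^ (k - L)]
    _ ≤ 4 * ∏ i, b (i₀.succAbove i) := by
        gcongr with i
        exact hfac i
    _ = 4 * ∏ i, b i := by rw [Fin.prod_univ_succAbove _ i₀, hb0, one_mul]
    _ = _ := by rw [hb, mul_pow]; ring

end WeightedSum

section Profile

lemma exists_rpow_mul_exp_neg_le {c : ℝ} (hc : 0 < c) {p : ℝ} (hp : 0 ≤ p) :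
    ∃ K : ℝ, 0 < K ∧ ∀ z : ℝ, 0 < z → z ^ p * Real.exp (-(c * z)) ≤ K := by
  obtain ⟨N, hN⟩ := exists_nat_ge p
  refine ⟨1 + N.factorial / c ^ N, by positivity, fun z hz => ?_⟩
  have h1 : z ^ p ≤ 1 + z ^ N := by
    rcases le_total z 1 with h | h
    · have := Real.rpow_le_one hz.le h hp
      have := pow_pos hz N
      linarith
    · have := Real.rpow_le_rpow_of_exponent_le h hN
      rw [Real.rpow_natCast] at this
      linarith
  have h2 : z ^ N * Real.exp (-(c * z)) ≤ N.factorial / c ^ N := by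
    have := Real.pow_div_factorial_le_exp (c * z) (by positivity) N
    rw [Real.exp_neg, ← div_eq_mul_inv, div_le_div_iff₀ (Real.exp_pos _) (by positivity)]
    rw [div_le_iff₀ (by positivity), mul_pow] at this
    linarith
  have h3 : Real.exp (-(c * z)) ≤ 1 := Real.exp_le_one_iff.2 (by
    have := mul_pos hc hz
    linarith)
  calc z ^ p * Real.exp (-(c * z)) ≤ (1 + z ^ N) * Real.exp (-(c * z)) := by gcongr
    _ = Real.exp (-(c * z)) + z ^ N * Real.exp (-(c * z)) := by ring
    _ ≤ _ := add_le_add h3 h2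

lemma exists_rpow_mul_exp_neg_le_dist {c : ℝ} (hc : 0 < c) {p : ℝ} (hp : 1 ≤ p) :
    ∃ K : ℝ, 0 < K ∧ ∀ (n a L : ℕ), 2 ^ L ≤ n → n < 2 ^ (L + 1) →
      ((n : ℝ) * (1 / 2) ^ a) ^ p * Real.exp (-(c * ((n : ℝ) * (1 / 2) ^ a))) ≤
        K * (1 / 2) ^ ((a - L) + (L - a)) := by
  obtain ⟨K₁, hK₁, h₁⟩ := exists_rpow_mul_exp_neg_le hc (p := p - 1) (by linarith)
  obtain ⟨K₂, hK₂, h₂⟩ := exists_rpow_mul_exp_neg_le hc (p := p + 1) (by linarith)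
  refine ⟨2 * K₁ + K₂, by positivity, fun n a L hL hL' => ?_⟩
  have hL1 : (2 : ℝ) ^ L ≤ n := by exact_mod_cast hL
  have hL2 : (n : ℝ) ≤ 2 ^ (L + 1) := by exact_mod_cast hL'.le
  have hn : (0 : ℝ) < n := lt_of_lt_of_le (by positivity) hL1
  set z := (n : ℝ) * (1 / 2) ^ a with hz
  have hz0 : 0 < z := by positivity
  rcases le_total L a with h | h
  · have e : z ^ p = z * z ^ (p - 1) := by
      rw [← Real.rpow_one_add' hz0.le (by linarith)]; ring_nf
    have hzle : z ≤ 2 * (1 / 2) ^ (a - L) := by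
      calc z ≤ 2 ^ (L + 1) * (1 / 2) ^ a := by rw [hz]; gcongr
        _ = 2 * ((2 * (1 / 2)) ^ L * (1 / 2) ^ (a - L)) := by
          conv_lhs => rw [← Nat.add_sub_cancel' h, pow_add, pow_add]
          rw [mul_pow, pow_one]; ring
        _ = _ := by norm_num
    rw [Nat.sub_eq_zero_of_le h, add_zero, e, mul_assoc]
    calc z * (z ^ (p - 1) * Real.exp (-(c * z))) ≤ 2 * (1 / 2) ^ (a - L) * K₁ :=
          mul_le_mul hzle (h₁ z hz0) (by positivity) (by positivity)
      _ = 2 * K₁ * (1 / 2) ^ (a - L) := by ring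
      _ ≤ _ := by gcongr; linarith
  · have e : z ^ p = z⁻¹ * z ^ (p + 1) := by
      rw [Real.rpow_add_one hz0.ne']; field_simp
    have hzle : z⁻¹ ≤ (1 / 2) ^ (L - a) := by
      rw [one_div, inv_pow]
      refine inv_anti₀ (by positivity) ?_
      calc (2 : ℝ) ^ (L - a) = 2 ^ L * (1 / 2) ^ a := by
            rw [one_div, inv_pow, ← div_eq_mul_inv, pow_sub₀ _ (by norm_num) h, div_eq_mul_inv]
        _ ≤ z := by rw [hz]; gcongr
    rw [Nat.sub_eq_zero_of_le h, zero_add, e, mul_assoc]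
    calc z⁻¹ * (z ^ (p + 1) * Real.exp (-(c * z))) ≤ (1 / 2) ^ (L - a) * K₂ :=
          mul_le_mul hzle (h₂ z hz0) (by positivity) (by positivity)
      _ = K₂ * (1 / 2) ^ (L - a) := by ring
      _ ≤ _ := by gcongr; linarith

end Profile

section UpperBound

variable {m : ℕ} {dv : Fin m → ℕ} {βv : Fin m → ℝ}

lemma prod_rpow_pow_eq (s : Fin m → ℝ) (σ : ℝ) (j : Fin m → ℕ) :
    ∏ i, ((1 / 2 : ℝ) ^ s i) ^ j i =
      (∏ i, ((1 / 2 : ℝ) ^ (s i - σ)) ^ j i) * ((1 / 2 : ℝ) ^ ∑ i, j i) ^ σ := by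
  have : ((1 / 2 : ℝ) ^ ∑ i, j i) ^ σ = ∏ i, ((1 / 2 : ℝ) ^ σ) ^ j i := by
    rw [Finset.prod_pow_eq_pow_sum, ← Real.rpow_natCast, ← Real.rpow_natCast,
      ← Real.rpow_mul (by norm_num), ← Real.rpow_mul (by norm_num), mul_comm]
  rw [this, ← Finset.prod_mul_distrib]
  refine Finset.prod_congr rfl fun i _ => ?_
  rw [← mul_pow, ← Real.rpow_add (by norm_num), sub_add_cancel]

lemma exists_facet_term_le {d : ℕ} (hd : 2 ≤ d) {σ : ℝ} (hσ0 : 0 ≤ σ) (s : Fin m → ℝ) {c : ℝ}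
    (hc : 0 < c) {C : ℝ} (hC : 0 < C) :
    ∃ K : ℝ, 0 < K ∧ ∀ (n L : ℕ) (j : Fin m → ℕ), 2 * d ≤ n → 2 ^ L ≤ n → n < 2 ^ (L + 1) →
      (n : ℝ) ^ d * (C * (∏ i, ((1 / 2 : ℝ) ^ s i) ^ j i) * ((1 / 2 : ℝ) ^ ∑ i, j i) ^ (d - 1) *
        Real.exp (-(c * (1 / 2) ^ ∑ i, j i)) ^ (n - d)) ≤
      K * (n : ℝ) ^ (1 - σ) * ((∏ i, ((1 / 2 : ℝ) ^ (s i - σ)) ^ j i) *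
        (1 / 2) ^ ((∑ i, j i - L) + (L - ∑ i, j i))) := by
  have hd1 : (1 : ℝ) ≤ (d - 1 : ℕ) := by exact_mod_cast (by omega : 1 ≤ d - 1)
  have hdc : ((d - 1 : ℕ) : ℝ) = d - 1 := by rw [Nat.cast_sub (by omega), Nat.cast_one]
  obtain ⟨K, hK, h⟩ := exists_rpow_mul_exp_neg_le_dist (c := c / 2) (by positivity)
    (p := (d - 1 : ℕ) + σ) (by linarith)
  refine ⟨C * K, by positivity, fun n L j hn hL hL' => ?_⟩
  have hn0 : (0 : ℝ) < n := by exact_mod_cast (by omega : 0 < n)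
  set a := ∑ i, j i with ha
  set P := ∏ i, ((1 / 2 : ℝ) ^ (s i - σ)) ^ j i with hP
  have hP0 : 0 < P := Finset.prod_pos fun i _ => by positivity
  have ha0 : (0 : ℝ) < (1 / 2) ^ a := by positivity
  have hexp : Real.exp (-(c * (1 / 2) ^ a)) ^ (n - d) ≤
      Real.exp (-(c / 2 * ((n : ℝ) * (1 / 2) ^ a))) := by
    rw [← Real.exp_nat_mul, Real.exp_le_exp, Nat.cast_sub (by omega)]
    have h1 : (2 : ℝ) * d ≤ n := by exact_mod_cast hn
    have h2 : 0 < c * (1 / 2 : ℝ) ^ a := by positivity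
    nlinarith
  have hpow : (n : ℝ) ^ d = (n : ℝ) ^ (1 - σ) * (n : ℝ) ^ (((d - 1 : ℕ) : ℝ) + σ) := by
    rw [← Real.rpow_add hn0, hdc, ← Real.rpow_natCast]
    congr 1
    ring
  have hz : (n : ℝ) ^ (((d - 1 : ℕ) : ℝ) + σ) * (((1 / 2 : ℝ) ^ a) ^ σ *
      ((1 / 2 : ℝ) ^ a) ^ (d - 1)) = ((n : ℝ) * (1 / 2) ^ a) ^ (((d - 1 : ℕ) : ℝ) + σ) := by
    rw [Real.mul_rpow hn0.le ha0.le, Real.rpow_add ha0, Real.rpow_natCast]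
    ring
  calc _ = C * (n : ℝ) ^ (1 - σ) * P * (((n : ℝ) * (1 / 2) ^ a) ^ (((d - 1 : ℕ) : ℝ) + σ) *
        Real.exp (-(c * (1 / 2) ^ a)) ^ (n - d)) := by
        rw [prod_rpow_pow_eq s σ, ← hP, ← ha, hpow, ← hz]
        ring
    _ ≤ C * (n : ℝ) ^ (1 - σ) * P * (((n : ℝ) * (1 / 2) ^ a) ^ (((d - 1 : ℕ) : ℝ) + σ) *
        Real.exp (-(c / 2 * ((n : ℝ) * (1 / 2) ^ a)))) := by gcongr
    _ ≤ C * (n : ℝ) ^ (1 - σ) * P * (K * (1 / 2) ^ ((a - L) + (L - a))) := by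
        exact mul_le_mul_of_nonneg_left (h n a L hL hL') (by positivity)
    _ = _ := by ring

/-- Upper bound for the expected number of facets. -/
lemma exists_expectedFaceCount_le {d : ℕ} (hd : 2 ≤ d) (hsum : ∑ i, dv i = d)
    (hdv : ∀ i, 1 ≤ dv i) (hβ : ∀ i, 0 ≤ βv i) {σ : ℝ} {M : Finset (Fin m)} (hM : M.Nonempty)
    (hσ0 : 0 ≤ σ) (hσ : ∀ i ∈ M, (βv i + 1) / capExponent (βv i) (dv i) = σ)
    (hσ' : ∀ i, i ∉ M → σ < (βv i + 1) / capExponent (βv i) (dv i)) :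
    ∃ C : ℝ, 0 < C ∧ ∀ n : ℕ, 2 * d ≤ n →
      expectedFaceCount dv βv (d - 1) n ≤
        C * ((n : ℝ) ^ (1 - σ) * Real.log n ^ (M.card - 1)) := by
  let s : Fin m → ℝ := fun i => (βv i + 1) / capExponent (βv i) (dv i)
  obtain ⟨c, hc, C₀, hC₀, hI⟩ := exists_measure_isSupported_le (by omega) hsum hdv hβ
  obtain ⟨K₁, hK₁, hterm⟩ := exists_facet_term_le hd hσ0 s hc hC₀
  obtain ⟨K₂, hK₂, hweight⟩ := exists_tsum_weight_le hM
    (ρ := fun i => ENNReal.ofReal ((1 / 2 : ℝ) ^ (s i - σ)))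
    (fun i => by
      rw [← ENNReal.ofReal_one]
      refine ENNReal.ofReal_le_ofReal (Real.rpow_le_one (by norm_num) (by norm_num) ?_)
      by_cases h : i ∈ M
      · exact (sub_eq_zero.2 (hσ i h)).ge
      · exact (sub_pos.2 (hσ' i h)).le)
    (fun i h => by
      rw [← ENNReal.ofReal_one, ENNReal.ofReal_lt_ofReal_iff one_pos]
      exact Real.rpow_lt_one (by norm_num) (by norm_num) (sub_pos.2 (hσ' i h)))
  refine ⟨2 * K₁ * (K₂.toReal + 1) * 4 ^ (M.card - 1), by positivity, fun n hn => ?_⟩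
  have hn0 : (0 : ℝ) < n := by exact_mod_cast (by omega : 0 < n)
  set L := Nat.log 2 n with hLdef
  have hL : 2 ^ L ≤ n := Nat.pow_log_le_self 2 (by omega)
  have hL' : n < 2 ^ (L + 1) := Nat.lt_pow_succ_log_self (by norm_num) n
  have hlog : ((L + 1 : ℕ) : ℝ) ≤ 4 * Real.log n := by
    have h1 : (L : ℝ) * Real.log 2 ≤ Real.log n := by
      rw [← Real.log_pow]
      exact Real.log_le_log (by positivity) (by exact_mod_cast hL)
    have h2 : Real.log 2 ≤ Real.log n :=
      Real.log_le_log (by norm_num) (by exact_mod_cast (by omega : 2 ≤ n))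
    have h3 := Real.log_two_gt_d9
    push_cast
    nlinarith [(Nat.cast_nonneg L : (0 : ℝ) ≤ L)]
  rw [expectedFaceCount_eq (by omega) hsum hdv hβ n]
  have hlogn : 0 ≤ Real.log n := Real.log_natCast_nonneg n
  refine ENNReal.toReal_le_of_le_ofReal (by positivity) ?_
  calc _ ≤ ∑ I ∈ (Finset.univ : Finset (Fin n)).powersetCard d,
          2 * ∑' j : Fin m → ℕ, ENNReal.ofReal (C₀ * (∏ i, ((1 / 2 : ℝ) ^ s i) ^ j i) *
            ((1 / 2 : ℝ) ^ ∑ i, j i) ^ (d - 1) *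
            Real.exp (-(c * (1 / 2) ^ ∑ i, j i)) ^ (n - d)) :=
        Finset.sum_le_sum fun I hIc => hI n I (Finset.mem_powersetCard.1 hIc).2
    _ ≤ ENNReal.ofReal ((n : ℝ) ^ d) *
          (2 * ∑' j : Fin m → ℕ, ENNReal.ofReal (C₀ * (∏ i, ((1 / 2 : ℝ) ^ s i) ^ j i) *
            ((1 / 2 : ℝ) ^ ∑ i, j i) ^ (d - 1) *
            Real.exp (-(c * (1 / 2) ^ ∑ i, j i)) ^ (n - d))) := by
        rw [Finset.sum_const, nsmul_eq_mul, Finset.card_powersetCard, Finset.card_univ,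
          Fintype.card_fin, ← Nat.cast_pow, ENNReal.ofReal_natCast]
        gcongr
        exact Nat.choose_le_pow n d
    _ = 2 * ∑' j : Fin m → ℕ, ENNReal.ofReal ((n : ℝ) ^ d *
          (C₀ * (∏ i, ((1 / 2 : ℝ) ^ s i) ^ j i) * ((1 / 2 : ℝ) ^ ∑ i, j i) ^ (d - 1) *
            Real.exp (-(c * (1 / 2) ^ ∑ i, j i)) ^ (n - d))) := by
        rw [mul_left_comm, ← ENNReal.tsum_mul_left]
        simp_rw [← ENNReal.ofReal_mul (pow_nonneg hn0.le d)]
    _ ≤ 2 * ∑' j : Fin m → ℕ, ENNReal.ofReal (K₁ * (n : ℝ) ^ (1 - σ)) *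
          ((∏ i, ENNReal.ofReal ((1 / 2 : ℝ) ^ (s i - σ)) ^ j i) *
            2⁻¹ ^ ((∑ i, j i - L) + (L - ∑ i, j i))) := by
        gcongr with j
        refine (ENNReal.ofReal_le_ofReal (hterm n L j hn hL hL')).trans (le_of_eq ?_)
        have h2 : (2⁻¹ : ENNReal) = ENNReal.ofReal (1 / 2) := by
          rw [one_div, ENNReal.ofReal_inv_of_pos (by norm_num), ENNReal.ofReal_ofNat]
        rw [ENNReal.ofReal_mul (by positivity), ENNReal.ofReal_mul (Finset.prod_nonneg fun i _ => by
          positivity), ENNReal.ofReal_prod_of_nonneg (fun i _ => by positivity), h2,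
          ENNReal.ofReal_pow (by norm_num)]
        simp_rw [ENNReal.ofReal_pow (Real.rpow_nonneg (show (0 : ℝ) ≤ 1 / 2 by norm_num) _)]
    _ ≤ 2 * (ENNReal.ofReal (K₁ * (n : ℝ) ^ (1 - σ)) *
          (K₂ * ((L + 1 : ℕ) : ENNReal) ^ (M.card - 1))) := by
        rw [ENNReal.tsum_mul_left]
        gcongr
        exact hweight L
    _ = ENNReal.ofReal (2 * (K₁ * (n : ℝ) ^ (1 - σ) *
          (K₂.toReal * ((L + 1 : ℕ) : ℝ) ^ (M.card - 1)))) := by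
        rw [ENNReal.ofReal_mul (p := 2) (by norm_num),
          ENNReal.ofReal_mul (p := K₁ * (n : ℝ) ^ (1 - σ)) (by positivity),
          ENNReal.ofReal_mul (p := K₂.toReal) ENNReal.toReal_nonneg, ENNReal.ofReal_toReal hK₂,
          ENNReal.ofReal_pow (by positivity), ENNReal.ofReal_natCast, ENNReal.ofReal_ofNat]
    _ ≤ _ := by
        refine ENNReal.ofReal_le_ofReal ?_
        calc 2 * (K₁ * (n : ℝ) ^ (1 - σ) * (K₂.toReal * ((L + 1 : ℕ) : ℝ) ^ (M.card - 1)))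
            ≤ 2 * (K₁ * (n : ℝ) ^ (1 - σ) *
              ((K₂.toReal + 1) * (4 * Real.log n) ^ (M.card - 1))) := by
              gcongr
              linarith
          _ = _ := by rw [mul_pow]; ring

end UpperBound

/-- A real sequence that is eventually in `[c, C]` has its lower and upper limits there. -/
lemma le_liminf_and_limsup_le {u : ℕ → ℝ} {c C : ℝ} (hc : ∀ᶠ n in atTop, c ≤ u n)
    (hC : ∀ᶠ n in atTop, u n ≤ C) : c ≤ liminf u atTop ∧ limsup u atTop ≤ C :=
  ⟨le_liminf_of_le (IsBoundedUnder.isCoboundedUnder_ge ⟨C, hC⟩) hc,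
    limsup_le_of_le (IsBoundedUnder.isCoboundedUnder_le ⟨c, hc⟩) hC⟩

/-- **Theorem 1.1**: the expected number of facets of the random block-beta polytope
satisfies `E f_{d-1}(P_n^β) ≍ n^{(k_max−1)/(k_max+1)} (ln n)^{#k_max−1}`. -/
theorem expected_facets_block_beta
    (d m : ℕ) (hd : 2 ≤ d) (hm : 1 ≤ m) (hmd : m ≤ d)
    (dv : Fin m → ℕ) (hdv : ∀ i, 1 ≤ dv i) (hsum : ∑ i, dv i = d)
    (βv : Fin m → ℝ) (hβ : ∀ i, 0 ≤ βv i)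
    (k : Fin m → ℝ) (hk : ∀ i, k i = ((dv i : ℝ) + βv i) / (1 + βv i))
    (kmax : ℝ) (hkmax : IsGreatest (Set.range k) kmax)
    (nkmax : ℕ) (hnkmax : nkmax = (Finset.univ.filter fun i => k i = kmax).card) :
    ∃ c C : ℝ, 0 < c ∧ c ≤ C ∧
      c ≤ liminf (fun n : ℕ => expectedFaceCount dv βv (d - 1) n /
            ((n : ℝ) ^ ((kmax - 1) / (kmax + 1)) * Real.log n ^ (nkmax - 1))) atTop ∧
      limsup (fun n : ℕ => expectedFaceCount dv βv (d - 1) n /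
            ((n : ℝ) ^ ((kmax - 1) / (kmax + 1)) * Real.log n ^ (nkmax - 1))) atTop ≤ C := by
  have hkpos : ∀ i, 0 < k i := fun i => by
    have h1 : (1 : ℝ) ≤ dv i := by exact_mod_cast hdv i
    have h2 := hβ i
    rw [hk]
    positivity
  have hs : ∀ i, (βv i + 1) / capExponent (βv i) (dv i) = 2 / (k i + 1) := fun i => by
    have h1 : (1 : ℝ) ≤ dv i := by exact_mod_cast hdv i
    have h2 := hβ i
    have h3 : 1 + βv i ≠ 0 := by positivity
    have h4 : ((dv i : ℝ) + 1) / 2 + βv i ≠ 0 := by positivity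
    have h5 : ((dv i : ℝ) + βv i) / (1 + βv i) + 1 ≠ 0 := by positivity
    rw [hk, capExponent, div_eq_div_iff h4 h5]
    field_simp
    ring
  obtain ⟨⟨i₀, hi₀⟩, hle⟩ := hkmax
  have hkmax0 : 0 < kmax := hi₀ ▸ hkpos i₀
  set M := Finset.univ.filter fun i => k i = kmax with hMdef
  have hM : M.Nonempty := ⟨i₀, by simp [hMdef, hi₀]⟩
  have hσ : ∀ i ∈ M, (βv i + 1) / capExponent (βv i) (dv i) = 2 / (kmax + 1) := fun i hi => by
    rw [hs, (Finset.mem_filter.1 hi).2]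
  have hσ' : ∀ i, i ∉ M → 2 / (kmax + 1) < (βv i + 1) / capExponent (βv i) (dv i) :=
    fun i hi => by
      have h1 : k i < kmax := lt_of_le_of_ne (hle ⟨i, rfl⟩) fun h => hi (by simp [hMdef, h])
      have h2 := hkpos i
      rw [hs]
      gcongr
  have hexp : (kmax - 1) / (kmax + 1) = 1 - 2 / (kmax + 1) := by
    field_simp
    ring
  obtain ⟨c, hc, hlower⟩ := exists_le_expectedFaceCount hd hm hsum hdv hβ hM (by positivity) hσ
  obtain ⟨C, -, hupper⟩ := exists_expectedFaceCount_le hd hsum hdv hβ hM (by positivity) hσ hσ'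
  have hpos : ∀ n : ℕ, 2 * d ≤ n →
      0 < (n : ℝ) ^ (1 - 2 / (kmax + 1)) * Real.log n ^ (M.card - 1) := fun n hn => by
    have h1 : (1 : ℝ) < n := by exact_mod_cast (by omega : 1 < n)
    have h2 := Real.log_pos h1
    positivity
  rw [hnkmax, hexp]
  refine ⟨c, max c C, hc, le_max_left _ _, le_liminf_and_limsup_le ?_ ?_⟩
  · filter_upwards [eventually_ge_atTop (2 * d)] with n hn
    exact (le_div_iff₀ (hpos n hn)).2 (hlower n (by omega))
  · filter_upwards [eventually_ge_atTop (2 * d)] with n hn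
    exact ((div_le_iff₀ (hpos n hn)).2 (hupper n hn)).trans (le_max_right _ _)
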